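/- arXiv:2110.01855 — 5 statements merged into one kernel-verified Lean document; each statement's English description precedes it below -/
import Mathlib

section
/- Let p be a prime number. The p-adic Thue–Morse number ξ_{t,p} satisfies μ×(ξ_{t,p}) = 3. -/
open Filter

noncomputable def multIrrExp (p : ℕ) [Fact p.Prime] (ξ : ℚ_[p]) : EReal :=
  sSup {e : EReal | ∃ μ : ℝ, e = (μ : EReal) ∧
    {ab : ℤ × ℤ | 0 < ‖(ab.2 : ℚ_[p]) * ξ - (ab.1 : ℚ_[p])‖ ∧
      ‖(ab.2 : ℚ_[p]) * ξ - (ab.1 : ℚ_[p])‖ ≤ ((|ab.1 * ab.2| : ℤ) : ℝ) ^ (-μ / 2)}.Infinite}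

open Finset in
/-- The product `∏_{k<n} (1 - x^{2^k})`. -/
def tmProd (x : ℤ) (n : ℕ) : ℤ := ∏ k ∈ range n, (1 - x ^ 2 ^ k)

theorem tmProd_succ (x : ℤ) (n : ℕ) : tmProd x (n + 1) = tmProd x n * (1 - x ^ 2 ^ n) :=
  Finset.prod_range_succ _ _

theorem one_sub_pow_dvd_one_sub_pow {x : ℤ} {n k : ℕ} (h : k < n) :
    (1 - x ^ 2 ^ k) ∣ (1 - x ^ 2 ^ n) := by
  obtain ⟨c, rfl⟩ := Nat.exists_eq_add_of_lt h
  have := sub_dvd_pow_sub_pow (1 : ℤ) (x ^ 2 ^ k) (2 ^ (c + 1))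
  rwa [one_pow, ← pow_mul, ← pow_add, ← add_assoc] at this

theorem isCoprime_tmProd {x h : ℤ} {n : ℕ} (hx : IsCoprime h (1 - x ^ 2 ^ n)) :
    IsCoprime h (tmProd x n) :=
  IsCoprime.prod_right fun _ hk =>
    hx.of_isCoprime_of_dvd_right (one_sub_pow_dvd_one_sub_pow (Finset.mem_range.1 hk))

theorem abs_tmProd_le {x : ℤ} (hx : 1 ≤ x) (n : ℕ) : |tmProd x n| ≤ x ^ 2 ^ n := by
  induction n with
  | zero => simpa [tmProd] using hx
  | succ n ih =>
    have h1 : |1 - x ^ 2 ^ n| ≤ x ^ 2 ^ n := by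
      have : 1 ≤ x ^ 2 ^ n := one_le_pow₀ hx
      rw [abs_le]; constructor <;> linarith
    rw [tmProd_succ, abs_mul, pow_succ, pow_mul, sq]
    gcongr

/-- A strengthened lower bound, suited to induction. -/
theorem le_abs_tmProd {x : ℤ} (hx : 2 ≤ x) (n : ℕ) :
    x ^ 2 ^ (n + 1) + 4 ≤ 4 * x * |tmProd x (n + 1)| := by
  induction n with
  | zero =>
    have : |tmProd x 1| = x - 1 := by
      simp only [tmProd, Finset.prod_range_one, pow_zero, pow_one]
      rw [abs_sub_comm, abs_of_nonneg (by linarith)]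
    rw [zero_add, this, pow_one]
    nlinarith [mul_nonneg (show (0 : ℤ) ≤ 3 * x + 2 by linarith) (sub_nonneg.2 hx)]
  | succ n ih =>
    have h4 : 4 ≤ x ^ 2 ^ (n + 1) := by
      calc (4 : ℤ) = 2 ^ 2 := by norm_num
        _ ≤ x ^ 2 := by gcongr
        _ ≤ x ^ 2 ^ (n + 1) := by
          gcongr
          · linarith
          · rw [pow_succ]; have := Nat.one_le_two_pow (n := n); omega
    rw [tmProd_succ, abs_mul, pow_succ 2 (n + 1), pow_mul]
    set y := x ^ 2 ^ (n + 1)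
    have : |1 - y| = y - 1 := by rw [abs_sub_comm, abs_of_nonneg (by linarith)]
    rw [this]
    have := mul_le_mul_of_nonneg_right ih (show (0 : ℤ) ≤ y - 1 by linarith)
    nlinarith

theorem sum_range_two_pow_eq_tmProd {t : ℕ → ℤ} (ht0 : t 0 = 1)
    (hte : ∀ n, t (2 * n) = t n) (hto : ∀ n, t (2 * n + 1) = - t n) (n : ℕ) (x : ℤ) :
    ∑ i ∈ Finset.range (2 ^ n), t i * x ^ i = tmProd x n := by
  induction n generalizing x with
  | zero => simp [tmProd, ht0]
  | succ n ih =>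
    have h (m : ℕ) : ∑ i ∈ Finset.range (2 * m), t i * x ^ i =
        (1 - x) * ∑ i ∈ Finset.range m, t i * (x ^ 2) ^ i := by
      induction m with
      | zero => simp
      | succ m ihm =>
        rw [Nat.mul_succ, Finset.sum_range_succ, Finset.sum_range_succ, ihm,
          Finset.sum_range_succ, hte, hto]
        ring
    rw [pow_succ', h, ih, tmProd, tmProd, Finset.prod_range_succ']
    simp only [← pow_mul, pow_zero, pow_one, ← pow_succ']
    ring

theorem abs_le_of_dvd_tmProd_mul_of_dvd_one_add {p n : ℕ} {d : ℤ}
    (h₁ : d ∣ tmProd p (n + 1) * (1 - 2 * ((p : ℤ) ^ 2 ^ (n + 1)) ^ 2))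
    (h₂ : d ∣ 1 + (p : ℤ) ^ 2 ^ (n + 1)) : |d| ≤ 2 := by
  set X := (p : ℤ) ^ 2 ^ (n + 1) with hX
  obtain ⟨h, hh, hdvd⟩ : ∃ h : ℤ, IsCoprime h (1 - X) ∧ 1 + X ∣ 2 * h := by
    have hsq : X = ((p : ℤ) ^ 2 ^ n) ^ 2 := by rw [← pow_mul, ← pow_succ]
    rcases Int.even_or_odd' ((p : ℤ) ^ 2 ^ n) with ⟨j, hj | hj⟩
    · refine ⟨1 + X, ⟨1 - 2 * j ^ 2, -(2 * j ^ 2), ?_⟩, Dvd.intro_left _ rfl⟩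
      rw [hsq, hj]; ring
    · refine ⟨2 * (j * (j + 1)) + 1, ⟨2 * (j * (j + 1)) + 1, j * (j + 1) + 1, ?_⟩, ?_⟩
      · rw [hsq, hj]; ring
      · rw [hsq, hj]
        exact ⟨1, by ring⟩
  have hdP : IsCoprime d (1 - 2 * X ^ 2) :=
    IsCoprime.of_isCoprime_of_dvd_left (y := 1 + X) ⟨2 * (1 - X), -1, by ring⟩ h₂
  have hdT : d ∣ tmProd p (n + 1) := hdP.dvd_of_dvd_mul_right h₁
  have hhd : IsCoprime d h :=
    ((isCoprime_tmProd hh).of_isCoprime_of_dvd_right hdT).symm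
  exact Int.le_of_dvd two_pos
    ((abs_dvd _ _).2 (hhd.dvd_of_dvd_mul_right (h₂.trans hdvd)))

theorem pow_two_le_abs_one_sub {X : ℤ} (hX : 16 ≤ X) :
    X ^ 2 ≤ 16 * |1 - 2 * X ^ 2| ∧ |1 - 2 * X ^ 2| ≤ 16 * X ^ 2 := by
  rw [abs_of_nonpos (by nlinarith)]
  constructor <;> nlinarith

theorem pow_one_le_abs_one_add {X : ℤ} (hX : 16 ≤ X) :
    X ^ 1 ≤ 16 * |1 + X| ∧ |1 + X| ≤ 16 * X ^ 1 := by
  rw [abs_of_nonneg (by linarith), pow_one]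
  constructor <;> linarith

section Padic

variable {p : ℕ} [Fact p.Prime]

theorem norm_tmProd (n : ℕ) : ‖((tmProd p n : ℤ) : ℚ_[p])‖ = 1 := by
  refine le_antisymm (Padic.norm_int_le_one _) (not_lt.1 fun h => ?_)
  rw [Padic.norm_intCast_lt_one_iff] at h
  have h1 : IsCoprime (p : ℤ) (1 - (p : ℤ) ^ 2 ^ n) :=
    ⟨(p : ℤ) ^ (2 ^ n - 1), 1, by
      rw [← pow_succ, Nat.sub_add_cancel Nat.one_le_two_pow]; ring⟩
  have := (isCoprime_tmProd h1).isUnit_of_dvd' dvd_rfl h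
  exact (Nat.prime_iff_prime_int.1 Fact.out).not_isUnit this

theorem exists_eq_tmProd_mul {t : ℕ → ℤ} (ht0 : t 0 = 1)
    (hte : ∀ n, t (2 * n) = t n) (hto : ∀ n, t (2 * n + 1) = - t n) (n : ℕ) :
    ∃ r : ℤ_[p], ∑' i : ℕ, (t i : ℚ_[p]) * (p : ℚ_[p]) ^ i =
      (tmProd p n : ℤ) * (1 + (p : ℚ_[p]) ^ 2 ^ n * r) := by
  have hp1 : ‖(p : ℚ_[p])‖ < 1 := Padic.norm_p_lt_one
  have hle (s : ℕ → ℤ) (i : ℕ) : ‖(s i : ℚ_[p]) * (p : ℚ_[p]) ^ i‖ ≤ ‖(p : ℚ_[p])‖ ^ i := by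
    rw [norm_mul, norm_pow]
    exact mul_le_of_le_one_left (by positivity) (Padic.norm_int_le_one _)
  have hs (s : ℕ → ℤ) : Summable fun i : ℕ => (s i : ℚ_[p]) * (p : ℚ_[p]) ^ i :=
    .of_norm_bounded (summable_geometric_of_lt_one (norm_nonneg _) hp1) (hle s)
  set u : ℚ_[p] := ∑' i : ℕ, (t (i + 2 ^ n) : ℚ_[p]) * (p : ℚ_[p]) ^ i with hu
  have hu1 : ‖u‖ ≤ 1 :=
    IsUltrametricDist.norm_tsum_le_of_forall_le_of_nonneg zero_le_one fun i =>
      (hle (fun i => t (i + 2 ^ n)) i).trans (pow_le_one₀ (norm_nonneg _) hp1.le)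
  have hT := norm_tmProd (p := p) n
  have hT0 : ((tmProd p n : ℤ) : ℚ_[p]) ≠ 0 := by
    rw [← norm_ne_zero_iff, hT]; exact one_ne_zero
  have hr : ‖u / (tmProd p n : ℤ)‖ ≤ 1 := by rwa [norm_div, hT, div_one]
  refine ⟨⟨_, hr⟩, ?_⟩
  rw [← (hs t).sum_add_tsum_nat_add (2 ^ n)]
  have h1 := sum_range_two_pow_eq_tmProd ht0 hte hto n p
  have h2 : ∑' i : ℕ, (t (i + 2 ^ n) : ℚ_[p]) * (p : ℚ_[p]) ^ (i + 2 ^ n) =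
      (p : ℚ_[p]) ^ 2 ^ n * u := by
    rw [hu, ← tsum_mul_left]
    exact tsum_congr fun i => by ring
  have h3 : ∑ i ∈ Finset.range (2 ^ n), (t i : ℚ_[p]) * (p : ℚ_[p]) ^ i = (tmProd p n : ℤ) := by
    rw [← h1]; push_cast; rfl
  rw [h2, h3]
  field_simp

theorem one_le_abs_mul_norm {z : ℤ} (hz : z ≠ 0) : 1 ≤ |(z : ℝ)| * ‖(z : ℚ_[p])‖ := by
  have hp : (0 : ℝ) < p := by exact_mod_cast (Fact.out : p.Prime).pos
  have h0 : (z : ℚ_[p]) ≠ 0 := by exact_mod_cast hz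
  have hd : (p : ℤ) ^ padicValInt p z ∣ z := padicValInt_dvd z
  have hl : (p : ℝ) ^ padicValInt p z ≤ |(z : ℝ)| := by
    exact_mod_cast Int.le_of_dvd (abs_pos.2 hz) ((dvd_abs _ _).2 hd)
  rw [Padic.norm_eq_zpow_neg_valuation h0, Padic.valuation_intCast, zpow_neg, zpow_natCast]
  rw [← div_eq_mul_inv]
  exact (one_le_div (by positivity)).2 hl

theorem le_or_min_le_of_approx {ξ : ℚ_[p]} {a b A B : ℤ} {w α β V u v γ c : ℝ} (hb0 : b ≠ 0)
    (ha : |(a : ℝ)| ≤ (p : ℝ) ^ α) (hb : |(b : ℝ)| ≤ (p : ℝ) ^ β)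
    (hw : ‖(b : ℚ_[p]) * ξ - a‖ ≤ (p : ℝ) ^ (-w))
    (hV : ‖(B : ℚ_[p]) * ξ - A‖ ≤ (p : ℝ) ^ (-V))
    (hV' : (p : ℝ) ^ (-V - c) ≤ ‖(B : ℚ_[p]) * ξ - A‖)
    (hA : |(A : ℝ)| ≤ (p : ℝ) ^ (u + c)) (hA' : (p : ℝ) ^ (u - c) ≤ |(A : ℝ)|)
    (hB : |(B : ℝ)| ≤ (p : ℝ) ^ (v + c)) (hB' : (p : ℝ) ^ (v - c) ≤ |(B : ℝ)|)
    (hg : ∀ d : ℤ, d ∣ A → d ∣ B → |(d : ℝ)| ≤ (p : ℝ) ^ (γ + c))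
    (hVγ : V ≤ 3 / 2 * (u + v) - 3 * γ) :
    w ≤ 3 / 2 * (α + β) + 7 * c ∨ min w V ≤ α + v + c + 1 ∨ min w V ≤ β + u + c + 1 := by
  have hp1 : (1 : ℝ) < p := by exact_mod_cast (Fact.out : p.Prime).one_lt
  have hp2 : (2 : ℝ) ≤ p := by exact_mod_cast (Fact.out : p.Prime).two_le
  have hp : (0 : ℝ) < p := by positivity
  by_cases h : a * B = b * A
  · left
    have hB0 : B ≠ 0 := by
      rintro rfl
      have : (0 : ℝ) < (p : ℝ) ^ (v - c) := by positivity
      simp only [Int.cast_zero, abs_zero] at hB'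
      linarith
    obtain ⟨A₁, hA₁⟩ := Int.gcd_dvd_left A B
    obtain ⟨B₁, hB₁⟩ := Int.gcd_dvd_right A B
    set g : ℤ := ((Int.gcd A B : ℕ) : ℤ) with hgdef
    have hg0 : g ≠ 0 := by rintro h0; rw [h0, zero_mul] at hB₁; exact hB0 hB₁
    have hB₁0 : B₁ ≠ 0 := by rintro rfl; rw [mul_zero] at hB₁; exact hB0 hB₁
    have hco : IsCoprime B₁ A₁ := by
      refine ⟨Int.gcdB A B, Int.gcdA A B, ?_⟩
      have := Int.gcd_eq_gcd_ab A B
      rw [← hgdef] at this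
      apply mul_left_cancel₀ hg0
      linear_combination -Int.gcdB A B * hB₁ - Int.gcdA A B * hA₁ - this
    have h' : a * B₁ = b * A₁ := by
      apply mul_left_cancel₀ hg0
      linear_combination h - a * hB₁ + b * hA₁
    obtain ⟨k, rfl⟩ : B₁ ∣ b := hco.dvd_of_dvd_mul_right ⟨a, by rw [← h', mul_comm]⟩
    have hk0 : k ≠ 0 := by rintro rfl; simp at hb0
    obtain rfl : a = A₁ * k := by
      apply mul_left_cancel₀ hB₁0
      linear_combination h'
    have hkpos : (0 : ℝ) < |(k : ℝ)| := by positivity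
    obtain ⟨κ, hκ⟩ : ∃ κ : ℝ, |(k : ℝ)| = (p : ℝ) ^ κ :=
      ⟨Real.logb p |(k : ℝ)|, (Real.rpow_logb hp hp1.ne' hkpos).symm⟩
    have hκ0 : 0 ≤ κ := by
      have : (1 : ℝ) ≤ |(k : ℝ)| := by exact_mod_cast Int.one_le_abs hk0
      rw [hκ, ← Real.rpow_zero (p : ℝ)] at this
      exact (Real.rpow_le_rpow_left_iff hp1).1 this
    have e1 : -V - c ≤ κ - w := by
      rw [← Real.rpow_le_rpow_left_iff hp1]
      calc (p : ℝ) ^ (-V - c) ≤ ‖(B : ℚ_[p]) * ξ - A‖ := hV'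
        _ = ‖(g : ℚ_[p])‖ * ‖(B₁ : ℚ_[p]) * ξ - A₁‖ := by
          rw [hA₁, hB₁, ← norm_mul]; push_cast; ring_nf
        _ ≤ 1 * ‖(B₁ : ℚ_[p]) * ξ - A₁‖ := by gcongr; exact Padic.norm_int_le_one _
        _ ≤ (|(k : ℝ)| * ‖(k : ℚ_[p])‖) * ‖(B₁ : ℚ_[p]) * ξ - A₁‖ := by
          gcongr; exact one_le_abs_mul_norm hk0
        _ = |(k : ℝ)| * ‖((B₁ * k : ℤ) : ℚ_[p]) * ξ - (A₁ * k : ℤ)‖ := by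
          rw [mul_assoc, ← norm_mul]; push_cast; ring_nf
        _ ≤ |(k : ℝ)| * (p : ℝ) ^ (-w) := by gcongr
        _ = (p : ℝ) ^ (κ - w) := by rw [hκ, ← Real.rpow_add hp, sub_eq_add_neg]
    have e2 : (u - c) + (v - c) + (κ + κ) ≤ (γ + c) + (γ + c) + (α + β) := by
      rw [← Real.rpow_le_rpow_left_iff hp1]
      calc (p : ℝ) ^ ((u - c) + (v - c) + (κ + κ))
          = (p : ℝ) ^ (u - c) * (p : ℝ) ^ (v - c) * (|(k : ℝ)| * |(k : ℝ)|) := by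
            rw [hκ, ← Real.rpow_add hp, ← Real.rpow_add hp, ← Real.rpow_add hp]
        _ ≤ |(A : ℝ)| * |(B : ℝ)| * (|(k : ℝ)| * |(k : ℝ)|) := by gcongr
        _ = |(g : ℝ)| * |(g : ℝ)| * (|((A₁ * k : ℤ) : ℝ)| * |((B₁ * k : ℤ) : ℝ)|) := by
          rw [hA₁, hB₁]; push_cast; simp only [abs_mul]; ring
        _ ≤ (p : ℝ) ^ (γ + c) * (p : ℝ) ^ (γ + c) * ((p : ℝ) ^ α * (p : ℝ) ^ β) := by
          have := hg g ⟨_, hA₁⟩ ⟨_, hB₁⟩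
          gcongr
        _ = _ := by rw [← Real.rpow_add hp, ← Real.rpow_add hp, ← Real.rpow_add hp]
    linarith
  · right
    have hz : a * B - b * A ≠ 0 := sub_ne_zero.2 h
    have e1 : ‖((a * B - b * A : ℤ) : ℚ_[p])‖ ≤ (p : ℝ) ^ (-min w V) := by
      have : ((a * B - b * A : ℤ) : ℚ_[p]) = b * (B * ξ - A) - B * (b * ξ - a) := by
        push_cast; ring
      rw [this, sub_eq_add_neg]
      refine (Padic.nonarchimedean _ _).trans (max_le ?_ ?_)
      · rw [norm_mul]
        refine (mul_le_of_le_one_left (norm_nonneg _) (Padic.norm_int_le_one _)).trans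
          (hV.trans ?_)
        gcongr
        · exact hp1.le
        · exact min_le_right _ _
      · rw [norm_neg, norm_mul]
        refine (mul_le_of_le_one_left (norm_nonneg _) (Padic.norm_int_le_one _)).trans
          (hw.trans ?_)
        gcongr
        · exact hp1.le
        · exact min_le_left _ _
    have e2 : |((a * B - b * A : ℤ) : ℝ)| ≤ (p : ℝ) ^ (1 + max (α + v + c) (β + u + c)) := by
      calc |((a * B - b * A : ℤ) : ℝ)| ≤ |(a : ℝ)| * |(B : ℝ)| + |(b : ℝ)| * |(A : ℝ)| := by
            push_cast; rw [← abs_mul, ← abs_mul]; exact abs_sub _ _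
        _ ≤ (p : ℝ) ^ α * (p : ℝ) ^ (v + c) + (p : ℝ) ^ β * (p : ℝ) ^ (u + c) := by gcongr
        _ = (p : ℝ) ^ (α + v + c) + (p : ℝ) ^ (β + u + c) := by
          rw [← Real.rpow_add hp, ← Real.rpow_add hp, add_assoc, add_assoc]
        _ ≤ (p : ℝ) ^ max (α + v + c) (β + u + c) + (p : ℝ) ^ max (α + v + c) (β + u + c) := by
          gcongr
          · exact hp1.le
          · exact le_max_left _ _
          · exact hp1.le
          · exact le_max_right _ _
        _ = 2 * (p : ℝ) ^ max (α + v + c) (β + u + c) := by ring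
        _ ≤ p * (p : ℝ) ^ max (α + v + c) (β + u + c) := by gcongr
        _ = _ := by rw [Real.rpow_add hp, Real.rpow_one]
    have e3 : 0 ≤ 1 + max (α + v + c) (β + u + c) + -min w V := by
      rw [← Real.rpow_le_rpow_left_iff hp1, Real.rpow_zero, Real.rpow_add hp]
      refine (one_le_abs_mul_norm (p := p) hz).trans ?_
      gcongr
    rcases max_cases (α + v + c) (β + u + c) with ⟨h, -⟩ | ⟨h, -⟩ <;> rw [h] at e3
    · left; linarith
    · right; linarith

/-- If `P / Q` (values at `X = p ^ 2 ^ n`) is a Padé approximant of the Thue–Morse series,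
of order exactly `W`, then `tmProd p n * P / Q` is a good approximation of `ξ`. -/
theorem norm_pade {ξ : ℚ_[p]} (hξ : ∀ n, ∃ r : ℤ_[p], ξ =
      (tmProd p n : ℤ) * (1 + (p : ℚ_[p]) ^ 2 ^ n * r)) {n W : ℕ} (hn : 2 ≤ n) {P Q e : ℤ}
    (he0 : e ≠ 0) (he : |e| ≤ 4)
    (hs : ∀ X r : ℤ_[p], X = (p : ℤ_[p]) ^ 2 ^ n → ∃ s : ℤ_[p],
      Q * ((1 - X) * (1 - X ^ 2) * (1 - X ^ 4) * (1 + X ^ 8 * r)) - P = X ^ W * (e + X * s)) :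
    ‖(Q : ℚ_[p]) * ξ - (tmProd p n * P : ℤ)‖ ≤ (p : ℝ) ^ (-(W * (2 : ℝ) ^ n)) ∧
    (p : ℝ) ^ (-(W * (2 : ℝ) ^ n) - 10) ≤ ‖(Q : ℚ_[p]) * ξ - (tmProd p n * P : ℤ)‖ := by
  have hp1 : (1 : ℝ) < p := by exact_mod_cast (Fact.out : p.Prime).one_lt
  have hp2 : (2 : ℝ) ≤ p := by exact_mod_cast (Fact.out : p.Prime).two_le
  have hp : (0 : ℝ) < p := by positivity
  obtain ⟨r, hr⟩ := hξ (n + 3)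
  obtain ⟨s, hs⟩ := hs _ r rfl
  have hT : tmProd (p : ℤ) (n + 3) = tmProd p n *
      ((1 - (p : ℤ) ^ 2 ^ n) * (1 - ((p : ℤ) ^ 2 ^ n) ^ 2) * (1 - ((p : ℤ) ^ 2 ^ n) ^ 4)) := by
    rw [tmProd_succ, tmProd_succ, tmProd_succ]
    simp only [pow_succ, pow_mul, pow_zero]
    ring
  have key : (Q : ℚ_[p]) * ξ - (tmProd p n * P : ℤ) =
      (tmProd p n : ℤ) * (((p : ℚ_[p]) ^ 2 ^ n) ^ W * (e + (p : ℚ_[p]) ^ 2 ^ n * s)) := by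
    have hs' := congrArg (fun z : ℤ_[p] => (z : ℚ_[p])) hs
    push_cast at hs'
    have h8 : (p : ℚ_[p]) ^ 2 ^ (n + 3) = ((p : ℚ_[p]) ^ 2 ^ n) ^ 8 := by
      rw [pow_add, pow_mul]; norm_num
    rw [hr, hT, h8]
    push_cast
    linear_combination ((tmProd p n : ℤ) : ℚ_[p]) * hs'
  have hX : ‖(p : ℚ_[p]) ^ 2 ^ n‖ = (p : ℝ) ^ (-(2 : ℝ) ^ n) := by
    rw [norm_pow, Padic.norm_p, inv_pow, Real.rpow_neg hp.le, ← Real.rpow_natCast]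
    push_cast; rfl
  have hXW : ‖((p : ℚ_[p]) ^ 2 ^ n) ^ W‖ = (p : ℝ) ^ (-(W * (2 : ℝ) ^ n)) := by
    rw [norm_pow, hX, ← Real.rpow_natCast, ← Real.rpow_mul hp.le]
    congr 1; ring
  have hX4 : ‖(p : ℚ_[p]) ^ 2 ^ n * s‖ < 1 / 4 := by
    have h4 : (4 : ℝ) ≤ 2 ^ n := by
      calc (4 : ℝ) = 2 ^ 2 := by norm_num
        _ ≤ 2 ^ n := by gcongr; norm_num
    calc ‖(p : ℚ_[p]) ^ 2 ^ n * s‖ ≤ ‖(p : ℚ_[p]) ^ 2 ^ n‖ := by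
          rw [norm_mul]; exact mul_le_of_le_one_right (norm_nonneg _) s.2
      _ = (p : ℝ) ^ (-(2 : ℝ) ^ n) := hX
      _ ≤ (p : ℝ) ^ (-4 : ℝ) := by gcongr; exact hp1.le
      _ ≤ (2 : ℝ) ^ (-4 : ℝ) := Real.rpow_le_rpow_of_nonpos (by norm_num) hp2 (by norm_num)
      _ < 1 / 4 := by
        rw [Real.rpow_neg (by norm_num)]; norm_num
  have he4 : 1 / 4 ≤ ‖(e : ℚ_[p])‖ := by
    have h1 := one_le_abs_mul_norm (p := p) he0
    have h2 : |(e : ℝ)| ≤ 4 := by exact_mod_cast he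
    have h3 : |(e : ℝ)| * ‖(e : ℚ_[p])‖ ≤ 4 * ‖(e : ℚ_[p])‖ := by gcongr
    linarith
  have hes : ‖(e : ℚ_[p]) + (p : ℚ_[p]) ^ 2 ^ n * s‖ = ‖(e : ℚ_[p])‖ := by
    rw [Padic.add_eq_max_of_ne (by linarith [hX4.trans_le he4]), max_eq_left (hX4.le.trans he4)]
  rw [key, norm_mul, norm_tmProd, one_mul, norm_mul, hXW, hes]
  refine ⟨mul_le_of_le_one_right (by positivity) (Padic.norm_int_le_one _), ?_⟩
  rw [sub_eq_add_neg, Real.rpow_add hp]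
  gcongr
  calc (p : ℝ) ^ (-10 : ℝ) ≤ (2 : ℝ) ^ (-10 : ℝ) :=
        Real.rpow_le_rpow_of_nonpos (by norm_num) hp2 (by norm_num)
    _ ≤ 1 / 4 := by rw [Real.rpow_neg (by norm_num)]; norm_num
    _ ≤ _ := he4

theorem rpow_bounds_of_pow_bounds {n m : ℕ} {P : ℤ} (h₁ : ((p : ℤ) ^ 2 ^ n) ^ m ≤ 16 * |P|)
    (h₂ : |P| ≤ 16 * ((p : ℤ) ^ 2 ^ n) ^ m) :
    (p : ℝ) ^ (m * (2 : ℝ) ^ n - 4) ≤ |(P : ℝ)| ∧ |(P : ℝ)| ≤ (p : ℝ) ^ (m * (2 : ℝ) ^ n + 4) := by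
  have hp2 : (2 : ℝ) ≤ p := by exact_mod_cast (Fact.out : p.Prime).two_le
  have hp : (0 : ℝ) < p := by positivity
  have h16 : (16 : ℝ) ≤ (p : ℝ) ^ (4 : ℝ) := by
    calc (16 : ℝ) = 2 ^ (4 : ℝ) := by norm_num
      _ ≤ _ := by gcongr
  have hX : (p : ℝ) ^ (m * (2 : ℝ) ^ n) = ((p : ℝ) ^ 2 ^ n) ^ m := by
    rw [← pow_mul, ← Real.rpow_natCast (p : ℝ)]; push_cast; rw [mul_comm]
  have h₁' : ((p : ℝ) ^ 2 ^ n) ^ m ≤ 16 * |(P : ℝ)| := by exact_mod_cast h₁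
  have h₂' : |(P : ℝ)| ≤ 16 * ((p : ℝ) ^ 2 ^ n) ^ m := by exact_mod_cast h₂
  rw [Real.rpow_sub hp, Real.rpow_add hp, hX]
  constructor
  · rw [div_le_iff₀ (by positivity), mul_comm]
    exact h₁'.trans (by gcongr)
  · rw [mul_comm]
    exact h₂'.trans (by gcongr)

theorem rpow_bounds_tmProd {n : ℕ} (hn : 1 ≤ n) :
    (p : ℝ) ^ ((2 : ℝ) ^ n - 3) ≤ |((tmProd p n : ℤ) : ℝ)| ∧
      |((tmProd p n : ℤ) : ℝ)| ≤ (p : ℝ) ^ (2 : ℝ) ^ n := by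
  have hp2 : (2 : ℝ) ≤ p := by exact_mod_cast (Fact.out : p.Prime).two_le
  have hp : (0 : ℝ) < p := by positivity
  have hX : (p : ℝ) ^ (2 : ℝ) ^ n = (p : ℝ) ^ 2 ^ n := by
    rw [← Real.rpow_natCast (p : ℝ)]; push_cast; rfl
  have hz : (2 : ℤ) ≤ p := by exact_mod_cast (Fact.out : p.Prime).two_le
  obtain ⟨j, rfl⟩ := Nat.exists_eq_add_of_le' hn
  have h1 : (p : ℝ) ^ 2 ^ (j + 1) + 4 ≤ 4 * p * |((tmProd p (j + 1) : ℤ) : ℝ)| := by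
    exact_mod_cast le_abs_tmProd hz j
  have h2 : |((tmProd p (j + 1) : ℤ) : ℝ)| ≤ (p : ℝ) ^ 2 ^ (j + 1) := by
    exact_mod_cast abs_tmProd_le (by linarith : (1 : ℤ) ≤ p) (j + 1)
  rw [Real.rpow_sub hp, hX]
  refine ⟨?_, h2⟩
  rw [div_le_iff₀ (by positivity)]
  calc (p : ℝ) ^ 2 ^ (j + 1) ≤ (2 ^ 2 * p) * |((tmProd p (j + 1) : ℤ) : ℝ)| := by linarith
    _ ≤ (p ^ 2 * p) * |((tmProd p (j + 1) : ℤ) : ℝ)| := by gcongr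
    _ = _ := by
      rw [show (3 : ℝ) = ((3 : ℕ) : ℝ) by norm_num, Real.rpow_natCast]; ring

theorem rpow_bounds_tmProd_mul {n m : ℕ} (hn : 1 ≤ n) {P : ℤ}
    (h₁ : ((p : ℤ) ^ 2 ^ n) ^ m ≤ 16 * |P|) (h₂ : |P| ≤ 16 * ((p : ℤ) ^ 2 ^ n) ^ m) :
    (p : ℝ) ^ ((m + 1) * (2 : ℝ) ^ n - 10) ≤ |((tmProd p n * P : ℤ) : ℝ)| ∧
      |((tmProd p n * P : ℤ) : ℝ)| ≤ (p : ℝ) ^ ((m + 1) * (2 : ℝ) ^ n + 10) := by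
  have hp1 : (1 : ℝ) ≤ p := by exact_mod_cast (Fact.out : p.Prime).one_lt.le
  have hp : (0 : ℝ) < p := by positivity
  obtain ⟨hP, hP'⟩ := rpow_bounds_of_pow_bounds h₁ h₂
  obtain ⟨hT, hT'⟩ := rpow_bounds_tmProd (p := p) hn
  rw [Int.cast_mul, abs_mul]
  constructor
  · calc (p : ℝ) ^ ((m + 1) * (2 : ℝ) ^ n - 10)
        ≤ (p : ℝ) ^ (((2 : ℝ) ^ n - 3) + (m * (2 : ℝ) ^ n - 4)) :=
          Real.rpow_le_rpow_of_exponent_le hp1 (by linarith)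
      _ ≤ _ := by rw [Real.rpow_add hp]; gcongr
  · calc _ ≤ (p : ℝ) ^ (2 : ℝ) ^ n * (p : ℝ) ^ (m * (2 : ℝ) ^ n + 4) := by gcongr
      _ ≤ _ := by rw [← Real.rpow_add hp]; exact Real.rpow_le_rpow_of_exponent_le hp1 (by linarith)

theorem le_or_min_le_of_pade {ξ : ℚ_[p]} (hξ : ∀ n, ∃ r : ℤ_[p], ξ =
      (tmProd p n : ℤ) * (1 + (p : ℚ_[p]) ^ 2 ^ n * r)) {n m k W : ℕ} (hn : 2 ≤ n)
    {a b P Q e : ℤ} {w α β γ : ℝ} (hb0 : b ≠ 0)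
    (ha : |(a : ℝ)| ≤ (p : ℝ) ^ α) (hb : |(b : ℝ)| ≤ (p : ℝ) ^ β)
    (hw : ‖(b : ℚ_[p]) * ξ - a‖ ≤ (p : ℝ) ^ (-w))
    (he0 : e ≠ 0) (he : |e| ≤ 4)
    (hs : ∀ X r : ℤ_[p], X = (p : ℤ_[p]) ^ 2 ^ n → ∃ s : ℤ_[p],
      Q * ((1 - X) * (1 - X ^ 2) * (1 - X ^ 4) * (1 + X ^ 8 * r)) - P = X ^ W * (e + X * s))
    (hP₁ : ((p : ℤ) ^ 2 ^ n) ^ m ≤ 16 * |P|) (hP₂ : |P| ≤ 16 * ((p : ℤ) ^ 2 ^ n) ^ m)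
    (hQ₁ : ((p : ℤ) ^ 2 ^ n) ^ k ≤ 16 * |Q|) (hQ₂ : |Q| ≤ 16 * ((p : ℤ) ^ 2 ^ n) ^ k)
    (hg : ∀ d : ℤ, d ∣ tmProd p n * P → d ∣ Q → |(d : ℝ)| ≤ (p : ℝ) ^ (γ + 10))
    (hγ : W * (2 : ℝ) ^ n ≤ 3 / 2 * ((m + 1) * (2 : ℝ) ^ n + k * (2 : ℝ) ^ n) - 3 * γ) :
    w ≤ 3 / 2 * (α + β) + 70 ∨ min w (W * (2 : ℝ) ^ n) ≤ α + k * (2 : ℝ) ^ n + 11 ∨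
      min w (W * (2 : ℝ) ^ n) ≤ β + (m + 1) * (2 : ℝ) ^ n + 11 := by
  have hp1 : (1 : ℝ) ≤ p := by exact_mod_cast (Fact.out : p.Prime).one_lt.le
  obtain ⟨hV, hV'⟩ := norm_pade hξ hn he0 he hs
  obtain ⟨hA, hA'⟩ := rpow_bounds_tmProd_mul (by omega) hP₁ hP₂
  obtain ⟨hB, hB'⟩ := rpow_bounds_of_pow_bounds hQ₁ hQ₂
  have := le_or_min_le_of_approx hb0 ha hb hw hV hV' hA' hA
    (hB'.trans (by gcongr; norm_num)) (le_trans (by gcongr; norm_num) hB) hg hγ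
  rcases this with h | h | h
  · left; linarith
  · right; left; linarith
  · right; right; linarith

/-- The common divisors of `tmProd p n * P` and `Q` are controlled by a Bézout relation. -/
theorem abs_le_of_dvd_tmProd_mul {n : ℕ} {P Q R U V d : ℤ} (hR0 : R ≠ 0) (hR : |R| ≤ 16)
    (hUV : U * ((1 - (p : ℤ) ^ 2 ^ n) * P) + V * Q = R)
    (h₁ : d ∣ tmProd p (n + 1) * P) (h₂ : d ∣ Q) :
    |(d : ℝ)| ≤ (p : ℝ) ^ ((2 : ℝ) ^ n + 10) := by
  have hp2 : (2 : ℝ) ≤ p := by exact_mod_cast (Fact.out : p.Prime).two_le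
  have hp : (0 : ℝ) < p := by positivity
  have hT0 : tmProd (p : ℤ) n ≠ 0 := by
    have := norm_tmProd (p := p) n
    rintro h
    simp [h] at this
  have hd : d ∣ tmProd p n * R := by
    have : tmProd p n * R = U * (tmProd p (n + 1) * P) + tmProd p n * V * Q := by
      rw [tmProd_succ, ← hUV]; ring
    rw [this]
    exact dvd_add (h₁.mul_left _) (h₂.mul_left _)
  have hle : |d| ≤ |tmProd p n * R| :=
    Int.le_of_dvd (abs_pos.2 (mul_ne_zero hT0 hR0)) ((abs_dvd_abs _ _).2 hd)
  have hT : |tmProd (p : ℤ) n| ≤ (p : ℤ) ^ 2 ^ n :=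
    abs_tmProd_le (by exact_mod_cast (Fact.out : p.Prime).one_lt.le) n
  have h3 : |d| ≤ (p : ℤ) ^ 2 ^ n * 16 := by
    rw [abs_mul] at hle
    exact hle.trans (by gcongr)
  have h4 : |(d : ℝ)| ≤ (p : ℝ) ^ 2 ^ n * 16 := by exact_mod_cast h3
  refine h4.trans ?_
  rw [Real.rpow_add hp]
  gcongr ?_ * ?_
  · rw [← Real.rpow_natCast]; push_cast; rfl
  · calc (16 : ℝ) ≤ 2 ^ (10 : ℝ) := by norm_num
      _ ≤ _ := by gcongr

theorem sixteen_le_pow {n : ℕ} (hn : 2 ≤ n) : (16 : ℤ) ≤ (p : ℤ) ^ 2 ^ n := by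
  have hp2 : (2 : ℤ) ≤ p := by exact_mod_cast (Fact.out : p.Prime).two_le
  calc (16 : ℤ) = 2 ^ 2 ^ 2 := by norm_num
    _ ≤ (p : ℤ) ^ 2 ^ 2 := by gcongr
    _ ≤ _ := by
      gcongr
      · linarith
      · norm_num

theorem le_or_min_le_of_pade_of_bezout {ξ : ℚ_[p]} (hξ : ∀ n, ∃ r : ℤ_[p], ξ =
      (tmProd p n : ℤ) * (1 + (p : ℚ_[p]) ^ 2 ^ n * r)) {n : ℕ} (m k W : ℕ) (hn : 2 ≤ n)
    {a b : ℤ} (P Q e U V R : ℤ) {w α β : ℝ} (hb0 : b ≠ 0)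
    (ha : |(a : ℝ)| ≤ (p : ℝ) ^ α) (hb : |(b : ℝ)| ≤ (p : ℝ) ^ β)
    (hw : ‖(b : ℚ_[p]) * ξ - a‖ ≤ (p : ℝ) ^ (-w))
    (he0 : e ≠ 0) (he : |e| ≤ 4)
    (hs : ∀ X r : ℤ_[p], X = (p : ℤ_[p]) ^ 2 ^ (n + 1) → ∃ s : ℤ_[p],
      Q * ((1 - X) * (1 - X ^ 2) * (1 - X ^ 4) * (1 + X ^ 8 * r)) - P = X ^ W * (e + X * s))
    (hP : ((p : ℤ) ^ 2 ^ (n + 1)) ^ m ≤ 16 * |P| ∧ |P| ≤ 16 * ((p : ℤ) ^ 2 ^ (n + 1)) ^ m)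
    (hQ : ((p : ℤ) ^ 2 ^ (n + 1)) ^ k ≤ 16 * |Q| ∧ |Q| ≤ 16 * ((p : ℤ) ^ 2 ^ (n + 1)) ^ k)
    (hR0 : R ≠ 0) (hR : |R| ≤ 16)
    (hUV : U * ((1 - (p : ℤ) ^ 2 ^ n) * P) + V * Q = R)
    (hW : W ≤ m + 1 + k) (hmk : 2 ≤ m + k) :
    w ≤ 3 / 2 * (α + β) + 70 ∨
      min w (W * (2 * (2 : ℝ) ^ n)) ≤ α + k * (2 * (2 : ℝ) ^ n) + 11 ∨
      min w (W * (2 * (2 : ℝ) ^ n)) ≤ β + (m + 1) * (2 * (2 : ℝ) ^ n) + 11 := by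
  have h := le_or_min_le_of_pade (γ := (2 : ℝ) ^ n) hξ (by omega) hb0 ha hb hw he0 he hs
    hP.1 hP.2 hQ.1 hQ.2 (fun d h₁ h₂ => abs_le_of_dvd_tmProd_mul hR0 hR hUV h₁ h₂)
  rw [pow_succ' (2 : ℝ)] at h
  apply h
  have h1 : (W : ℝ) ≤ m + 1 + k := by exact_mod_cast hW
  have h2 : (2 : ℝ) ≤ m + k := by exact_mod_cast hmk
  have h3 : (0 : ℝ) < 2 ^ n := by positivity
  nlinarith [mul_le_mul_of_nonneg_right h1 h3.le, mul_le_mul_of_nonneg_right h2 h3.le]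

/-- The Padé approximant `(1 - 2 X ^ 2) / (1 + X)` has the exceptional order `6`. -/
theorem exists_pade_three_one (n : ℕ) (X r : ℤ_[p]) (hX : X = (p : ℤ_[p]) ^ 2 ^ n) :
    ∃ s : ℤ_[p], ((1 + (p : ℤ) ^ 2 ^ n : ℤ) : ℤ_[p]) *
      ((1 - X) * (1 - X ^ 2) * (1 - X ^ 4) * (1 + X ^ 8 * r)) -
      ((1 - 2 * ((p : ℤ) ^ 2 ^ n) ^ 2 : ℤ) : ℤ_[p]) = X ^ 6 * ((2 : ℤ) + X * s) :=
  ⟨-X + r * X * (1 + X) * ((1 - X) * (1 - X ^ 2) * (1 - X ^ 4)), by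
    push_cast; rw [← hX]; ring⟩

theorem le_or_min_le_three_one {ξ : ℚ_[p]} (hξ : ∀ n, ∃ r : ℤ_[p], ξ =
      (tmProd p n : ℤ) * (1 + (p : ℚ_[p]) ^ 2 ^ n * r)) {n : ℕ} (hn : 2 ≤ n)
    {a b : ℤ} {w α β : ℝ} (hb0 : b ≠ 0)
    (ha : |(a : ℝ)| ≤ (p : ℝ) ^ α) (hb : |(b : ℝ)| ≤ (p : ℝ) ^ β)
    (hw : ‖(b : ℚ_[p]) * ξ - a‖ ≤ (p : ℝ) ^ (-w)) :
    w ≤ 3 / 2 * (α + β) + 70 ∨ min w (6 * (2 : ℝ) ^ n) ≤ α + (2 : ℝ) ^ n + 11 ∨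
      min w (6 * (2 : ℝ) ^ n) ≤ β + 3 * (2 : ℝ) ^ n + 11 := by
  have hp2 : (2 : ℝ) ≤ p := by exact_mod_cast (Fact.out : p.Prime).two_le
  have hX := sixteen_le_pow (p := p) hn
  obtain ⟨hP, hP'⟩ := pow_two_le_abs_one_sub hX
  obtain ⟨hQ, hQ'⟩ := pow_one_le_abs_one_add hX
  have h := le_or_min_le_of_pade (γ := 0) hξ hn hb0 ha hb hw two_ne_zero (by norm_num)
    (exists_pade_three_one n) hP hP' hQ hQ' (fun d h₁ h₂ => by
      obtain ⟨j, rfl⟩ := Nat.exists_eq_add_of_le' (by omega : 1 ≤ n)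
      have h3 : |(d : ℝ)| ≤ 2 := by
        exact_mod_cast abs_le_of_dvd_tmProd_mul_of_dvd_one_add h₁ h₂
      calc |(d : ℝ)| ≤ 2 ^ (0 + 10 : ℝ) := h3.trans (by norm_num)
        _ ≤ _ := by gcongr) (by push_cast; linarith)
  push_cast at h
  rw [one_mul] at h
  norm_num at h ⊢
  exact h

theorem neg_log_norm_le {ξ : ℚ_[p]} (hξ : ∀ n, ∃ r : ℤ_[p], ξ =
      (tmProd p n : ℤ) * (1 + (p : ℚ_[p]) ^ 2 ^ n * r))
    {a b : ℤ} {w α β : ℝ} (hb0 : b ≠ 0) (hα : 0 ≤ α) (hβ : 0 ≤ β)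
    (ha : |(a : ℝ)| ≤ (p : ℝ) ^ α) (hb : |(b : ℝ)| ≤ (p : ℝ) ^ β)
    (hw : ‖(b : ℚ_[p]) * ξ - a‖ ≤ (p : ℝ) ^ (-w)) :
    w ≤ 3 / 2 * (α + β) + 1000 := by
  by_contra! hlt
  obtain ⟨n, hn₁, hn₂⟩ := exists_nat_pow_near (show 1 ≤ w / 6 by linarith) one_lt_two
  have hn : 2 ≤ n := by
    by_contra! hlt'
    have : (2 : ℝ) ^ (n + 1) ≤ 2 ^ 2 := by gcongr; norm_num; omega
    linarith
  have hX := sixteen_le_pow (p := p) (show 2 ≤ n + 1 by omega)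
  have hX₁ : 16 * (p : ℤ) ^ 2 ^ (n + 1) ≤ ((p : ℤ) ^ 2 ^ (n + 1)) ^ 2 := by nlinarith
  have hX₂ : 16 * ((p : ℤ) ^ 2 ^ (n + 1)) ^ 2 ≤ ((p : ℤ) ^ 2 ^ (n + 1)) ^ 3 := by nlinarith
  have hX₃ : 16 * ((p : ℤ) ^ 2 ^ (n + 1)) ^ 3 ≤ ((p : ℤ) ^ 2 ^ (n + 1)) ^ 4 := by nlinarith
  have hsq : (p : ℤ) ^ 2 ^ (n + 1) = ((p : ℤ) ^ 2 ^ n) ^ 2 := by rw [pow_succ, pow_mul]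
  have h₁ := (le_or_min_le_three_one hξ hn hb0 ha hb hw).resolve_left (by linarith)
  have h₂ := (le_or_min_le_three_one hξ (by omega : 2 ≤ n + 1) hb0 ha hb hw).resolve_left
    (by linarith)
  have h₃ := (le_or_min_le_of_pade_of_bezout hξ 0 2 3 hn 1
    (1 + (p : ℤ) ^ 2 ^ (n + 1) + 2 * ((p : ℤ) ^ 2 ^ (n + 1)) ^ 2) (-2)
    ((1 + (p : ℤ) ^ 2 ^ n) * (3 + 2 * (p : ℤ) ^ 2 ^ (n + 1))) 1 4 hb0 ha hb hw
    (by norm_num) (by norm_num)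
    (fun X r h => ⟨-2 + 2 * X + 2 * X ^ 3 + X ^ 4 - 2 * X ^ 5 + r * X ^ 4 * (1 + X + 2 * X ^ 2) *
      ((1 - X) * (1 - X ^ 2) * (1 - X ^ 4)), by push_cast; rw [← h]; ring⟩)
    (by norm_num) (by rw [abs_of_nonneg (by linarith)]; constructor <;> linarith)
    (by norm_num) (by norm_num) (by rw [hsq]; ring)
    (by norm_num) (by norm_num)).resolve_left (by linarith)
  have h₄ := (le_or_min_le_of_pade_of_bezout hξ 0 3 4 hn 1
    (1 + (p : ℤ) ^ 2 ^ (n + 1) + 2 * ((p : ℤ) ^ 2 ^ (n + 1)) ^ 2 +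
      2 * ((p : ℤ) ^ 2 ^ (n + 1)) ^ 3) (-4)
    ((1 + (p : ℤ) ^ 2 ^ n) * (5 + 4 * (p : ℤ) ^ 2 ^ (n + 1) + 2 * ((p : ℤ) ^ 2 ^ (n + 1)) ^ 2))
    1 6 hb0 ha hb hw (by norm_num) (by norm_num)
    (fun X r h => ⟨2 * X + 3 * X ^ 3 - 2 * X ^ 5 + r * X ^ 3 * (1 + X + 2 * X ^ 2 + 2 * X ^ 3) *
      ((1 - X) * (1 - X ^ 2) * (1 - X ^ 4)), by push_cast; rw [← h]; ring⟩)
    (by norm_num) (by rw [abs_of_nonneg (by linarith)]; constructor <;> linarith)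
    (by norm_num) (by norm_num) (by rw [hsq]; ring)
    (by norm_num) (by norm_num)).resolve_left (by linarith)
  have h₅ := (le_or_min_le_of_pade_of_bezout hξ 0 4 5 hn 1
    (1 + (p : ℤ) ^ 2 ^ (n + 1) + 2 * ((p : ℤ) ^ 2 ^ (n + 1)) ^ 2 +
      2 * ((p : ℤ) ^ 2 ^ (n + 1)) ^ 3 + 4 * ((p : ℤ) ^ 2 ^ (n + 1)) ^ 4) (-4)
    ((1 + (p : ℤ) ^ 2 ^ n) * (9 + 8 * (p : ℤ) ^ 2 ^ (n + 1) + 6 * ((p : ℤ) ^ 2 ^ (n + 1)) ^ 2 +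
      4 * ((p : ℤ) ^ 2 ^ (n + 1)) ^ 3))
    1 10 hb0 ha hb hw (by norm_num) (by norm_num)
    (fun X r h => ⟨-2 + 4 * X - X ^ 2 + 4 * X ^ 3 + 2 * X ^ 4 - 4 * X ^ 5 +
      r * X ^ 2 * (1 + X + 2 * X ^ 2 + 2 * X ^ 3 + 4 * X ^ 4) *
      ((1 - X) * (1 - X ^ 2) * (1 - X ^ 4)), by push_cast; rw [← h]; ring⟩)
    (by norm_num) (by rw [abs_of_nonneg (by linarith)]; constructor <;> linarith)
    (by norm_num) (by norm_num) (by rw [hsq]; ring)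
    (by norm_num) (by norm_num)).resolve_left (by linarith)
  have h₆ := (le_or_min_le_of_pade_of_bezout hξ 1 2 4 hn (1 - (p : ℤ) ^ 2 ^ (n + 1))
    (1 + ((p : ℤ) ^ 2 ^ (n + 1)) ^ 2) (-2)
    ((1 + (p : ℤ) ^ 2 ^ n) * (p : ℤ) ^ 2 ^ (n + 1)) (2 - (p : ℤ) ^ 2 ^ (n + 1)) 2
    hb0 ha hb hw (by norm_num) (by norm_num)
    (fun X r h => ⟨2 + X ^ 3 - X ^ 4 + r * X ^ 3 * (1 + X ^ 2) *
      ((1 - X) * (1 - X ^ 2) * (1 - X ^ 4)), by push_cast; rw [← h]; ring⟩)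
    (by rw [abs_of_nonpos (by linarith)]; constructor <;> linarith)
    (by rw [abs_of_nonneg (by linarith)]; constructor <;> linarith)
    (by norm_num) (by norm_num) (by rw [hsq]; ring)
    (by norm_num) (by norm_num)).resolve_left (by linarith)
  have h₇ := (le_or_min_le_of_pade_of_bezout hξ 1 3 5 hn (1 - 2 * (p : ℤ) ^ 2 ^ (n + 1))
    (1 - (p : ℤ) ^ 2 ^ (n + 1) - 2 * ((p : ℤ) ^ 2 ^ (n + 1)) ^ 3) 4
    (-(1 + (p : ℤ) ^ 2 ^ n) * (3 + 2 * (p : ℤ) ^ 2 ^ (n + 1) + 2 * ((p : ℤ) ^ 2 ^ (n + 1)) ^ 2) *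
      (3 + 2 * (p : ℤ) ^ 2 ^ (n + 1) + 4 * ((p : ℤ) ^ 2 ^ (n + 1)) ^ 2))
    (4 * (1 - (p : ℤ) ^ 2 ^ (n + 1)) *
        (3 + 2 * (p : ℤ) ^ 2 ^ (n + 1) + 2 * ((p : ℤ) ^ 2 ^ (n + 1)) ^ 2) -
      4 * (1 - (p : ℤ) ^ 2 ^ (n + 1) - 2 * ((p : ℤ) ^ 2 ^ (n + 1)) ^ 3) +
      (1 - 2 * (p : ℤ) ^ 2 ^ (n + 1)) *
        (3 + 2 * (p : ℤ) ^ 2 ^ (n + 1) + 4 * ((p : ℤ) ^ 2 ^ (n + 1)) ^ 2)) 2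
    hb0 ha hb hw (by norm_num) (by norm_num)
    (fun X r h => ⟨-2 - X ^ 2 - 2 * X ^ 3 + 2 * X ^ 4 + r * X ^ 2 * (1 - X - 2 * X ^ 3) *
      ((1 - X) * (1 - X ^ 2) * (1 - X ^ 4)), by push_cast; rw [← h]; ring⟩)
    (by rw [abs_of_nonpos (by linarith)]; constructor <;> linarith)
    (by rw [abs_of_nonpos (by linarith)]; constructor <;> linarith)
    (by norm_num) (by norm_num) (by rw [hsq]; ring)
    (by norm_num) (by norm_num)).resolve_left (by linarith)
  rw [pow_succ' (2 : ℝ)] at hn₂ h₂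
  generalize (2 : ℝ) ^ n = N at *
  push_cast at h₃ h₄ h₅ h₆ h₇
  simp only [min_le_iff] at h₁ h₂ h₃ h₄ h₅ h₆ h₇
  have e₂ : w ≤ β + 6 * N + 11 := by
    rcases h₂ with (h | h) | (h | h) <;> linarith
  have e₁ : 3 * N ≤ β + 11 := by
    rcases h₁ with (h | h) | (h | h) <;> linarith
  rcases h₃ with (h₃ | h₃) | (h₃ | h₃) <;> try linarith
  all_goals rcases h₄ with (h₄ | h₄) | (h₄ | h₄) <;> try linarith
  all_goals rcases h₆ with (h₆ | h₆) | (h₆ | h₆) <;> try linarith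
  all_goals rcases h₇ with (h₇ | h₇) | (h₇ | h₇) <;> try linarith
  all_goals rcases h₅ with (h₅ | h₅) | (h₅ | h₅) <;> try linarith


theorem three_le_multIrrExp {ξ : ℚ_[p]} (hξ : ∀ n, ∃ r : ℤ_[p], ξ =
      (tmProd p n : ℤ) * (1 + (p : ℚ_[p]) ^ 2 ^ n * r)) :
    ((3 : ℝ) : EReal) ≤ multIrrExp p ξ := by
  have hp2 : (2 : ℝ) ≤ p := by exact_mod_cast (Fact.out : p.Prime).two_le
  have hp : (0 : ℝ) < p := by positivity
  refine le_of_forall_lt fun c hc => ?_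
  obtain ⟨ν, hν, hν3⟩ := EReal.lt_iff_exists_real_btwn.1 hc
  refine hν.trans_le ?_
  have hν3 : ν < 3 := by exact_mod_cast hν3
  set μ := max ν 2 with hμdef
  have hμ3 : μ < 3 := max_lt hν3 (by norm_num)
  have hμ2 : 2 ≤ μ := le_max_right _ _
  refine le_trans (EReal.coe_le_coe_iff.2 (le_max_left ν 2)) (le_sSup ⟨μ, rfl, ?_⟩)
  obtain ⟨m, hm⟩ := pow_unbounded_of_one_lt (21 / (3 - μ)) (one_lt_two (α := ℝ))
  have hm' : 21 < 2 ^ m * (3 - μ) := (div_lt_iff₀ (by linarith)).1 hm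
  refine Set.infinite_of_injective_forall_mem (f := fun k : ℕ =>
    (tmProd p (k + m + 2) * (1 - 2 * ((p : ℤ) ^ 2 ^ (k + m + 2)) ^ 2),
      1 + (p : ℤ) ^ 2 ^ (k + m + 2))) (fun i j hij => ?_) fun k => ?_
  · have h := (Prod.ext_iff.1 hij).2
    have h2 : (1 : ℤ) < p := by exact_mod_cast (Fact.out : p.Prime).one_lt
    have h3 := Nat.pow_right_injective le_rfl
      (pow_right_injective₀ (by linarith) h2.ne' (add_left_cancel h))
    omega
  · have hn : 2 ≤ k + m + 2 := by omega
    have hN : (2 : ℝ) ^ m ≤ 2 ^ (k + m + 2) := by gcongr <;> [norm_num; omega]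
    generalize k + m + 2 = n at *
    have hX := sixteen_le_pow (p := p) hn
    obtain ⟨hP, hP'⟩ := pow_two_le_abs_one_sub hX
    obtain ⟨hQ, hQ'⟩ := pow_one_le_abs_one_add hX
    obtain ⟨h₁, h₂⟩ := norm_pade hξ hn two_ne_zero (by norm_num) (exists_pade_three_one n)
    have hA := (rpow_bounds_tmProd_mul (by omega) hP hP')
    have hB := (rpow_bounds_of_pow_bounds hQ hQ')
    have hA0 := (Real.rpow_pos_of_pos hp _).trans_le hA.1
    have hB0 := (Real.rpow_pos_of_pos hp _).trans_le hB.1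
    have hAB := mul_le_mul hA.2 hB.2 hB0.le (by positivity)
    rw [← Real.rpow_add hp] at hAB
    refine ⟨(Real.rpow_pos_of_pos hp _).trans_le h₂, h₁.trans ?_⟩
    simp only [Int.cast_abs, Int.cast_mul (tmProd _ _ * _), abs_mul (Int.cast (tmProd _ _ * _) : ℝ)]
    refine le_trans ?_ (Real.rpow_le_rpow_of_nonpos (mul_pos hA0 hB0) hAB (by linarith))
    rw [← Real.rpow_mul hp.le]
    refine Real.rpow_le_rpow_of_exponent_le (by linarith) ?_
    push_cast
    nlinarith

theorem multIrrExp_le_three {ξ : ℚ_[p]} (hξ : ∀ n, ∃ r : ℤ_[p], ξ =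
      (tmProd p n : ℤ) * (1 + (p : ℚ_[p]) ^ 2 ^ n * r)) :
    multIrrExp p ξ ≤ ((3 : ℝ) : EReal) := by
  have hp2 : (2 : ℝ) ≤ p := by exact_mod_cast (Fact.out : p.Prime).two_le
  have hp : (0 : ℝ) < p := by positivity
  have hp1 : (1 : ℝ) < p := by linarith
  refine sSup_le ?_
  rintro _ ⟨μ, rfl, hinf⟩
  rw [EReal.coe_le_coe_iff]
  by_contra! hμ
  set K : ℝ := 1000 / (μ / 2 - 3 / 2) with hK
  refine hinf (((Set.finite_Icc (-⌊(p : ℝ) ^ K⌋) ⌊(p : ℝ) ^ K⌋).prod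
    (Set.finite_Icc (-⌊(p : ℝ) ^ K⌋) ⌊(p : ℝ) ^ K⌋)).subset ?_)
  rintro ⟨a, b⟩ ⟨h0, h1⟩
  dsimp only at h0 h1
  have hab : a * b ≠ 0 := by
    intro h
    rw [h, abs_zero, Int.cast_zero, Real.zero_rpow (by linarith)] at h1
    linarith
  obtain ⟨ha0, hb0⟩ := mul_ne_zero_iff.1 hab
  have hlog {z : ℤ} (hz : z ≠ 0) : 0 ≤ Real.logb p |(z : ℝ)| ∧
      (p : ℝ) ^ Real.logb p |(z : ℝ)| = |(z : ℝ)| :=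
    ⟨Real.logb_nonneg hp1 (by exact_mod_cast Int.one_le_abs hz),
      Real.rpow_logb hp hp1.ne' (by positivity)⟩
  obtain ⟨hα, ha⟩ := hlog ha0
  obtain ⟨hβ, hb⟩ := hlog hb0
  rw [Int.cast_abs, Int.cast_mul, abs_mul, ← ha, ← hb, ← Real.rpow_add hp, ← Real.rpow_mul hp.le,
    show ∀ s : ℝ, s * (-μ / 2) = -(s * (μ / 2)) by intro s; ring] at h1
  have h := neg_log_norm_le hξ hb0 hα hβ ha.ge hb.ge h1
  have hsum : Real.logb p |(a : ℝ)| + Real.logb p |(b : ℝ)| ≤ K := by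
    rw [hK, le_div_iff₀ (by linarith)]
    linarith
  have hmem {z : ℤ} (hz : z ≠ 0) (h : Real.logb p |(z : ℝ)| ≤ K) :
      z ∈ Set.Icc (-⌊(p : ℝ) ^ K⌋) ⌊(p : ℝ) ^ K⌋ := by
    rw [Set.mem_Icc, ← abs_le, Int.le_floor, Int.cast_abs, ← (hlog hz).2]
    exact Real.rpow_le_rpow_of_exponent_le hp1.le h
  exact ⟨hmem ha0 (by linarith), hmem hb0 (by linarith)⟩

end Padic

theorem tm_multIrrExp (p : ℕ) [Fact p.Prime]
    (t : ℕ → ℤ) (ht0 : t 0 = 1)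
    (hte : ∀ n, t (2 * n) = t n) (hto : ∀ n, t (2 * n + 1) = - t n)
    (ξ : ℚ_[p]) (hξ : ξ = ∑' n : ℕ, (t n : ℚ_[p]) * (p : ℚ_[p]) ^ n) :
    multIrrExp p ξ = ((3 : ℝ) : EReal) := by
  have h : ∀ n, ∃ r : ℤ_[p], ξ = (tmProd p n : ℤ) * (1 + (p : ℚ_[p]) ^ 2 ^ n * r) :=
    hξ ▸ exists_eq_tmProd_mul ht0 hte hto
  exact le_antisymm (multIrrExp_le_three h) (three_le_multIrrExp h)
end

section
/- Let p be a prime number. The p-adic Thue–Morse number ξ_{t,p} satisfies μ̂×(ξ_{t,p}) = 2. -/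
open Filter

noncomputable def uniformMultIrrExp (p : ℕ) [Fact p.Prime] (ξ : ℚ_[p]) : EReal :=
  sSup {e : EReal | ∃ μ : ℝ, e = (μ : EReal) ∧
    ∀ᶠ X : ℝ in atTop, ∃ a b : ℤ,
      0 < ((|a * b| : ℤ) : ℝ) ^ (1 / 2 : ℝ) ∧
      ((|a * b| : ℤ) : ℝ) ^ (1 / 2 : ℝ) ≤ X ∧
      ‖(b : ℚ_[p]) * ξ - (a : ℚ_[p])‖ ≤ X ^ (-μ)}

open Polynomial

theorem eq_zero_of_eisenstein_form {R : Type*} [CommRing R] [IsDomain R] [WfDvdMonoid R] {q : R}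
    (hq : Prime q) {a b : R} (h : a ^ 2 + q * a * b + q * b ^ 2 = 0) : a = 0 ∧ b = 0 := by
  have key : ∀ n : ℕ, ∀ a b : R, a ^ 2 + q * a * b + q * b ^ 2 = 0 → q ^ n ∣ a ∧ q ^ n ∣ b := by
    intro n
    induction n with
    | zero => simp
    | succ n ih =>
      intro a b h
      obtain ⟨c, rfl⟩ : q ∣ a := hq.dvd_of_dvd_pow (n := 2) ⟨-(a * b + b ^ 2), by
        linear_combination h⟩
      have h' : q * c ^ 2 + q * c * b + b ^ 2 = 0 :=
        mul_left_cancel₀ hq.ne_zero (by linear_combination h)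
      obtain ⟨d, rfl⟩ : q ∣ b := hq.dvd_of_dvd_pow (n := 2) ⟨-(c ^ 2 + c * b), by
        linear_combination h'⟩
      obtain ⟨h1, h2⟩ := ih c d (mul_left_cancel₀ hq.ne_zero (by linear_combination h'))
      rw [pow_succ']
      exact ⟨mul_dvd_mul_left q h1, mul_dvd_mul_left q h2⟩
  have aux : ∀ x : R, (∀ n : ℕ, q ^ n ∣ x) → x = 0 := by
    intro x hx
    by_contra h0
    obtain ⟨n, hn⟩ := FiniteMultiplicity.of_not_isUnit hq.not_isUnit h0
    exact hn (hx _)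
  exact ⟨aux a fun n => (key n a b h).1, aux b fun n => (key n a b h).2⟩

theorem pade_unique_of_quadratic {m d e : ℕ} {τ Q B : (ZMod 2)[X]}
    (hfrob : (1 + X : (ZMod 2)[X]) ^ (2 * m) = 1 + X ^ (2 * m))
    (hτ : τ ^ 2 + τ * (1 + X) ^ m = X ^ (2 * m) + X * (1 + X) ^ (2 * m - 1))
    (hτd : τ.natDegree ≤ m) (hQ : Q.natDegree ≤ d) (hB : B.natDegree ≤ e) (hde : d ≤ e)
    (hme : m ≤ e) (hsum : d + e + 2 ≤ 2 * m)
    (h : X ^ (2 * m) ∣ Q * ((1 + X) ^ m * τ) - B) : Q = 0 ∧ B = 0 := by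
  have h2 : (2 : (ZMod 2)[X]) = 0 := by
    have : (2 : ZMod 2) = 0 := rfl
    rw [← C_ofNat, this, C_0]
  have hL : (1 + X : (ZMod 2)[X]) = X + C 1 := by rw [C_1, add_comm]
  have hLd : ∀ n : ℕ, ((1 + X : (ZMod 2)[X]) ^ n).natDegree = n := fun n => by
    rw [hL, natDegree_pow_X_add_C]
  have hL0 : (1 + X : (ZMod 2)[X]) ≠ 0 := by rw [hL]; exact X_add_C_ne_zero 1
  have hLp : Prime (1 + X : (ZMod 2)[X]) := by
    have := prime_X_sub_C (-1 : ZMod 2)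
    rwa [C_neg, sub_neg_eq_add, C_1, add_comm] at this
  have hsucc : (1 + X : (ZMod 2)[X]) ^ (2 * m) = (1 + X) * (1 + X) ^ (2 * m - 1) := by
    rw [← pow_succ', Nat.sub_add_cancel (by omega)]
  obtain ⟨S', hS'⟩ := h
  obtain ⟨S, hS⟩ : ∃ S, Q * τ + (1 + X) ^ m * B = X ^ (2 * m) * S :=
    ⟨(1 + X) ^ m * S' - Q * τ, by
      have h3 : ((1 + X : (ZMod 2)[X]) ^ m) ^ 2 = 1 + X ^ (2 * m) := by
        rw [← pow_mul, mul_comm m, hfrob]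
      linear_combination (1 + X) ^ m * hS' - Q * τ * h3 + ((1 + X) ^ m * B) * h2⟩
  have hSd : S.natDegree + m ≤ e := by
    rcases eq_or_ne S 0 with rfl | hS0
    · simpa using hme
    have h3 : (X ^ (2 * m) * S).natDegree = 2 * m + S.natDegree := by
      rw [natDegree_mul (pow_ne_zero _ X_ne_zero) hS0, natDegree_X_pow]
    have h4 : (Q * τ + (1 + X) ^ m * B).natDegree ≤ m + e := by
      refine natDegree_add_le_of_degree_le ?_ ?_
      · exact natDegree_mul_le.trans (by omega)
      · exact natDegree_mul_le.trans (by rw [hLd]; omega)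
    rw [hS, h3] at h4
    omega
  obtain ⟨G, hG⟩ : (1 + X) ^ m ∣ Q + S * τ := by
    have hco : IsCoprime ((1 + X : (ZMod 2)[X]) ^ m) (X ^ (2 * m)) :=
      IsCoprime.pow ⟨1, -1, by ring⟩
    refine hco.dvd_of_dvd_mul_left ?_
    have h3 : (1 + X : (ZMod 2)[X]) ^ (2 * m - 1) = (1 + X) ^ m * (1 + X) ^ (m - 1) := by
      rw [← pow_add]; congr 1; omega
    rw [h3] at hτ
    exact ⟨X ^ (2 * m) * S + B * (τ + (1 + X) ^ m) + Q * (X * (1 + X) ^ (m - 1)), by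
      linear_combination (τ + (1 + X) ^ m) * hS - Q * hτ + (X ^ (2 * m) * S * τ
        - X * Q * (1 + X) ^ m * (1 + X) ^ (m - 1) - τ * B * (1 + X) ^ m
        - B * (1 + X) ^ (2 * m)) * h2⟩
  have hmain : (1 + X) ^ (2 * m - 1) * (S ^ 2 + (1 + X) * S * G + (1 + X) * G ^ 2)
      = Q ^ 2 + Q * S * (1 + X) ^ m + S ^ 2 := by
    linear_combination (-(S * G + G ^ 2) - S ^ 2) * hsucc
      - ((Q + S * τ + (1 + X) ^ m * G) + (1 + X) ^ m * S) * hG + S ^ 2 * hτ + S ^ 2 * hfrob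
      + (Q * S * τ + S ^ 2 * X ^ (2 * m)) * h2
  have hE : S ^ 2 + (1 + X) * S * G + (1 + X) * G ^ 2 = 0 := by
    by_contra h0
    have h3 : ((1 + X) ^ (2 * m - 1) * (S ^ 2 + (1 + X) * S * G + (1 + X) * G ^ 2)).natDegree
        = 2 * m - 1 + (S ^ 2 + (1 + X) * S * G + (1 + X) * G ^ 2).natDegree := by
      rw [natDegree_mul (pow_ne_zero _ hL0) h0, hLd]
    have h4 : (Q ^ 2 + Q * S * (1 + X) ^ m + S ^ 2).natDegree ≤ 2 * m - 2 := by
      refine natDegree_add_le_of_degree_le (natDegree_add_le_of_degree_le ?_ ?_) ?_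
      · exact natDegree_pow_le.trans (by omega)
      · refine natDegree_mul_le.trans ?_
        have := natDegree_mul_le (p := Q) (q := S)
        rw [hLd]
        omega
      · exact natDegree_pow_le.trans (by omega)
    rw [← hmain, h3] at h4
    omega
  obtain ⟨rfl, rfl⟩ := eq_zero_of_eisenstein_form hLp hE
  obtain rfl : Q = 0 := by simpa using hG
  refine ⟨rfl, ?_⟩
  have h3 : (1 + X) ^ m * B = 0 := by simpa using hS
  exact (mul_eq_zero.1 h3).resolve_left (pow_ne_zero _ hL0)

theorem exists_thueMorse_quadratic (j : ℕ) : ∃ τ : (ZMod 2)[X],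
    τ ^ 2 + τ * (1 + X) ^ 2 ^ j = X ^ (2 * 2 ^ j) + X * (1 + X) ^ (2 * 2 ^ j - 1) ∧
    τ.natDegree ≤ 2 ^ j ∧ ∃ φ : ℤ[X],
    (1 - X) * ∏ i ∈ Finset.range (j + 1), (1 - X ^ 2 ^ i : ℤ[X]) = 1 - X ^ (2 * 2 ^ j) - 2 * φ ∧
    φ.map (Int.castRingHom (ZMod 2)) = (1 + X) ^ 2 ^ j * τ := by
  have h2 : (2 : (ZMod 2)[X]) = 0 := by
    have : (2 : ZMod 2) = 0 := rfl
    rw [← C_ofNat, this, C_0]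
  have hLd : ∀ n : ℕ, ((1 + X : (ZMod 2)[X]) ^ n).natDegree = n := fun n => by
    rw [add_comm, ← C_1, natDegree_pow_X_add_C]
  have hneg : ∀ x : (ZMod 2)[X], -x = x := fun x => by linear_combination -x * h2
  induction j with
  | zero =>
    refine ⟨X, ?_, by simp, X - X ^ 2, ?_, ?_⟩
    · norm_num
    · simp; ring
    · simp [sub_eq_add_neg, hneg]; ring
  | succ j ih =>
    obtain ⟨τ, hτ, hd, φ, hφ, hmap⟩ := ih
    have hfrob : (1 + X : (ZMod 2)[X]) ^ 2 ^ (j + 1) = 1 + X ^ 2 ^ (j + 1) := by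
      rw [add_pow_char_pow, one_pow]
    have h1 : 1 ≤ 2 ^ j := Nat.one_le_two_pow
    obtain ⟨m, hm⟩ : ∃ m, 2 ^ j = m := ⟨_, rfl⟩
    have hpow : 2 ^ (j + 1) = 2 * m := by rw [← hm]; ring
    rw [hm] at h1 hd hτ hφ hmap
    rw [hpow] at hfrob ⊢
    refine ⟨(1 + X) ^ m * τ + X ^ (2 * m), ?_, ?_, ?_⟩
    · have hs : (1 + X : (ZMod 2)[X]) ^ (2 * (2 * m) - 1)
          = (1 + X) ^ (2 * m) * (1 + X) ^ (2 * m - 1) := by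
        rw [← pow_add]; congr 1; omega
      have hs' : X ^ (2 * (2 * m)) = (X ^ (2 * m) : (ZMod 2)[X]) ^ 2 := by ring
      rw [hs, hs']
      linear_combination (1 + X) ^ (2 * m) * hτ +
        (X ^ (2 * m) * (1 + X) ^ m * τ + X ^ (2 * m) * (1 + X) ^ (2 * m)) * h2
    · refine natDegree_add_le_of_degree_le (natDegree_mul_le.trans ?_) (natDegree_X_pow_le _)
      rw [hLd]; omega
    · refine ⟨(1 - X ^ (2 * m)) * (X ^ (2 * m) + φ), ?_, ?_⟩
      · rw [Finset.prod_range_succ, hpow, ← mul_assoc, hφ]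
        ring
      · rw [Polynomial.map_mul, Polynomial.map_add, hmap]
        simp [sub_eq_add_neg, hneg]
        rw [← hfrob]
        ring

theorem exists_eq_two_mul_of_map_eq_zero {P : ℤ[X]}
    (h : P.map (Int.castRingHom (ZMod 2)) = 0) : ∃ P' : ℤ[X], P = 2 * P' := by
  have : C (2 : ℤ) ∣ P := by
    rw [C_dvd_iff_dvd_coeff]
    intro i
    have := congrArg (fun q => coeff q i) h
    simp only [coeff_map, eq_intCast, coeff_zero] at this
    exact (ZMod.intCast_zmod_eq_zero_iff_dvd _ 2).1 this
  obtain ⟨P', hP'⟩ := this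
  exact ⟨P', by rw [hP', C_ofNat]⟩

theorem X_pow_dvd_of_dvd_two_mul {P : ℤ[X]} {n : ℕ} (h : X ^ n ∣ 2 * P) : X ^ n ∣ P := by
  rw [X_pow_dvd_iff] at h ⊢
  intro i hi
  have := h i hi
  rw [← C_ofNat, coeff_C_mul] at this
  simpa using this

theorem natDegree_two_mul (P : ℤ[X]) : (2 * P).natDegree = P.natDegree := by
  rw [← C_ofNat, natDegree_C_mul (by norm_num)]

theorem thueMorse_pade_two_dvd {k d e : ℕ} {Q R : ℤ[X]} (hQ : Q.natDegree ≤ d)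
    (hR : R.natDegree ≤ e) (hde : d + e + 5 ≤ 2 ^ k)
    (h : X ^ 2 ^ k ∣ Q * ∏ i ∈ Finset.range k, (1 - X ^ 2 ^ i : ℤ[X]) - R) :
    (∃ Q', Q = 2 * Q') ∧ ∃ R', R = 2 * R' := by
  obtain ⟨j, rfl⟩ : ∃ j, k = j + 1 :=
    Nat.exists_eq_succ_of_ne_zero (by rintro rfl; simp at hde)
  obtain ⟨τ, hτ, hτd, φ, hφ, hmap⟩ := exists_thueMorse_quadratic j
  have hfrob : (1 + X : (ZMod 2)[X]) ^ 2 ^ (j + 1) = 1 + X ^ 2 ^ (j + 1) := by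
    rw [add_pow_char_pow, one_pow]
  have hpow : 2 ^ (j + 1) = 2 * 2 ^ j := by ring
  rw [hpow] at hfrob h hde
  generalize 2 ^ j = m at *
  set f := Int.castRingHom (ZMod 2)
  obtain ⟨U, hU⟩ := h
  have hB : Q - (1 - X) * R = 2 * (Q * φ) + X ^ (2 * m) * ((1 - X) * U + Q) := by
    linear_combination (1 - X) * hU - Q * hφ
  have hmul : ((1 - X) * R).natDegree ≤ e + 1 := by
    refine natDegree_mul_le.trans ?_
    have : (1 - X : ℤ[X]).natDegree ≤ 1 := by compute_degree
    omega
  have hBd : (Q - (1 - X) * R).natDegree ≤ max d (e + 1) :=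
    (natDegree_sub_le _ _).trans (max_le_max hQ hmul)
  have hB0 : (Q - (1 - X) * R).map f = 0 := by
    have h1 : X ^ (2 * m) ∣ (Q - (1 - X) * R).map f := by
      refine ⟨((1 - X) * U + Q).map f, ?_⟩
      have h2 : (2 : (ZMod 2)[X]) = 0 := by
        have : (2 : ZMod 2) = 0 := rfl
        rw [← C_ofNat, this, C_0]
      rw [hB, Polynomial.map_add, Polynomial.map_mul, Polynomial.map_mul (p := X ^ (2 * m))]
      simp [h2]
    by_contra h0
    have h2 := natDegree_le_of_dvd h1 h0
    rw [natDegree_X_pow] at h2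
    have h3 := h2.trans natDegree_map_le
    omega
  obtain ⟨B, hB2⟩ := exists_eq_two_mul_of_map_eq_zero hB0
  have hdvd : X ^ (2 * m) ∣ Q * φ - B := by
    refine X_pow_dvd_of_dvd_two_mul ⟨-((1 - X) * U + Q), ?_⟩
    linear_combination hB2 - hB
  have hBd' : B.natDegree ≤ max d (e + 1) := by rwa [hB2, natDegree_two_mul] at hBd
  have hQR : Q.map f = ((1 - X) * R).map f := by
    rwa [Polynomial.map_sub, sub_eq_zero] at hB0
  have hQd : (Q.map f).natDegree ≤ min d (e + 1) :=
    le_min (natDegree_map_le.trans hQ) (by rw [hQR]; exact natDegree_map_le.trans hmul)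
  have hdvd' : X ^ (2 * m) ∣ Q.map f * ((1 + X) ^ m * τ) - B.map f := by
    have := Polynomial.map_dvd f hdvd
    rwa [Polynomial.map_sub, Polynomial.map_mul, hmap, Polynomial.map_pow, map_X] at this
  obtain ⟨hQ0, -⟩ := pade_unique_of_quadratic (e := max (max d (e + 1)) m) hfrob hτ hτd hQd
    (natDegree_map_le.trans (hBd'.trans (le_max_left _ _))) (by omega) (by omega) (by omega) hdvd'
  refine ⟨exists_eq_two_mul_of_map_eq_zero hQ0, exists_eq_two_mul_of_map_eq_zero ?_⟩
  rw [hQ0, Polynomial.map_mul, eq_comm, mul_eq_zero] at hQR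
  refine hQR.resolve_left ?_
  rw [Polynomial.map_sub, Polynomial.map_one, map_X, ← neg_sub, ← C_1]
  exact neg_ne_zero.2 (X_sub_C_ne_zero 1)

theorem eq_zero_of_forall_two_pow_dvd {P : ℤ[X]} (h : ∀ n : ℕ, ∃ P', P = 2 ^ n * P') : P = 0 := by
  ext i
  obtain ⟨P', hP'⟩ := h (P.coeff i).natAbs
  refine Int.eq_zero_of_abs_lt_dvd (m := 2 ^ (P.coeff i).natAbs) ⟨P'.coeff i, ?_⟩ ?_
  · conv_lhs => rw [hP']
    rw [← C_ofNat, ← C_pow, coeff_C_mul]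
  · rw [Int.abs_eq_natAbs]
    exact_mod_cast Nat.lt_two_pow_self

theorem thueMorse_pade_eq_zero {k d e : ℕ} {Q R : ℤ[X]} (hQ : Q.natDegree ≤ d)
    (hR : R.natDegree ≤ e) (hde : d + e + 5 ≤ 2 ^ k)
    (h : X ^ 2 ^ k ∣ Q * ∏ i ∈ Finset.range k, (1 - X ^ 2 ^ i : ℤ[X]) - R) :
    Q = 0 ∧ R = 0 := by
  have key : ∀ n : ℕ, ∃ Q' R' : ℤ[X], Q = 2 ^ n * Q' ∧ R = 2 ^ n * R' ∧ Q'.natDegree ≤ d ∧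
      R'.natDegree ≤ e ∧ X ^ 2 ^ k ∣ Q' * ∏ i ∈ Finset.range k, (1 - X ^ 2 ^ i : ℤ[X]) - R' := by
    intro n
    induction n with
    | zero => exact ⟨Q, R, by simp, by simp, hQ, hR, h⟩
    | succ n ih =>
      obtain ⟨Q', R', hQ', hR', h1, h2, h3⟩ := ih
      obtain ⟨⟨Q'', rfl⟩, R'', rfl⟩ := thueMorse_pade_two_dvd h1 h2 hde h3
      rw [natDegree_two_mul] at h1 h2
      refine ⟨Q'', R'', by rw [hQ']; ring, by rw [hR']; ring, h1, h2, ?_⟩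
      rw [mul_assoc, ← mul_sub] at h3
      exact X_pow_dvd_of_dvd_two_mul h3
  constructor
  · exact eq_zero_of_forall_two_pow_dvd fun n => by
      obtain ⟨Q', -, h, -⟩ := key n
      exact ⟨Q', h⟩
  · exact eq_zero_of_forall_two_pow_dvd fun n => by
      obtain ⟨-, R', -, h, -⟩ := key n
      exact ⟨R', h⟩

theorem exists_pade (F : ℤ[X]) {M d e : ℕ} (h : M ≤ d + e + 1) : ∃ Q R : ℤ[X],
    (Q ≠ 0 ∨ R ≠ 0) ∧ Q.natDegree ≤ d ∧ R.natDegree ≤ e ∧ X ^ M ∣ Q * F - R := by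
  let g : (degreeLT ℤ (d + 1) × degreeLT ℤ (e + 1)) →ₗ[ℤ] Fin M → ℤ :=
    LinearMap.pi fun i => (lcoeff ℤ (i : ℕ)).comp
      (((LinearMap.mulRight ℤ F).comp (Submodule.subtype _)).coprod (-(Submodule.subtype _)))
  have hg : ¬ Function.Injective g := fun hinj => by
    have : Module.Finite ℤ (degreeLT ℤ (d + 1)) := Module.Finite.equiv (degreeLTEquiv ℤ _).symm
    have : Module.Finite ℤ (degreeLT ℤ (e + 1)) := Module.Finite.equiv (degreeLTEquiv ℤ _).symm
    have : Module.Free ℤ (degreeLT ℤ (d + 1)) := Module.Free.of_equiv (degreeLTEquiv ℤ _).symm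
    have : Module.Free ℤ (degreeLT ℤ (e + 1)) := Module.Free.of_equiv (degreeLTEquiv ℤ _).symm
    have := LinearMap.finrank_le_finrank_of_injective hinj
    rw [Module.finrank_prod, (degreeLTEquiv ℤ _).finrank_eq, (degreeLTEquiv ℤ _).finrank_eq,
      Module.finrank_fin_fun, Module.finrank_fin_fun, Module.finrank_fin_fun] at this
    omega
  rw [injective_iff_map_eq_zero] at hg
  push Not at hg
  obtain ⟨⟨⟨Q, hQ⟩, ⟨R, hR⟩⟩, h0, hne⟩ := hg
  refine ⟨Q, R, ?_, ?_, ?_, ?_⟩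
  · by_contra! hc
    obtain ⟨rfl, rfl⟩ := hc
    exact hne rfl
  · exact natDegree_le_iff_coeff_eq_zero.2 fun i hi =>
      (degree_lt_iff_coeff_zero _ _).1 (mem_degreeLT.1 hQ) i hi
  · exact natDegree_le_iff_coeff_eq_zero.2 fun i hi =>
      (degree_lt_iff_coeff_zero _ _).1 (mem_degreeLT.1 hR) i hi
  · rw [X_pow_dvd_iff]
    intro i hi
    have := congrFun h0 ⟨i, hi⟩
    simpa [g, sub_eq_add_neg] using this

theorem exists_thueMorse_pade_pair {k d e : ℕ} (hd : 4 ≤ d) (hde : d + e + 1 = 2 ^ k) :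
    ∃ Q₁ R₁ Q₂ R₂ : ℤ[X], Q₁.natDegree ≤ d ∧ R₁.natDegree ≤ e + 4 ∧ Q₂.natDegree ≤ d ∧
      R₂.natDegree ≤ e + 4 ∧ X ^ 2 ^ k ∣ Q₁ * ∏ i ∈ Finset.range k, (1 - X ^ 2 ^ i : ℤ[X]) - R₁ ∧
      X ^ 2 ^ k ∣ Q₂ * ∏ i ∈ Finset.range k, (1 - X ^ 2 ^ i : ℤ[X]) - R₂ ∧
      Q₁ * R₂ - Q₂ * R₁ ≠ 0 := by
  have deg : ∀ {Q R : ℤ[X]}, Q ≠ 0 ∨ R ≠ 0 →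
      X ^ 2 ^ k ∣ Q * ∏ i ∈ Finset.range k, (1 - X ^ 2 ^ i : ℤ[X]) - R →
      2 ^ k < Q.natDegree + R.natDegree + 5 := by
    intro Q R h0 h
    by_contra! hc
    obtain ⟨hQ, hR⟩ := thueMorse_pade_eq_zero le_rfl le_rfl hc h
    tauto
  obtain ⟨Q₁, R₁, h01, hQ₁, hR₁, h₁⟩ :=
    exists_pade (∏ i ∈ Finset.range k, (1 - X ^ 2 ^ i : ℤ[X])) (M := 2 ^ k) (d := d) (e := e)
      hde.ge
  obtain ⟨Q₂, R₂, h02, hQ₂, hR₂, h₂⟩ :=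
    exists_pade (∏ i ∈ Finset.range k, (1 - X ^ 2 ^ i : ℤ[X])) (M := 2 ^ k) (d := d - 4)
      (e := e + 4) (by omega)
  have d₁ := deg h01 h₁
  have d₂ := deg h02 h₂
  refine ⟨Q₁, R₁, Q₂, R₂, hQ₁, by omega, by omega, hR₂, h₁, h₂, fun h => ?_⟩
  have hQ0 : Q₁ ≠ 0 := by rintro rfl; simp at d₁; omega
  have hR0 : R₂ ≠ 0 := by rintro rfl; simp at d₂; omega
  have h3 := natDegree_mul hQ0 hR0
  rw [sub_eq_zero.1 h] at h3
  have := natDegree_mul_le (p := Q₂) (q := R₁)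
  omega

theorem eventually_abs_eval_le {P : ℤ[X]} {n : ℕ} (h : P.natDegree ≤ n) :
    ∀ᶠ H : ℤ in Filter.atTop, |P.eval H| ≤ H ^ (n + 1) := by
  filter_upwards [Filter.eventually_ge_atTop (∑ i ∈ Finset.range (n + 1), |P.coeff i|),
    Filter.eventually_ge_atTop 1] with H hH h1
  rw [eval_eq_sum_range' (Nat.lt_succ_of_le h)]
  calc |∑ i ∈ Finset.range (n + 1), P.coeff i * H ^ i|
      ≤ ∑ i ∈ Finset.range (n + 1), |P.coeff i * H ^ i| := Finset.abs_sum_le_sum_abs _ _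
    _ ≤ ∑ i ∈ Finset.range (n + 1), |P.coeff i| * H ^ n := by
        refine Finset.sum_le_sum fun i hi => ?_
        rw [abs_mul, abs_of_nonneg (a := H ^ i) (by positivity)]
        have : i ≤ n := by simpa [Nat.lt_succ_iff] using hi
        gcongr
    _ = (∑ i ∈ Finset.range (n + 1), |P.coeff i|) * H ^ n := by rw [Finset.sum_mul]
    _ ≤ H ^ (n + 1) := by
        rw [pow_succ']
        gcongr

theorem eventually_not_isRoot_int {P : ℤ[X]} (h : P ≠ 0) :
    ∀ᶠ H : ℤ in Filter.atTop, ¬ P.IsRoot H := by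
  obtain ⟨B, hB⟩ := (finite_setOfPred_isRoot h).bddAbove
  filter_upwards [Filter.eventually_gt_atTop B] with H hH hr
  exact (hB hr).not_gt hH

theorem eventually_pow_le_of_pow_dvd {k d e : ℕ} (hd : 4 ≤ d) (hde : d + e + 1 = 2 ^ k) :
    ∀ᶠ H : ℤ in Filter.atTop, ∀ P a b : ℤ, P ≠ 0 → |P| ≤ H → b ≠ 0 →
      H ^ 2 ^ k ∣ b * (P * ∏ i ∈ Finset.range k, (1 - H ^ 2 ^ i)) - a →
      H ^ 2 ^ k ≤ H ^ (e + 6) * |b| + H ^ (d + 1) * |a| := by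
  obtain ⟨Q₁, R₁, Q₂, R₂, hQ₁, hR₁, hQ₂, hR₂, h₁, h₂, hne⟩ := exists_thueMorse_pade_pair hd hde
  filter_upwards [eventually_abs_eval_le hQ₁, eventually_abs_eval_le hR₁,
    eventually_abs_eval_le hQ₂, eventually_abs_eval_le hR₂, eventually_not_isRoot_int hne,
    Filter.eventually_ge_atTop 1] with H eQ₁ eR₁ eQ₂ eR₂ hroot h1 P a b hP0 hP hb h
  have key : ∀ {Q R : ℤ[X]}, X ^ 2 ^ k ∣ Q * ∏ i ∈ Finset.range k, (1 - X ^ 2 ^ i : ℤ[X]) - R →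
      |Q.eval H| ≤ H ^ (d + 1) → |R.eval H| ≤ H ^ (e + 4 + 1) →
      R.eval H * P * b - Q.eval H * a ≠ 0 →
      H ^ 2 ^ k ≤ H ^ (e + 6) * |b| + H ^ (d + 1) * |a| := by
    intro Q R hdvd hQ hR h0
    have hdvd' := eval_dvd (x := H) hdvd
    simp only [eval_pow, eval_X, eval_sub, eval_mul, eval_prod, eval_one] at hdvd'
    have h2 : H ^ 2 ^ k ∣ R.eval H * P * b - Q.eval H * a := by
      have := dvd_sub (h.mul_left (Q.eval H)) (hdvd'.mul_left (P * b))
      have e : Q.eval H * (b * (P * ∏ i ∈ Finset.range k, (1 - H ^ 2 ^ i)) - a)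
          - P * b * (Q.eval H * ∏ i ∈ Finset.range k, (1 - H ^ 2 ^ i) - R.eval H)
          = R.eval H * P * b - Q.eval H * a := by ring
      rwa [e] at this
    calc H ^ 2 ^ k ≤ |R.eval H * P * b - Q.eval H * a| :=
          Int.le_of_dvd (abs_pos.2 h0) ((dvd_abs _ _).2 h2)
      _ ≤ |R.eval H * P * b| + |Q.eval H * a| := abs_sub _ _
      _ = |R.eval H| * |P| * |b| + |Q.eval H| * |a| := by simp only [abs_mul]
      _ ≤ H ^ (e + 4 + 1) * H * |b| + H ^ (d + 1) * |a| := by gcongr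
      _ = _ := by ring
  by_cases h0 : R₁.eval H * P * b - Q₁.eval H * a = 0
  · refine key h₂ eQ₂ eR₂ fun h0' => hroot ?_
    have : P * b * (Q₁ * R₂ - Q₂ * R₁).eval H = 0 := by
      simp only [eval_sub, eval_mul]
      linear_combination Q₁.eval H * h0' - Q₂.eval H * h0
    exact (mul_eq_zero.1 this).resolve_left (mul_ne_zero hP0 hb)
  · exact key h₁ eQ₁ eR₁ h0

theorem eventually_pow_le_abs_mul (k : ℕ) :
    ∀ᶠ H : ℤ in Filter.atTop, ∀ P a b : ℤ, P ≠ 0 → |P| ≤ H → a ≠ 0 → b ≠ 0 →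
      H ^ 2 ^ k ∣ b * (P * ∏ i ∈ Finset.range k, (1 - H ^ 2 ^ i)) - a →
      H ^ (2 ^ k - 9) ≤ |a * b| := by
  have hall : ∀ᶠ H : ℤ in Filter.atTop, ∀ d ∈ Finset.range (2 ^ k), 4 ≤ d → ∀ P a b : ℤ,
      P ≠ 0 → |P| ≤ H → b ≠ 0 →
      H ^ 2 ^ k ∣ b * (P * ∏ i ∈ Finset.range k, (1 - H ^ 2 ^ i)) - a →
      H ^ 2 ^ k ≤ H ^ (2 ^ k - 1 - d + 6) * |b| + H ^ (d + 1) * |a| := by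
    rw [Filter.eventually_all_finset]
    intro d hd
    rw [Finset.mem_range] at hd
    by_cases h4 : 4 ≤ d
    · filter_upwards [eventually_pow_le_of_pow_dvd h4
        (show d + (2 ^ k - 1 - d) + 1 = 2 ^ k by omega)] with H h _ using h
    · exact .of_forall fun H h => absurd h h4
  filter_upwards [hall, Filter.eventually_ge_atTop 2] with H hH h2 P a b hP0 hP ha hb h
  obtain ⟨c, hc1, hc2⟩ : ∃ c : ℕ, H ^ c ≤ |b| ∧ |b| < H ^ (c + 1) := by
    lift H to ℕ using by omega
    rw [Int.abs_eq_natAbs]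
    refine ⟨Nat.log H b.natAbs, ?_, ?_⟩
    · exact_mod_cast Nat.pow_log_le_self H (by simpa using hb)
    · exact_mod_cast Nat.lt_pow_succ_log_self (by omega) _
  have ha1 : 1 ≤ |a| := Int.one_le_abs ha
  rw [abs_mul]
  rcases le_or_gt (c + 9) (2 ^ k) with hc | hc
  · have h3 := hH (c + 7) (by rw [Finset.mem_range]; omega) (by omega) P a b hP0 hP hb h
    obtain ⟨r, hr⟩ := Nat.exists_eq_add_of_le hc
    have e1 : 2 ^ k - 1 - (c + 7) + 6 = r + 7 := by omega
    have e2 : 2 ^ k - 9 = c + r := by omega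
    rw [e1] at h3
    rw [e2]
    rw [hr] at h3
    have h4 : H ^ (c + 8) * H ^ r ≤ H ^ (c + 8) * |a| := by
      have h5 : H ^ (r + 7) * |b| ≤ H ^ (r + 7) * H ^ (c + 1) := by gcongr
      have h6 : 2 * (H ^ (c + 8) * H ^ r) ≤ H * (H ^ (c + 8) * H ^ r) := by gcongr
      have h7 : H ^ (c + 9 + r) = H * (H ^ (c + 8) * H ^ r) := by ring
      have h8 : H ^ (r + 7) * H ^ (c + 1) = H ^ (c + 8) * H ^ r := by ring
      have h9 : c + 7 + 1 = c + 8 := rfl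
      rw [h9] at h3
      linarith
    have h5 : H ^ r ≤ |a| := le_of_mul_le_mul_left h4 (by positivity)
    calc H ^ (c + r) = H ^ r * H ^ c := by ring
      _ ≤ |a| * |b| := by gcongr
  · calc H ^ (2 ^ k - 9) ≤ H ^ c := pow_le_pow_right₀ (by omega) (by omega)
      _ ≤ |b| := hc1
      _ ≤ |a| * |b| := le_mul_of_one_le_left (abs_nonneg _) ha1

theorem sum_thueMorse_eq_prod {S : Type*} [CommRing S] {t : ℕ → ℤ} (ht0 : t 0 = 1)
    (hte : ∀ n, t (2 * n) = t n) (hto : ∀ n, t (2 * n + 1) = - t n) (j : ℕ) (z : S) :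
    ∑ n ∈ Finset.range (2 ^ j), (t n : S) * z ^ n = ∏ i ∈ Finset.range j, (1 - z ^ 2 ^ i) := by
  have split : ∀ (f : ℕ → S) (N : ℕ), ∑ n ∈ Finset.range (2 * N), f n
      = ∑ n ∈ Finset.range N, (f (2 * n) + f (2 * n + 1)) := by
    intro f N
    induction N with
    | zero => simp
    | succ N ih =>
      rw [Finset.sum_range_succ _ N, ← ih, mul_add_one, Finset.sum_range_succ,
        Finset.sum_range_succ, add_assoc]
  induction j generalizing z with
  | zero => simp [ht0]
  | succ j ih =>
    have h : ∏ i ∈ Finset.range j, (1 - z ^ 2 ^ (i + 1)) = ∏ i ∈ Finset.range j,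
        (1 - (z ^ 2) ^ 2 ^ i) := Finset.prod_congr rfl fun i _ => by rw [← pow_mul, ← pow_succ']
    rw [pow_succ', split, Finset.prod_range_succ', h, ← ih (z ^ 2), Finset.sum_mul]
    refine Finset.sum_congr rfl fun n _ => ?_
    rw [hte, hto]
    push_cast
    ring

section Padic

variable {p : ℕ} [Fact p.Prime]

theorem norm_tsum_sub_sum_le (t : ℕ → ℤ) (N : ℕ) :
    ‖∑' n : ℕ, (t n : ℚ_[p]) * (p : ℚ_[p]) ^ n
      - ∑ n ∈ Finset.range N, (t n : ℚ_[p]) * (p : ℚ_[p]) ^ n‖ ≤ (p : ℝ) ^ (-N : ℤ) := by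
  have hp : 1 < (p : ℝ) := by exact_mod_cast (Fact.out : p.Prime).one_lt
  have hterm : ∀ n : ℕ, ‖(t n : ℚ_[p]) * (p : ℚ_[p]) ^ n‖ ≤ (p : ℝ)⁻¹ ^ n := fun n => by
    rw [norm_mul, norm_pow, Padic.norm_p]
    exact mul_le_of_le_one_left (by positivity) (Padic.norm_int_le_one _)
  have hs : Summable fun n : ℕ => (t n : ℚ_[p]) * (p : ℚ_[p]) ^ n :=
    .of_norm_bounded (summable_geometric_of_lt_one (by positivity) (inv_lt_one_of_one_lt₀ hp)) hterm
  rw [← hs.sum_add_tsum_nat_add N, add_sub_cancel_left]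
  refine IsUltrametricDist.norm_tsum_le_of_forall_le_of_nonneg (by positivity) fun n => ?_
  refine (hterm _).trans ?_
  rw [zpow_neg, zpow_natCast, ← inv_pow]
  exact pow_le_pow_of_le_one (by positivity) (inv_le_one_of_one_le₀ hp.le) (by omega)

theorem norm_mul_sub_le_iff_dvd {ξ : ℚ_[p]} {x : ℤ} {m N : ℕ} (hmN : N ≤ m)
    (hx : ‖ξ - x‖ ≤ (p : ℝ) ^ (-m : ℤ)) (a b : ℤ) :
    ‖(b : ℚ_[p]) * ξ - a‖ ≤ (p : ℝ) ^ (-N : ℤ) ↔ (p : ℤ) ^ N ∣ b * x - a := by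
  have hp : 1 ≤ (p : ℝ) := by exact_mod_cast (Fact.out : p.Prime).one_lt.le
  have hxb : ‖(b : ℚ_[p]) * (ξ - x)‖ ≤ (p : ℝ) ^ (-N : ℤ) := by
    rw [norm_mul]
    refine (mul_le_of_le_one_left (norm_nonneg _) (Padic.norm_int_le_one _)).trans (hx.trans ?_)
    exact zpow_le_zpow_right₀ hp (by omega)
  have := Padic.norm_int_le_pow_iff_dvd (p := p) (b * x - a) N
  push_cast at this
  rw [← this]
  constructor <;> intro h
  · have e : (b : ℚ_[p]) * x - a = (b * ξ - a) - b * (ξ - x) := by ring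
    rw [e, sub_eq_add_neg]
    exact (IsUltrametricDist.norm_add_le_max _ _).trans (max_le h (by rwa [norm_neg]))
  · have e : (b : ℚ_[p]) * ξ - a = (b * x - a) + b * (ξ - x) := by ring
    rw [e]
    exact (IsUltrametricDist.norm_add_le_max _ _).trans (max_le h hxb)

theorem two_le_uniformMultIrrExp {ξ : ℚ_[p]} {x : ℕ → ℤ}
    (hx : ∀ m : ℕ, ‖ξ - x m‖ ≤ (p : ℝ) ^ (-m : ℤ)) (hco : ∀ m, IsCoprime (p : ℤ) (x m)) :
    ((2 : ℝ) : EReal) ≤ uniformMultIrrExp p ξ := by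
  have hp1 : 1 < p := (Fact.out : p.Prime).one_lt
  have hp : 1 < (p : ℝ) := by exact_mod_cast hp1
  refine EReal.ge_of_forall_gt_iff_ge.1 fun μ hμ => le_sSup ⟨μ, rfl, ?_⟩
  rw [EReal.coe_lt_coe_iff] at hμ
  filter_upwards [(tendsto_rpow_atTop (sub_pos.2 hμ)).eventually_ge_atTop (p : ℝ),
    eventually_ge_atTop (p : ℝ)] with X hX hXp
  have hX1 : 1 < X := hp.trans_le hXp
  have hX0 : 0 < X := by linarith
  obtain ⟨m, hm1, hm2⟩ := exists_nat_pow_near (one_le_pow₀ hX1.le : 1 ≤ X ^ 2) hp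
  have hNX : (⌊X⌋₊ : ℝ) ≤ X := Nat.floor_le hX0.le
  have hcard : p ^ m < (⌊X⌋₊ + 1) * (⌊X⌋₊ + 1) := by
    have := Nat.lt_floor_add_one X
    have h2 : (p : ℝ) ^ m < (⌊X⌋₊ + 1) * (⌊X⌋₊ + 1) := by nlinarith
    exact_mod_cast h2
  have hlt : (⌊X⌋₊ : ℤ) < (p : ℤ) ^ m := by
    have h1 : X * p ≤ X ^ 2 := by nlinarith
    have h2 : X * p < p ^ m * p := by rw [← pow_succ]; linarith
    have h3 : (⌊X⌋₊ : ℝ) < (p : ℝ) ^ m := hNX.trans_lt (lt_of_mul_lt_mul_right h2 (by positivity))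
    exact_mod_cast h3
  have : NeZero (p ^ m) := ⟨by positivity⟩
  obtain ⟨u, hu, v, hv, huv, heq⟩ := Finset.exists_ne_map_eq_of_card_lt_of_maps_to
    (s := Finset.range (⌊X⌋₊ + 1) ×ˢ Finset.range (⌊X⌋₊ + 1))
    (t := (Finset.univ : Finset (ZMod (p ^ m))))
    (by simpa [ZMod.card] using hcard)
    (f := fun u => ((u.2 * x m - u.1 : ℤ) : ZMod (p ^ m))) (fun _ _ => Finset.mem_univ _)
  simp only [Finset.mem_product, Finset.mem_range] at hu hv
  obtain ⟨a, ha⟩ : ∃ a : ℤ, a = u.1 - v.1 := ⟨_, rfl⟩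
  obtain ⟨b, hb⟩ : ∃ b : ℤ, b = u.2 - v.2 := ⟨_, rfl⟩
  have haN : |a| ≤ ⌊X⌋₊ := by rw [abs_le]; omega
  have hbN : |b| ≤ ⌊X⌋₊ := by rw [abs_le]; omega
  have hab : ¬ (a = 0 ∧ b = 0) := fun h => huv (Prod.ext (by omega) (by omega))
  have hdvd : (p : ℤ) ^ m ∣ b * x m - a := by
    have h1 := (ZMod.intCast_eq_intCast_iff_dvd_sub _ _ _).1 heq
    rw [← dvd_neg] at h1
    push_cast at h1
    have e : b * x m - a = -(↑v.2 * x m - ↑v.1 - (↑u.2 * x m - ↑u.1)) := by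
      rw [ha, hb]
      ring
    rwa [e]
  have ha0 : a ≠ 0 := by
    intro h
    rw [h, sub_zero] at hdvd
    exact hab ⟨h, Int.eq_zero_of_abs_lt_dvd ((hco m).pow_left.dvd_of_dvd_mul_right hdvd)
      (hbN.trans_lt hlt)⟩
  have hb0 : b ≠ 0 := by
    intro h
    rw [h, zero_mul, zero_sub, dvd_neg] at hdvd
    exact hab ⟨Int.eq_zero_of_abs_lt_dvd hdvd (haN.trans_lt hlt), h⟩
  have habX : ((|a * b| : ℤ) : ℝ) ≤ X ^ 2 := by
    have h1 : ((|a * b| : ℤ) : ℝ) ≤ ⌊X⌋₊ * ⌊X⌋₊ := by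
      rw [abs_mul]
      exact_mod_cast mul_le_mul haN hbN (abs_nonneg _) (by positivity)
    nlinarith
  refine ⟨a, b, ?_, ?_, ?_⟩
  · have : 0 < |a * b| := abs_pos.2 (mul_ne_zero ha0 hb0)
    have : (0 : ℝ) < ((|a * b| : ℤ) : ℝ) := by exact_mod_cast this
    positivity
  · rw [← Real.sqrt_eq_rpow]
    exact Real.sqrt_le_iff.2 ⟨hX0.le, habX⟩
  · refine ((norm_mul_sub_le_iff_dvd le_rfl (hx m) a b).2 hdvd).trans ?_
    rw [zpow_neg, zpow_natCast, Real.rpow_neg hX0.le]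
    refine inv_anti₀ (by positivity) ?_
    have h1 : X ^ (2 - μ) * X ^ μ = X ^ 2 := by
      rw [← Real.rpow_add hX0, sub_add_cancel, Real.rpow_two]
    have h2 : (p : ℝ) * X ^ μ ≤ X ^ (2 - μ) * X ^ μ := by gcongr
    have h3 : (p : ℝ) * X ^ μ < p * p ^ m := by rw [← pow_succ']; linarith
    exact (lt_of_mul_lt_mul_left h3 (by positivity)).le

theorem uniformMultIrrExp_le_two {ξ : ℚ_[p]}
    (hx : ∀ j : ℕ, ‖ξ - (∏ i ∈ Finset.range j, (1 - (p : ℤ) ^ 2 ^ i) : ℤ)‖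
      ≤ (p : ℝ) ^ (-(2 ^ j : ℕ) : ℤ)) :
    uniformMultIrrExp p ξ ≤ ((2 : ℝ) : EReal) := by
  have hp1 : 1 < p := (Fact.out : p.Prime).one_lt
  refine sSup_le ?_
  rintro _ ⟨μ, rfl, h⟩
  rw [EReal.coe_le_coe_iff]
  by_contra! hμ
  have hμ0 : 0 < μ := by linarith
  obtain ⟨k, hk⟩ := pow_unbounded_of_one_lt (9 * μ / (μ - 2)) (one_lt_two : (1 : ℝ) < 2)
  rw [div_lt_iff₀ (by linarith)] at hk
  have hk9 : 9 ≤ 2 ^ k := by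
    have : (9 : ℝ) ≤ 2 ^ k := by
      by_contra! hc
      nlinarith
    exact_mod_cast this
  have hHtop : Tendsto (fun n : ℕ => (p : ℤ) ^ 2 ^ n) atTop atTop :=
    (tendsto_pow_atTop_atTop_of_one_lt (by exact_mod_cast hp1)).comp
      (tendsto_pow_atTop_atTop_of_one_lt one_lt_two)
  have hXtop : Tendsto (fun n : ℕ => (((p : ℤ) ^ 2 ^ n : ℤ) : ℝ) ^ ((2 ^ k : ℝ) / μ)) atTop atTop :=
    (tendsto_rpow_atTop (by positivity)).comp (tendsto_intCast_atTop_atTop.comp hHtop)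
  obtain ⟨n, h1, a, b, hab0, habX, hab⟩ :=
    ((hHtop.eventually (eventually_pow_le_abs_mul k)).and (hXtop.eventually h)).exists
  obtain ⟨H, hH⟩ : ∃ H : ℤ, H = (p : ℤ) ^ 2 ^ n := ⟨_, rfl⟩
  simp only [← hH] at h1 habX hab
  have hH1 : (1 : ℝ) < H := by
    rw [hH]
    exact_mod_cast one_lt_pow₀ hp1 (by positivity)
  have hab1 : a * b ≠ 0 := fun h0 => by
    rw [h0] at hab0
    norm_num at hab0
  have hdvd : (p : ℤ) ^ 2 ^ (n + k)
      ∣ b * ∏ i ∈ Finset.range (n + k), (1 - (p : ℤ) ^ 2 ^ i) - a := by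
    refine (norm_mul_sub_le_iff_dvd le_rfl (hx (n + k)) a b).1 (hab.trans_eq ?_)
    rw [← Real.rpow_mul (by linarith), mul_neg, div_mul_cancel₀ _ hμ0.ne', zpow_neg,
      Real.rpow_neg (by linarith), zpow_natCast, hH, pow_add, pow_mul]
    norm_cast
  have hprod : ∏ i ∈ Finset.range (n + k), (1 - (p : ℤ) ^ 2 ^ i)
      = (∏ i ∈ Finset.range n, (1 - (p : ℤ) ^ 2 ^ i)) * ∏ i ∈ Finset.range k, (1 - H ^ 2 ^ i) := by
    rw [Finset.prod_range_add, hH]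
    simp only [pow_add, pow_mul]
  rw [hprod, pow_add, pow_mul, ← hH] at hdvd
  have h2 := h1 _ a b (Finset.prod_ne_zero_iff.2 fun i _ => ?_) ?_ (left_ne_zero_of_mul hab1)
    (right_ne_zero_of_mul hab1) hdvd
  · have h3 : ((|a * b| : ℤ) : ℝ) ≤ (H : ℝ) ^ (2 * ((2 ^ k : ℝ) / μ)) := by
      rw [← Real.sqrt_eq_rpow] at habX
      have h4 := (Real.sqrt_le_iff.1 habX).2
      rwa [← Real.rpow_natCast, ← Real.rpow_mul (by linarith), mul_comm _ ((2 : ℕ) : ℝ)] at h4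
    have h4 : (H : ℝ) ^ ((2 ^ k - 9 : ℕ) : ℝ) ≤ ((|a * b| : ℤ) : ℝ) := by
      rw [Real.rpow_natCast]
      exact_mod_cast h2
    have h5 := (Real.rpow_le_rpow_left_iff hH1).1 (h4.trans h3)
    rw [Nat.cast_sub hk9, mul_div_assoc', le_div_iff₀ hμ0] at h5
    push_cast at h5
    nlinarith
  · have : 1 < (p : ℤ) ^ 2 ^ i := by exact_mod_cast one_lt_pow₀ hp1 (by positivity)
    omega
  · rw [hH]
    clear * - hp1
    induction n with
    | zero => simpa using by omega
    | succ n ih =>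
      have h3 : 1 ≤ (p : ℤ) ^ 2 ^ n := by exact_mod_cast Nat.one_le_pow _ _ (by omega)
      rw [Finset.prod_range_succ, abs_mul, pow_succ 2 n, pow_mul, sq]
      refine mul_le_mul ih ?_ (abs_nonneg _) (by positivity)
      rw [abs_le]
      omega

end Padic

theorem tm_uniformMultIrrExp (p : ℕ) [Fact p.Prime]
    (t : ℕ → ℤ) (ht0 : t 0 = 1)
    (hte : ∀ n, t (2 * n) = t n) (hto : ∀ n, t (2 * n + 1) = - t n)
    (ξ : ℚ_[p]) (hξ : ξ = ∑' n : ℕ, (t n : ℚ_[p]) * (p : ℚ_[p]) ^ n) :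
    uniformMultIrrExp p ξ = ((2 : ℝ) : EReal) := by
  have hx : ∀ j : ℕ, ‖ξ - (∏ i ∈ Finset.range j, (1 - (p : ℤ) ^ 2 ^ i) : ℤ)‖
      ≤ (p : ℝ) ^ (-(2 ^ j : ℕ) : ℤ) := fun j => by
    have h := norm_tsum_sub_sum_le (p := p) t (2 ^ j)
    rw [sum_thueMorse_eq_prod ht0 hte hto, ← hξ] at h
    push_cast at h ⊢
    exact h
  have hp : 1 ≤ (p : ℝ) := by exact_mod_cast (Fact.out : p.Prime).one_lt.le
  refine le_antisymm (uniformMultIrrExp_le_two hx) (two_le_uniformMultIrrExp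
    (x := fun m => ∏ i ∈ Finset.range m, (1 - (p : ℤ) ^ 2 ^ i)) (fun m => (hx m).trans ?_)
    fun m => IsCoprime.prod_right fun i _ => ⟨(p : ℤ) ^ (2 ^ i - 1), 1, ?_⟩)
  · exact zpow_le_zpow_right₀ hp (by
      have : m < 2 ^ m := Nat.lt_two_pow_self
      omega)
  · rw [← pow_succ, Nat.sub_add_cancel Nat.one_le_two_pow]
    ring
end

section
/- Let p be a prime number. There exists a positive real number c₁ (one may take c₁ = 4p³) such that for every real number N there exist nonzero integers a, b with |ab| > N and |b ξ_{t,p} − a|_p < c₁ |ab|^{−3/2}. -/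
section ThueMorse

variable {p : ℕ} [Fact p.Prime]

theorem padic_norm_sub_le_max (x y : ℚ_[p]) : ‖x - y‖ ≤ max ‖x‖ ‖y‖ := by
  simpa [sub_eq_add_neg] using IsUltrametricDist.norm_add_le_max x (-y)

theorem padic_norm_intCast_mul_pow_le (t : ℕ → ℤ) (y : ℚ_[p]) (n : ℕ) :
    ‖(t n : ℚ_[p]) * y ^ n‖ ≤ ‖y‖ ^ n := by
  rw [norm_mul, norm_pow]
  exact mul_le_of_le_one_left (by positivity) (Padic.norm_int_le_one _)

theorem padic_summable_intCast_mul_pow (t : ℕ → ℤ) {y : ℚ_[p]} (hy : ‖y‖ < 1) :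
    Summable fun n : ℕ => (t n : ℚ_[p]) * y ^ n :=
  Summable.of_norm_bounded (summable_geometric_of_lt_one (norm_nonneg y) hy)
    (padic_norm_intCast_mul_pow_le t y)

theorem padic_norm_tsum_intCast_mul_pow_le_one (t : ℕ → ℤ) {y : ℚ_[p]} (hy : ‖y‖ < 1) :
    ‖∑' n : ℕ, (t n : ℚ_[p]) * y ^ n‖ ≤ 1 :=
  IsUltrametricDist.norm_tsum_le_of_forall_le_of_nonneg zero_le_one fun n =>
    (padic_norm_intCast_mul_pow_le t y n).trans (pow_le_one₀ (norm_nonneg y) hy.le)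

theorem padic_norm_tsum_sub_one_le {t : ℕ → ℤ} (ht0 : t 0 = 1) {y : ℚ_[p]} (hy : ‖y‖ < 1) :
    ‖∑' n : ℕ, (t n : ℚ_[p]) * y ^ n - 1‖ ≤ ‖y‖ := by
  have h : ∑' n : ℕ, (t n : ℚ_[p]) * y ^ n - 1 =
      y * ∑' n : ℕ, (t (n + 1) : ℚ_[p]) * y ^ n := by
    rw [(padic_summable_intCast_mul_pow t hy).tsum_eq_zero_add, ← tsum_mul_left, ht0]
    simp only [Int.cast_one, pow_zero, mul_one, add_sub_cancel_left]
    exact tsum_congr fun n => by ring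
  rw [h, norm_mul]
  exact mul_le_of_le_one_right (norm_nonneg y)
    (padic_norm_tsum_intCast_mul_pow_le_one (fun n => t (n + 1)) hy)

theorem thueMorse_tsum_eq {t : ℕ → ℤ}
    (hte : ∀ n, t (2 * n) = t n) (hto : ∀ n, t (2 * n + 1) = - t n)
    {y : ℚ_[p]} (hy : ‖y‖ < 1) :
    ∑' n : ℕ, (t n : ℚ_[p]) * y ^ n = (1 - y) * ∑' n : ℕ, (t n : ℚ_[p]) * (y ^ 2) ^ n := by
  have hy2 : ‖y ^ 2‖ < 1 := by
    rw [norm_pow]; exact pow_lt_one₀ (norm_nonneg y) hy two_ne_zero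
  have hS := (padic_summable_intCast_mul_pow t hy2).hasSum
  have heven : HasSum (fun n : ℕ => (t (2 * n) : ℚ_[p]) * y ^ (2 * n))
      (∑' n : ℕ, (t n : ℚ_[p]) * (y ^ 2) ^ n) := by
    simpa only [hte, pow_mul] using hS
  have hodd : HasSum (fun n : ℕ => (t (2 * n + 1) : ℚ_[p]) * y ^ (2 * n + 1))
      (-y * ∑' n : ℕ, (t n : ℚ_[p]) * (y ^ 2) ^ n) := by
    refine (hS.mul_left (-y)).congr_fun fun n => ?_
    rw [hto, pow_succ, pow_mul]
    push_cast
    ring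
  have h := HasSum.even_add_odd (f := fun n : ℕ => (t n : ℚ_[p]) * y ^ n) heven hodd
  rw [h.tsum_eq, sub_mul, one_mul, neg_mul, sub_eq_add_neg]

theorem thueMorse_norm_mul_tsum_sub_le {t : ℕ → ℤ} (ht0 : t 0 = 1)
    (hte : ∀ n, t (2 * n) = t n) (hto : ∀ n, t (2 * n + 1) = - t n)
    {z : ℚ_[p]} (hz : ‖z‖ < 1) :
    ‖(1 - z) * ∑' n : ℕ, (t n : ℚ_[p]) * z ^ n - (1 - 2 * z)‖ ≤ ‖z‖ ^ 3 := by
  have hz2 : ‖z ^ 2‖ < 1 := by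
    rw [norm_pow]; exact pow_lt_one₀ (norm_nonneg z) hz two_ne_zero
  have hz4 : ‖(z ^ 2) ^ 2‖ < 1 := by
    rw [norm_pow]; exact pow_lt_one₀ (norm_nonneg _) hz2 two_ne_zero
  rw [thueMorse_tsum_eq hte hto hz, thueMorse_tsum_eq hte hto hz2]
  have hG := padic_norm_tsum_sub_one_le ht0 hz4
  generalize ∑' n : ℕ, (t n : ℚ_[p]) * ((z ^ 2) ^ 2) ^ n = G at hG ⊢
  have hone : ‖1 - z‖ ≤ 1 := by
    simpa [hz.le] using padic_norm_sub_le_max (1 : ℚ_[p]) z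
  have hone2 : ‖1 - z ^ 2‖ ≤ 1 := by
    have := padic_norm_sub_le_max (1 : ℚ_[p]) (z ^ 2)
    rwa [norm_one, max_eq_left hz2.le] at this
  have h2z : ‖2 - z‖ ≤ 1 := by
    refine (padic_norm_sub_le_max (2 : ℚ_[p]) z).trans (max_le ?_ hz.le)
    exact_mod_cast Padic.norm_int_le_one (p := p) 2
  have e : (1 - z) * ((1 - z) * ((1 - z ^ 2) * G)) - (1 - 2 * z) =
      z ^ 3 * (2 - z) + (1 - z) * (1 - z) * (1 - z ^ 2) * (G - 1) := by ring
  rw [e]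
  refine (IsUltrametricDist.norm_add_le_max _ _).trans (max_le ?_ ?_)
  · rw [norm_mul, norm_pow]
    exact mul_le_of_le_one_right (by positivity) h2z
  · rw [norm_mul, norm_mul, norm_mul]
    refine (mul_le_of_le_one_left (norm_nonneg _) ?_).trans (hG.trans ?_)
    · exact mul_le_one₀ (mul_le_one₀ hone (norm_nonneg _) hone) (norm_nonneg _) hone2
    · rw [← pow_mul, norm_pow]
      exact pow_le_pow_of_le_one (norm_nonneg z) hz.le (by norm_num)

theorem thueMorse_exists_int_factor {t : ℕ → ℤ}
    (hte : ∀ n, t (2 * n) = t n) (hto : ∀ n, t (2 * n + 1) = - t n) (n : ℕ) :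
    ∃ A : ℤ, A ≠ 0 ∧ |A| ≤ (p : ℤ) ^ 2 ^ n ∧
      ∑' k : ℕ, (t k : ℚ_[p]) * (p : ℚ_[p]) ^ k =
        A * ∑' k : ℕ, (t k : ℚ_[p]) * ((p : ℚ_[p]) ^ 2 ^ n) ^ k := by
  have hp : (1 : ℤ) < p := by exact_mod_cast (Fact.out : p.Prime).one_lt
  induction n with
  | zero => exact ⟨1, one_ne_zero, by simpa using hp.le, by simp⟩
  | succ n ih =>
    obtain ⟨A, hA, hAle, hAeq⟩ := ih
    have hx : (1 : ℤ) < (p : ℤ) ^ 2 ^ n := one_lt_pow₀ hp (by positivity)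
    refine ⟨A * (1 - (p : ℤ) ^ 2 ^ n), mul_ne_zero hA (by lia), ?_, ?_⟩
    · rw [abs_mul, pow_succ 2, pow_mul, sq]
      refine mul_le_mul hAle ?_ (abs_nonneg _) (by lia)
      rw [abs_le]
      constructor <;> lia
    · have hy : ‖(p : ℚ_[p]) ^ 2 ^ n‖ < 1 := by
        rw [norm_pow]
        exact pow_lt_one₀ (norm_nonneg _) Padic.norm_p_lt_one (by positivity)
      rw [hAeq, thueMorse_tsum_eq hte hto hy, pow_succ 2, pow_mul]
      push_cast
      ring

end ThueMorse

theorem tm_good_approximations (p : ℕ) [Fact p.Prime]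
    (t : ℕ → ℤ) (ht0 : t 0 = 1)
    (hte : ∀ n, t (2 * n) = t n) (hto : ∀ n, t (2 * n + 1) = - t n)
    (ξ : ℚ_[p]) (hξ : ξ = ∑' n : ℕ, (t n : ℚ_[p]) * (p : ℚ_[p]) ^ n) :
    ∃ c₁ : ℝ, 0 < c₁ ∧ ∀ N : ℝ, ∃ a b : ℤ, a ≠ 0 ∧ b ≠ 0 ∧
      N < ((|a * b| : ℤ) : ℝ) ∧
      ‖(b : ℚ_[p]) * ξ - (a : ℚ_[p])‖ < c₁ * ((|a * b| : ℤ) : ℝ) ^ (-(3 / 2) : ℝ) := by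
  refine ⟨9, by norm_num, fun N => ?_⟩
  have hp : 1 < p := (Fact.out : p.Prime).one_lt
  obtain ⟨n, hn⟩ := exists_nat_gt N
  obtain ⟨A, hA, hAle, hAeq⟩ := thueMorse_exists_int_factor (p := p) hte hto n
  have hnx : (n : ℤ) < (p : ℤ) ^ 2 ^ n := by
    exact_mod_cast (Nat.lt_two_pow_self (n := n)).trans (Nat.lt_pow_self hp)
  have hx : (1 : ℤ) < (p : ℤ) ^ 2 ^ n := one_lt_pow₀ (by exact_mod_cast hp) (by positivity)
  have hy : ‖(p : ℚ_[p]) ^ 2 ^ n‖ < 1 := by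
    rw [norm_pow]
    exact pow_lt_one₀ (norm_nonneg _) Padic.norm_p_lt_one (by positivity)
  have hynorm : ‖(p : ℚ_[p]) ^ 2 ^ n‖ = (((p : ℤ) ^ 2 ^ n : ℤ) : ℝ)⁻¹ := by
    rw [norm_pow, Padic.norm_p]; push_cast; rw [inv_pow]
  have hycast : (p : ℚ_[p]) ^ 2 ^ n = (((p : ℤ) ^ 2 ^ n : ℤ) : ℚ_[p]) := by push_cast; rfl
  rw [hycast] at hy hynorm hAeq
  generalize (p : ℤ) ^ 2 ^ n = x at *
  have hab : A * (1 - 2 * x ^ 2) ≠ 0 := mul_ne_zero hA (by nlinarith)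
  refine ⟨A * (1 - 2 * x ^ 2), 1 + x, hab, by lia, ?_, ?_⟩
  · refine hn.trans ?_
    have h1 : 1 ≤ |A * (1 - 2 * x ^ 2)| := Int.one_le_abs hab
    have h2 : |1 + x| = 1 + x := abs_of_pos (by lia)
    have : (n : ℤ) < |A * (1 - 2 * x ^ 2) * (1 + x)| := by
      rw [abs_mul, h2]; nlinarith
    exact_mod_cast this
  · have hupper : |A * (1 - 2 * x ^ 2) * (1 + x)| ≤ 4 * x ^ 4 := by
      have h1 : |1 - 2 * x ^ 2| ≤ 2 * x ^ 2 := by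
        rw [abs_le]; constructor <;> nlinarith
      have h2 : |1 + x| ≤ 2 * x := by
        rw [abs_le]; constructor <;> lia
      rw [abs_mul, abs_mul]
      calc |A| * |1 - 2 * x ^ 2| * |1 + x| ≤ x * (2 * x ^ 2) * (2 * x) := by gcongr
        _ = 4 * x ^ 4 := by ring
    have hpos : 0 < |A * (1 - 2 * x ^ 2) * (1 + x)| :=
      abs_pos.mpr (mul_ne_zero hab (by lia))
    have hx0 : (0 : ℝ) < x := by exact_mod_cast zero_lt_one.trans hx
    have hy2 : ‖(x : ℚ_[p]) ^ 2‖ < 1 := by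
      rw [norm_pow]; exact pow_lt_one₀ (norm_nonneg _) hy two_ne_zero
    have hkey := thueMorse_norm_mul_tsum_sub_le ht0 hte hto hy2
    have hle : ‖((1 + x : ℤ) : ℚ_[p]) * ξ - ((A * (1 - 2 * x ^ 2) : ℤ) : ℚ_[p])‖ ≤
        ((x : ℝ) ^ 6)⁻¹ := by
      have e : ((1 + x : ℤ) : ℚ_[p]) * ξ - ((A * (1 - 2 * x ^ 2) : ℤ) : ℚ_[p]) =
          A * ((1 - (x : ℚ_[p]) ^ 2) * ∑' k : ℕ, (t k : ℚ_[p]) * ((x : ℚ_[p]) ^ 2) ^ k -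
            (1 - 2 * (x : ℚ_[p]) ^ 2)) := by
        rw [hξ, hAeq, thueMorse_tsum_eq hte hto hy]
        push_cast
        ring
      rw [e, norm_mul]
      refine (mul_le_of_le_one_left (norm_nonneg _) (Padic.norm_int_le_one A)).trans
        (hkey.trans_eq ?_)
      rw [norm_pow, hynorm, ← pow_mul, inv_pow]
    have hrpow : ((4 * x ^ 4 : ℤ) : ℝ) ^ (-(3 / 2) : ℝ) = ((x : ℝ) ^ 6)⁻¹ / 8 := by
      have e : ((4 * x ^ 4 : ℤ) : ℝ) = (2 * (x : ℝ) ^ 2) ^ (2 : ℝ) := by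
        rw [Real.rpow_two]; push_cast; ring
      rw [e, ← Real.rpow_mul (by positivity),
        show (2 : ℝ) * (-(3 / 2)) = -((3 : ℕ) : ℝ) by norm_num,
        Real.rpow_neg (by positivity), Real.rpow_natCast]
      field_simp
      norm_num
    have hmono : ((4 * x ^ 4 : ℤ) : ℝ) ^ (-(3 / 2) : ℝ) ≤
        ((|A * (1 - 2 * x ^ 2) * (1 + x)| : ℤ) : ℝ) ^ (-(3 / 2) : ℝ) :=
      Real.rpow_le_rpow_of_nonpos (by exact_mod_cast hpos) (by exact_mod_cast hupper)
        (by norm_num)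
    have hinv : 0 < ((x : ℝ) ^ 6)⁻¹ := by positivity
    linarith
end

section
/- Let p be a prime number. There exists a positive real number c₂ such that for all nonzero integers r, s one has |s ξ_{t,p} − r|_p > c₂ |rs|^{−3/2}. -/
/-- The partial product `∏_{k < m} (1 - p ^ 2 ^ k)` of the Thue–Morse number. -/
def thueMorseProd (p m : ℕ) : ℤ := ∏ k ∈ Finset.range m, (1 - (p : ℤ) ^ 2 ^ k)

lemma sum_range_two_mul_eq {M : Type*} [AddCommMonoid M] (f : ℕ → M) (n : ℕ) :
    ∑ i ∈ Finset.range (2 * n), f i = ∑ i ∈ Finset.range n, (f (2 * i) + f (2 * i + 1)) := by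
  induction n with
  | zero => simp
  | succ n ih =>
    rw [Finset.sum_range_succ, ← ih, show 2 * (n + 1) = 2 * n + 1 + 1 by ring,
      Finset.sum_range_succ, Finset.sum_range_succ, add_assoc]

lemma thueMorse_sum_eq_prod {R : Type*} [CommRing R] (t : ℕ → ℤ) (ht0 : t 0 = 1)
    (hte : ∀ n, t (2 * n) = t n) (hto : ∀ n, t (2 * n + 1) = - t n) (m : ℕ) (x : R) :
    ∑ n ∈ Finset.range (2 ^ m), (t n : R) * x ^ n
      = ∏ k ∈ Finset.range m, (1 - x ^ 2 ^ k) := by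
  induction m generalizing x with
  | zero => simp [ht0]
  | succ m ih =>
    rw [pow_succ', sum_range_two_mul_eq, Finset.prod_range_succ']
    have h := ih (x ^ 2)
    simp only [← pow_mul, ← pow_succ'] at h
    rw [← h, Finset.sum_mul]
    refine Finset.sum_congr rfl fun n _ => ?_
    rw [hte, hto]
    push_cast
    ring

lemma exists_padicInt_thueMorse (p : ℕ) [Fact p.Prime]
    (t : ℕ → ℤ) (ht0 : t 0 = 1)
    (hte : ∀ n, t (2 * n) = t n) (hto : ∀ n, t (2 * n + 1) = - t n) :
    ∃ Ξ : ℤ_[p], (Ξ : ℚ_[p]) = ∑' n : ℕ, (t n : ℚ_[p]) * (p : ℚ_[p]) ^ n ∧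
      ∀ m, ∃ e : ℤ_[p], Ξ = thueMorseProd p m + (p : ℤ_[p]) ^ 2 ^ m * e := by
  have hp : 1 < (p : ℝ) := by exact_mod_cast (Fact.out : p.Prime).one_lt
  have hs : ∀ u : ℕ → ℤ, Summable fun n => (u n : ℤ_[p]) * (p : ℤ_[p]) ^ n := by
    intro u
    refine Summable.of_norm_bounded (g := fun n : ℕ => ((p : ℝ)⁻¹) ^ n)
      (summable_geometric_of_lt_one (by positivity) (inv_lt_one_of_one_lt₀ hp)) fun n => ?_
    rw [norm_mul, norm_pow, PadicInt.norm_p]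
    exact mul_le_of_le_one_left (by positivity) (PadicInt.norm_le_one _)
  refine ⟨∑' n, (t n : ℤ_[p]) * (p : ℤ_[p]) ^ n, ?_, fun m => ?_⟩
  · have hc : Continuous (PadicInt.Coe.ringHom (p := p)) := continuous_subtype_val
    have h := (hs t).hasSum.map (PadicInt.Coe.ringHom (p := p)) hc
    have h2 := h.tsum_eq
    refine Eq.trans h2.symm (tsum_congr fun n => ?_)
    simp
  · refine ⟨∑' n, (t (n + 2 ^ m) : ℤ_[p]) * (p : ℤ_[p]) ^ n, ?_⟩
    rw [← (hs t).sum_add_tsum_nat_add (2 ^ m), ← (hs fun n => t (n + 2 ^ m)).tsum_mul_left,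
      thueMorse_sum_eq_prod t ht0 hte hto]
    congr 1
    · simp [thueMorseProd]
    · refine tsum_congr fun n => ?_
      ring

lemma one_le_abs_mul_padicInt_norm {p : ℕ} [Fact p.Prime] {D : ℤ} (hD : D ≠ 0) :
    1 ≤ |(D : ℝ)| * ‖(D : ℤ_[p])‖ := by
  have hp : 0 < (p : ℝ) := by exact_mod_cast (Fact.out : p.Prime).pos
  have hD' : (D : ℤ_[p]) ≠ 0 := by exact_mod_cast hD
  set v := (D : ℤ_[p]).valuation with hv
  have hn := PadicInt.norm_eq_zpow_neg_valuation hD'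
  have hd : ((p ^ v : ℕ) : ℤ) ∣ D := by
    have := (PadicInt.norm_int_le_pow_iff_dvd (p := p) (k := D) (n := v)).1 hn.le
    exact_mod_cast this
  have hle : (p : ℝ) ^ v ≤ |(D : ℝ)| := by
    have := Int.le_of_dvd (abs_pos.2 hD) ((dvd_abs _ _).2 hd)
    exact_mod_cast this
  rw [hn, zpow_neg, zpow_natCast, ← div_eq_mul_inv, one_le_div (by positivity)]
  exact hle

lemma cross_eq_of_small {p : ℕ} [Fact p.Prime] {Ξ : ℤ_[p]} {r s r₀ s₀ : ℤ} {ε : ℝ}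
    (h : ‖(s : ℤ_[p]) * Ξ - r‖ ≤ ε) (h₀ : ‖(s₀ : ℤ_[p]) * Ξ - r₀‖ ≤ ε)
    (hlt : (|(s : ℝ)| * |(r₀ : ℝ)| + |(r : ℝ)| * |(s₀ : ℝ)|) * ε < 1) : s * r₀ = r * s₀ := by
  by_contra hne
  have hD : s * r₀ - r * s₀ ≠ 0 := sub_ne_zero.2 hne
  have h1 := one_le_abs_mul_padicInt_norm (p := p) hD
  have hε : 0 ≤ ε := (norm_nonneg _).trans h
  have h2 : ‖((s * r₀ - r * s₀ : ℤ) : ℤ_[p])‖ ≤ ε := by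
    have : ((s * r₀ - r * s₀ : ℤ) : ℤ_[p])
        = s₀ * ((s : ℤ_[p]) * Ξ - r) + -(s * ((s₀ : ℤ_[p]) * Ξ - r₀)) := by
      push_cast; ring
    rw [this]
    refine (PadicInt.nonarchimedean _ _).trans (max_le ?_ ?_)
    · rw [norm_mul]
      exact (mul_le_of_le_one_left (norm_nonneg _) (PadicInt.norm_le_one _)).trans h
    · rw [norm_neg, norm_mul]
      exact (mul_le_of_le_one_left (norm_nonneg _) (PadicInt.norm_le_one _)).trans h₀
  have h3 : |((s * r₀ - r * s₀ : ℤ) : ℝ)| ≤ |(s : ℝ)| * |(r₀ : ℝ)| + |(r : ℝ)| * |(s₀ : ℝ)| := by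
    push_cast
    rw [← abs_mul, ← abs_mul]
    exact abs_sub _ _
  have := mul_le_mul h3 h2 (norm_nonneg _) (by positivity)
  linarith

/-- Two proportional pairs: `(r, s) = k / g • (r₀, s₀)` with `g = gcd r₀ s₀`. -/
lemma exists_scaling {p : ℕ} [Fact p.Prime] {Ξ : ℤ_[p]} {r s r₀ s₀ : ℤ}
    (hs : s ≠ 0) (hs₀ : s₀ ≠ 0) (h : s * r₀ = r * s₀) :
    ∃ k : ℤ, k ≠ 0 ∧ (Int.gcd r₀ s₀ : ℝ) * |(r : ℝ)| = |(k : ℝ)| * |(r₀ : ℝ)| ∧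
      (Int.gcd r₀ s₀ : ℝ) * |(s : ℝ)| = |(k : ℝ)| * |(s₀ : ℝ)| ∧
      ‖(s₀ : ℤ_[p]) * Ξ - r₀‖ ≤ |(k : ℝ)| * ‖(s : ℤ_[p]) * Ξ - r‖ := by
  set g : ℤ := (Int.gcd r₀ s₀ : ℤ) with hg
  have hg0 : g ≠ 0 := by
    rw [hg]; exact_mod_cast (Int.gcd_pos_of_ne_zero_right _ hs₀).ne'
  obtain ⟨a, ha⟩ : g ∣ r₀ := Int.gcd_dvd_left ..
  obtain ⟨b, hb⟩ : g ∣ s₀ := Int.gcd_dvd_right ..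
  have hcop : IsCoprime b a := by
    refine IsCoprime.symm ⟨Int.gcdA r₀ s₀, Int.gcdB r₀ s₀, mul_left_cancel₀ hg0 ?_⟩
    have := Int.gcd_eq_gcd_ab r₀ s₀
    linear_combination -this - Int.gcdA r₀ s₀ * ha - Int.gcdB r₀ s₀ * hb
  have hab : s * a = r * b := mul_left_cancel₀ hg0 (by linear_combination h - s * ha + r * hb)
  obtain ⟨k, hk⟩ : b ∣ s := hcop.dvd_of_dvd_mul_right ⟨r, by rw [hab, mul_comm]⟩
  have hb0 : b ≠ 0 := by rintro rfl; simp_all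
  have hr : r = k * a := mul_right_cancel₀ hb0 (by rw [← hab, hk]; ring)
  have hk0 : k ≠ 0 := by rintro rfl; simp_all
  have hgr : (Int.gcd r₀ s₀ : ℝ) = |(g : ℝ)| := by
    rw [hg]; simp
  have hgk : g * r = k * r₀ := by rw [hr]; linear_combination -k * ha
  have hgs : g * s = k * s₀ := by rw [hk]; linear_combination -k * hb
  refine ⟨k, hk0, ?_, ?_, ?_⟩
  · rw [hgr, ← abs_mul, ← abs_mul]
    exact_mod_cast congrArg (fun z : ℤ => |(z : ℝ)|) hgk
  · rw [hgr, ← abs_mul, ← abs_mul]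
    exact_mod_cast congrArg (fun z : ℤ => |(z : ℝ)|) hgs
  · have e : (k : ℤ_[p]) * ((s₀ : ℤ_[p]) * Ξ - r₀) = g * ((s : ℤ_[p]) * Ξ - r) := by
      rw [ha, hb, hk, hr]; push_cast; ring
    have e2 := congrArg norm e
    rw [norm_mul, norm_mul] at e2
    have h1 := one_le_abs_mul_padicInt_norm (p := p) hk0
    calc ‖(s₀ : ℤ_[p]) * Ξ - r₀‖ ≤ (|(k : ℝ)| * ‖(k : ℤ_[p])‖) * ‖(s₀ : ℤ_[p]) * Ξ - r₀‖ :=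
          le_mul_of_one_le_left (norm_nonneg _) h1
      _ = |(k : ℝ)| * (‖(g : ℤ_[p])‖ * ‖(s : ℤ_[p]) * Ξ - r‖) := by rw [← e2]; ring
      _ ≤ _ := mul_le_mul_of_nonneg_left
          (mul_le_of_le_one_left (norm_nonneg _) (PadicInt.norm_le_one _)) (abs_nonneg _)

lemma false_of_better_approx {p : ℕ} [Fact p.Prime] {Ξ : ℤ_[p]} {r s r₀ s₀ : ℤ}
    {x y a b M γ C : ℝ} (hr : |(r : ℝ)| = (p : ℝ) ^ x) (hs : |(s : ℝ)| = (p : ℝ) ^ y)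
    (h : ‖(s : ℤ_[p]) * Ξ - r‖ ≤ (p : ℝ) ^ (-(3 / 2 * (x + y) + C)))
    (hr₀ : (p : ℝ) ^ (a - 3) ≤ |(r₀ : ℝ)|) (hr₀' : |(r₀ : ℝ)| ≤ (p : ℝ) ^ (a + 4))
    (hs₀ : (p : ℝ) ^ b ≤ |(s₀ : ℝ)|) (hs₀' : |(s₀ : ℝ)| ≤ (p : ℝ) ^ (b + 4))
    (h₀ : (p : ℝ) ^ (-M - 2) ≤ ‖(s₀ : ℤ_[p]) * Ξ - r₀‖)
    (h₀' : ‖(s₀ : ℤ_[p]) * Ξ - r₀‖ ≤ (p : ℝ) ^ (-M))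
    (hg : (Int.gcd r₀ s₀ : ℝ) ≤ (p : ℝ) ^ γ)
    (h1 : y + a + 6 ≤ M) (h2 : x + b + 6 ≤ M)
    (h3 : y + a + 6 ≤ 3 / 2 * (x + y) + C) (h4 : x + b + 6 ≤ 3 / 2 * (x + y) + C)
    (h5 : M + 7 + 3 * γ < 3 / 2 * (a + b) + C) : False := by
  have hp2 : (2 : ℝ) ≤ p := by exact_mod_cast (Fact.out : p.Prime).two_le
  have hp1 : (1 : ℝ) < p := by linarith
  have hp0 : (0 : ℝ) < p := by linarith
  have hpos : ∀ u : ℝ, 0 < (p : ℝ) ^ u := fun u => Real.rpow_pos_of_pos hp0 u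
  set κ := min M (3 / 2 * (x + y) + C) with hκ
  have key : s * r₀ = r * s₀ := by
    refine cross_eq_of_small (Ξ := Ξ) (ε := (p : ℝ) ^ (-κ)) (h.trans ?_) (h₀'.trans ?_) ?_
    · exact Real.rpow_le_rpow_of_exponent_le hp1.le (neg_le_neg (min_le_right _ _))
    · exact Real.rpow_le_rpow_of_exponent_le hp1.le (neg_le_neg (min_le_left _ _))
    · have hq : (p : ℝ) ^ (-2 : ℝ) ≤ 1 / 4 := by
        rw [Real.rpow_neg hp0.le, inv_eq_one_div]
        refine one_div_le_one_div_of_le (by norm_num) ?_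
        norm_cast
        nlinarith [(Fact.out : p.Prime).two_le]
      have e1 : |(s : ℝ)| * |(r₀ : ℝ)| * (p : ℝ) ^ (-κ) ≤ 1 / 4 := by
        refine le_trans ?_ hq
        calc |(s : ℝ)| * |(r₀ : ℝ)| * (p : ℝ) ^ (-κ)
            ≤ (p : ℝ) ^ y * (p : ℝ) ^ (a + 4) * (p : ℝ) ^ (-κ) := by rw [hs]; gcongr
          _ = (p : ℝ) ^ (y + (a + 4) + -κ) := by
            rw [Real.rpow_add hp0 (y + (a + 4)), Real.rpow_add hp0 y]
          _ ≤ _ := Real.rpow_le_rpow_of_exponent_le hp1.le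
              (by have := le_min h1 h3; linarith)
      have e2 : |(r : ℝ)| * |(s₀ : ℝ)| * (p : ℝ) ^ (-κ) ≤ 1 / 4 := by
        refine le_trans ?_ hq
        calc |(r : ℝ)| * |(s₀ : ℝ)| * (p : ℝ) ^ (-κ)
            ≤ (p : ℝ) ^ x * (p : ℝ) ^ (b + 4) * (p : ℝ) ^ (-κ) := by rw [hr]; gcongr
          _ = (p : ℝ) ^ (x + (b + 4) + -κ) := by
            rw [Real.rpow_add hp0 (x + (b + 4)), Real.rpow_add hp0 x]
          _ ≤ _ := Real.rpow_le_rpow_of_exponent_le hp1.le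
              (by have := le_min h2 h4; linarith)
      linarith
  have hs_ne : s ≠ 0 := by
    rintro rfl
    have := hpos y
    simp [← hs] at this
  have hs₀_ne : s₀ ≠ 0 := by
    rintro rfl
    have := hpos b
    simp at hs₀
    linarith
  obtain ⟨k, hk0, k1, k2, k3⟩ := exists_scaling (Ξ := Ξ) hs_ne hs₀_ne key
  have hk1 : (1 : ℝ) ≤ |(k : ℝ)| := by exact_mod_cast Int.one_le_abs hk0
  obtain ⟨w, hw⟩ : ∃ w : ℝ, |(k : ℝ)| = (p : ℝ) ^ w :=
    ⟨_, (Real.rpow_logb hp0 hp1.ne' (by linarith)).symm⟩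
  have hw0 : 0 ≤ w := by
    rw [hw, ← Real.rpow_zero (p : ℝ), Real.rpow_le_rpow_left_iff hp1] at hk1
    exact hk1
  have l1 : w + (a - 3) ≤ γ + x := by
    rw [← Real.rpow_le_rpow_left_iff hp1, Real.rpow_add hp0, Real.rpow_add hp0, ← hw, ← hr]
    calc |(k : ℝ)| * (p : ℝ) ^ (a - 3) ≤ |(k : ℝ)| * |(r₀ : ℝ)| := by gcongr
      _ = _ := k1.symm
      _ ≤ _ := by gcongr
  have l2 : w + b ≤ γ + y := by
    rw [← Real.rpow_le_rpow_left_iff hp1, Real.rpow_add hp0, Real.rpow_add hp0, ← hw, ← hs]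
    calc |(k : ℝ)| * (p : ℝ) ^ b ≤ |(k : ℝ)| * |(s₀ : ℝ)| := by gcongr
      _ = _ := k2.symm
      _ ≤ _ := by gcongr
  have l3 : -M - 2 ≤ w + -(3 / 2 * (x + y) + C) := by
    rw [← Real.rpow_le_rpow_left_iff hp1, Real.rpow_add hp0 w, ← hw]
    refine (h₀.trans k3).trans ?_
    gcongr
  linarith

lemma abs_thueMorseProd_le {p : ℕ} (hp : 2 ≤ p) (m : ℕ) :
    |thueMorseProd p m| ≤ (p : ℤ) ^ 2 ^ m := by
  induction m with
  | zero => simp [thueMorseProd]; omega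
  | succ m ih =>
    have h1 : (1 : ℤ) ≤ (p : ℤ) ^ 2 ^ m := one_le_pow₀ (by omega)
    have h2 : |1 - (p : ℤ) ^ 2 ^ m| ≤ (p : ℤ) ^ 2 ^ m := by rw [abs_le]; omega
    rw [thueMorseProd, Finset.prod_range_succ, abs_mul, pow_succ 2 m, pow_mul, pow_two]
    exact mul_le_mul ih h2 (abs_nonneg _) (by positivity)

lemma pow_le_abs_thueMorseProd {p : ℕ} (hp : 2 ≤ p) (m : ℕ) (hm : 1 ≤ m) :
    (p : ℤ) ^ 2 ^ m + 2 ≤ 3 * p * |thueMorseProd p m| := by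
  have hp' : (2 : ℤ) ≤ p := by exact_mod_cast hp
  induction m, hm using Nat.le_induction with
  | base =>
    have h : |1 - (p : ℤ)| = p - 1 := by rw [abs_sub_comm, abs_of_nonneg]; omega
    simp [thueMorseProd, h]
    nlinarith
  | succ m hm ih =>
    have h4 : (4 : ℤ) ≤ (p : ℤ) ^ 2 ^ m := by
      calc (4 : ℤ) = 2 ^ 2 ^ 1 := by norm_num
        _ ≤ (p : ℤ) ^ 2 ^ 1 := by gcongr
        _ ≤ _ := pow_le_pow_right₀ (by omega) (Nat.pow_le_pow_right (by norm_num) hm)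
    have h : |1 - (p : ℤ) ^ 2 ^ m| = (p : ℤ) ^ 2 ^ m - 1 := by
      rw [abs_sub_comm, abs_of_nonneg]; omega
    rw [thueMorseProd, Finset.prod_range_succ, abs_mul, h, pow_succ 2 m, pow_mul, ← mul_assoc]
    change _ ≤ 3 * (p : ℤ) * |thueMorseProd p m| * _
    nlinarith

lemma gcd_thueMorseProd_le {p : ℕ} {m : ℕ} {n b : ℤ} (hb : b ≠ 0)
    (h : (p : ℤ) ^ 2 ^ m - 1 ∣ n - b) : Int.gcd (thueMorseProd p m) n ≤ b.natAbs ^ m := by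
  have key : ∀ j ≤ m, Int.gcd (thueMorseProd p j) n ∣ b.natAbs ^ j := by
    intro j
    induction j with
    | zero => simp [thueMorseProd]
    | succ j ih =>
      intro hj
      have hd : 1 - (p : ℤ) ^ 2 ^ j ∣ n - b := by
        refine dvd_trans ?_ h
        obtain ⟨i, rfl⟩ := Nat.exists_eq_add_of_le (Nat.le_of_succ_le hj)
        rw [← neg_sub, neg_dvd, pow_add, pow_mul]
        simpa using sub_dvd_pow_sub_pow ((p : ℤ) ^ 2 ^ j) 1 (2 ^ i)
      have h1 : Int.gcd (1 - (p : ℤ) ^ 2 ^ j) n ∣ b.natAbs := by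
        rw [← Int.natCast_dvd]
        have e1 := (Int.gcd_dvd_left (1 - (p : ℤ) ^ 2 ^ j) n).trans hd
        have e2 := Int.gcd_dvd_right (1 - (p : ℤ) ^ 2 ^ j) n
        have := dvd_sub e2 e1
        simpa using this
      rw [thueMorseProd, Finset.prod_range_succ, pow_succ, Int.gcd, Int.natAbs_mul]
      refine (Nat.gcd_mul_left_dvd_mul_gcd _ _ _).trans (mul_dvd_mul ?_ h1)
      exact ih (by omega)
  exact Nat.le_of_dvd (by positivity) (key m le_rfl)

lemma gcd_thueMorseProd_succ_le_two {p : ℕ} [Fact p.Prime] {m : ℕ} (hm : 1 ≤ m) :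
    Int.gcd (thueMorseProd p m) (1 + (p : ℤ) ^ 2 ^ m) ≤ 2 := by
  obtain ⟨e, k, he, hek⟩ : ∃ e k : ℤ, (e = 1 ∨ e = 2) ∧ 1 + (p : ℤ) ^ 2 ^ m = e * (2 * k + 1) := by
    rcases (Fact.out : p.Prime).eq_two_or_odd' with rfl | hodd
    · refine ⟨1, 2 ^ (2 ^ m - 1), Or.inl rfl, ?_⟩
      have : (2 : ℤ) * 2 ^ (2 ^ m - 1) = 2 ^ 2 ^ m := by
        rw [← pow_succ', Nat.sub_add_cancel Nat.one_le_two_pow]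
      push_cast
      linarith
    · obtain ⟨i, rfl⟩ := Nat.exists_eq_add_of_le' hm
      obtain ⟨k, hk⟩ := hodd.pow (n := 2 ^ i)
      refine ⟨2, k * (k + 1), Or.inr rfl, ?_⟩
      rw [pow_succ 2 i, pow_mul]
      have : (p : ℤ) ^ 2 ^ i = 2 * k + 1 := by exact_mod_cast hk
      rw [this]; ring
  have hcop : IsCoprime (thueMorseProd p m) (2 * k + 1) := by
    refine IsCoprime.prod_left fun j hj => ?_
    obtain ⟨i, rfl⟩ := Nat.exists_eq_add_of_le (Finset.mem_range.1 hj).le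
    have hd : 1 - (p : ℤ) ^ 2 ^ j ∣ 1 - (p : ℤ) ^ 2 ^ (j + i) := by
      rw [pow_add, pow_mul]
      simpa using sub_dvd_pow_sub_pow 1 ((p : ℤ) ^ 2 ^ j) (2 ^ i)
    obtain ⟨w, hw⟩ := hd
    exact ⟨-k * w, 1 - k * e, by linear_combination k * hek + k * hw⟩
  rw [hek, Int.gcd, Int.natAbs_mul]
  refine (Nat.le_of_dvd ?_ (Nat.gcd_mul_right_dvd_mul_gcd _ _ _)).trans ?_
  · have : (2 * k + 1).natAbs ≠ 0 := by omega
    refine Nat.mul_pos (Nat.gcd_pos_of_pos_right _ (by omega)) (Nat.gcd_pos_of_pos_right _ (by omega))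
  · have h1 : Nat.gcd (thueMorseProd p m).natAbs (2 * k + 1).natAbs = 1 :=
      Int.isCoprime_iff_gcd_eq_one.1 hcop
    rw [h1, mul_one]
    exact (Nat.gcd_le_right _ (by omega)).trans (by omega)

/-- The approximations `P_m A(q) / B(q)` to the Thue–Morse number, where `q = p ^ 2 ^ m` and
`A / B` is a Padé approximant of order `M` to its generating function. -/
lemma norm_approx_bounds {p : ℕ} [Fact p.Prime] {Ξ : ℤ_[p]}
    (hΞ : ∀ m, ∃ e : ℤ_[p], Ξ = thueMorseProd p m + (p : ℤ_[p]) ^ 2 ^ m * e)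
    {m M : ℕ} {A B c d q : ℤ} (hq : q = (p : ℤ) ^ 2 ^ m) (hq8 : 8 ≤ q) (hM : M ≤ 7)
    (hc : c ≠ 0) (hc4 : |c| ≤ 4)
    (hAB : B * ((1 - q) * (1 - q ^ 2) * (1 - q ^ 4)) - A = q ^ M * (c + q * d)) :
    (p : ℝ) ^ (-((M : ℝ) * 2 ^ m) - 2) ≤ ‖(B : ℤ_[p]) * Ξ - (thueMorseProd p m * A : ℤ)‖ ∧
      ‖(B : ℤ_[p]) * Ξ - (thueMorseProd p m * A : ℤ)‖ ≤ (p : ℝ) ^ (-((M : ℝ) * 2 ^ m)) := by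
  have hp2 : (2 : ℝ) ≤ p := by exact_mod_cast (Fact.out : p.Prime).two_le
  have hp0 : (0 : ℝ) < p := by linarith
  obtain ⟨e, he⟩ := hΞ (m + 3)
  have hprod : thueMorseProd p (m + 3)
      = thueMorseProd p m * ((1 - q) * (1 - q ^ 2) * (1 - q ^ 4)) := by
    simp only [thueMorseProd, Finset.prod_range_succ, pow_add 2 m, pow_mul, hq]
    norm_num
    ring
  have hP : ‖(thueMorseProd p m : ℤ_[p])‖ = 1 := by
    rw [PadicInt.norm_intCast_eq_one_iff, thueMorseProd]
    refine IsCoprime.prod_left fun j _ => ⟨1, (p : ℤ) ^ (2 ^ j - 1), ?_⟩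
    rw [← pow_succ, Nat.sub_add_cancel Nat.one_le_two_pow]
    ring
  have hfac : (B : ℤ_[p]) * Ξ - (thueMorseProd p m * A : ℤ)
      = (q : ℤ_[p]) ^ M * (thueMorseProd p m * c
          + q * (thueMorseProd p m * d + B * (q : ℤ_[p]) ^ (7 - M) * e)) := by
    have h8 : (p : ℤ_[p]) ^ 2 ^ (m + 3) = (q : ℤ_[p]) ^ M * (q * (q : ℤ_[p]) ^ (7 - M)) := by
      rw [← pow_succ', ← pow_add, show M + (7 - M + 1) = 8 by omega, hq, pow_add 2 m]
      push_cast
      rw [pow_mul]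
    have hAB' : (B : ℤ_[p]) * ((1 - q) * (1 - q ^ 2) * (1 - q ^ 4)) - A = q ^ M * (c + q * d) := by
      exact_mod_cast congrArg (fun z : ℤ => (z : ℤ_[p])) hAB
    rw [he, hprod, h8]
    push_cast
    linear_combination (thueMorseProd p m : ℤ_[p]) * hAB'
  have hnq : ‖(q : ℤ_[p])‖ = ((q : ℝ))⁻¹ := by
    rw [hq]; push_cast
    rw [norm_pow, PadicInt.norm_p, inv_pow]
  have hqM : ((q : ℝ)⁻¹) ^ M = (p : ℝ) ^ (-((M : ℝ) * 2 ^ m)) := by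
    rw [Real.rpow_neg hp0.le, inv_pow, hq]
    push_cast
    rw [← pow_mul, ← Real.rpow_natCast]
    push_cast
    rw [mul_comm]
  have hc' : 1 / 4 ≤ ‖(thueMorseProd p m * c : ℤ_[p])‖ := by
    rw [norm_mul, hP, one_mul]
    have h1 := one_le_abs_mul_padicInt_norm (p := p) hc
    have h2 : |(c : ℝ)| ≤ 4 := by exact_mod_cast hc4
    nlinarith [norm_nonneg (c : ℤ_[p])]
  rw [hfac, norm_mul, norm_pow, hnq, hqM]
  set Z := (thueMorseProd p m * d + B * (q : ℤ_[p]) ^ (7 - M) * e : ℤ_[p])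
  refine ⟨?_, mul_le_of_le_one_right (by positivity) (PadicInt.norm_le_one _)⟩
  rw [sub_eq_add_neg, Real.rpow_add hp0]
  refine mul_le_mul_of_nonneg_left ?_ (by positivity)
  have hZ : ‖(q : ℤ_[p]) * Z‖ ≤ 1 / 8 := by
    rw [norm_mul, hnq]
    refine (mul_le_of_le_one_right (by positivity) (PadicInt.norm_le_one _)).trans ?_
    rw [inv_eq_one_div]
    exact one_div_le_one_div_of_le (by norm_num) (by exact_mod_cast hq8)
  rw [PadicInt.norm_add_eq_max_of_ne (by linarith)]
  refine le_trans ?_ (hc'.trans (le_max_left _ _))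
  rw [Real.rpow_neg hp0.le, inv_eq_one_div]
  refine one_div_le_one_div_of_le (by norm_num) ?_
  norm_cast
  nlinarith [(Fact.out : p.Prime).two_le]

lemma false_of_better_pade {p : ℕ} [Fact p.Prime] {Ξ : ℤ_[p]}
    (hΞ : ∀ m, ∃ e : ℤ_[p], Ξ = thueMorseProd p m + (p : ℤ_[p]) ^ 2 ^ m * e)
    {r s : ℤ} {x y C γ : ℝ} (hr : |(r : ℝ)| = (p : ℝ) ^ x) (hs : |(s : ℝ)| = (p : ℝ) ^ y)
    (h : ‖(s : ℤ_[p]) * Ξ - r‖ ≤ (p : ℝ) ^ (-(3 / 2 * (x + y) + C)))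
    {m M α β : ℕ} {A B c d q : ℤ} (hm : 2 ≤ m) (hq : q = (p : ℤ) ^ 2 ^ m) (hM : M ≤ 7)
    (hc : c ≠ 0) (hc4 : |c| ≤ 4)
    (hAB : B * ((1 - q) * (1 - q ^ 2) * (1 - q ^ 4)) - A = q ^ M * (c + q * d))
    (hA : q ^ α ≤ |A|) (hA' : |A| ≤ 10 * q ^ α) (hB : q ^ β ≤ |B|) (hB' : |B| ≤ 10 * q ^ β)
    (hg : (Int.gcd (thueMorseProd p m * A) B : ℝ) ≤ (p : ℝ) ^ γ)
    (h1 : y + (α + 1) * 2 ^ m + 6 ≤ M * 2 ^ m) (h2 : x + β * 2 ^ m + 6 ≤ M * 2 ^ m)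
    (h3 : y + (α + 1) * 2 ^ m + 6 ≤ 3 / 2 * (x + y) + C)
    (h4 : x + β * 2 ^ m + 6 ≤ 3 / 2 * (x + y) + C)
    (h5 : M * 2 ^ m + 7 + 3 * γ < 3 / 2 * ((α + 1 + β) * 2 ^ m) + C) : False := by
  have hp := (Fact.out : p.Prime).two_le
  have hp2 : (2 : ℝ) ≤ p := by exact_mod_cast hp
  have hp0 : (0 : ℝ) < p := by linarith
  have hq8 : 8 ≤ q := by
    calc (8 : ℤ) ≤ 2 ^ 2 ^ 2 := by norm_num
      _ ≤ (p : ℤ) ^ 2 ^ 2 := by gcongr; exact_mod_cast hp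
      _ ≤ _ := hq ▸ pow_le_pow_right₀ (by omega) (Nat.pow_le_pow_right (by norm_num) hm)
  have hqr : ∀ n : ℕ, (q : ℝ) ^ n = (p : ℝ) ^ ((n : ℝ) * 2 ^ m) := by
    intro n
    rw [hq]; push_cast
    rw [← pow_mul, ← Real.rpow_natCast]
    push_cast
    rw [mul_comm]
  have h16 : (16 : ℝ) ≤ (p : ℝ) ^ (4 : ℝ) := by
    calc (16 : ℝ) = 2 ^ (4 : ℝ) := by norm_num
      _ ≤ _ := by gcongr
  have h8 : (p : ℝ) ^ (-3 : ℝ) * (3 * p) ≤ 1 := by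
    have : (p : ℝ) ^ (3 : ℝ) = p ^ 3 := by norm_cast
    rw [Real.rpow_neg hp0.le, this, inv_mul_le_one₀ (by positivity)]
    nlinarith [mul_nonneg (mul_nonneg hp0.le (sub_nonneg.2 hp2)) (by linarith : 0 ≤ (p : ℝ) + 2)]
  obtain ⟨b1, b2⟩ := norm_approx_bounds hΞ hq hq8 hM hc hc4 hAB
  have hPu : |(thueMorseProd p m : ℝ)| ≤ q := by
    rw [hq]; exact_mod_cast abs_thueMorseProd_le hp m
  have hPl : (q : ℝ) ≤ 3 * p * |(thueMorseProd p m : ℝ)| := by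
    have := pow_le_abs_thueMorseProd hp m (by omega)
    rw [← hq] at this
    have h' : q ≤ 3 * p * |thueMorseProd p m| := by linarith
    exact_mod_cast h'
  have hA₁ : (q : ℝ) ^ α ≤ |(A : ℝ)| := by exact_mod_cast hA
  have hA₂ : |(A : ℝ)| ≤ 10 * (q : ℝ) ^ α := by exact_mod_cast hA'
  have hB₁ : (q : ℝ) ^ β ≤ |(B : ℝ)| := by exact_mod_cast hB
  have hB₂ : |(B : ℝ)| ≤ 10 * (q : ℝ) ^ β := by exact_mod_cast hB'
  have hq0 : (0 : ℝ) < q := by exact_mod_cast (by omega : 0 < q)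
  have hα : (q : ℝ) * q ^ α = (p : ℝ) ^ (((α : ℝ) + 1) * 2 ^ m) := by
    rw [← pow_succ', hqr]; push_cast; rfl
  refine false_of_better_approx (a := (α + 1) * 2 ^ m) (b := β * 2 ^ m) (M := M * 2 ^ m)
    hr hs h ?_ ?_ ?_ ?_ b1 b2 hg h1 h2 h3 h4 (by linarith)
  · rw [sub_eq_add_neg, Real.rpow_add hp0, ← hα]
    push_cast
    rw [abs_mul]
    calc (q : ℝ) * q ^ α * (p : ℝ) ^ (-3 : ℝ)
        ≤ (3 * p * |(thueMorseProd p m : ℝ)|) * |(A : ℝ)| * (p : ℝ) ^ (-3 : ℝ) := by gcongr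
      _ = |(thueMorseProd p m : ℝ)| * |(A : ℝ)| * ((p : ℝ) ^ (-3 : ℝ) * (3 * p)) := by ring
      _ ≤ _ := mul_le_of_le_one_right (by positivity) h8
  · rw [Real.rpow_add hp0, ← hα]
    push_cast
    rw [abs_mul]
    calc |(thueMorseProd p m : ℝ)| * |(A : ℝ)| ≤ q * (10 * (q : ℝ) ^ α) := by gcongr
      _ = q * (q : ℝ) ^ α * 10 := by ring
      _ ≤ _ := by gcongr; linarith
  · rw [← hqr]; exact hB₁
  · rw [Real.rpow_add hp0, ← hqr]
    calc |(B : ℝ)| ≤ 10 * (q : ℝ) ^ β := hB₂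
      _ = (q : ℝ) ^ β * 10 := by ring
      _ ≤ _ := by gcongr; linarith

/-- A Padé approximant of normal order is far from every better approximation. -/
lemma false_of_better_normal_pade {p : ℕ} [Fact p.Prime] {Ξ : ℤ_[p]}
    (hΞ : ∀ m, ∃ e : ℤ_[p], Ξ = thueMorseProd p m + (p : ℤ_[p]) ^ 2 ^ m * e)
    {r s : ℤ} {x y : ℝ} (hr : |(r : ℝ)| = (p : ℝ) ^ x) (hs : |(s : ℝ)| = (p : ℝ) ^ y)
    (h : ‖(s : ℤ_[p]) * Ξ - r‖ ≤ (p : ℝ) ^ (-(3 / 2 * (x + y) + 100)))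
    {m α β : ℕ} {A B b c d q : ℤ} (hm : 2 ≤ m) (hq : q = (p : ℤ) ^ 2 ^ m)
    (hβ : 1 ≤ β) (hM : α + 1 + β ≤ 7) (hc : c ≠ 0) (hc4 : |c| ≤ 4)
    (hAB : B * ((1 - q) * (1 - q ^ 2) * (1 - q ^ 4)) - A = q ^ (α + 1 + β) * (c + q * d))
    (hA : q ^ α ≤ |A|) (hA' : |A| ≤ 10 * q ^ α) (hB : q ^ β ≤ |B|) (hB' : |B| ≤ 10 * q ^ β)
    (hcop : IsCoprime A B) (hb : b ≠ 0) (hb10 : b.natAbs ≤ 10) (hBb : q - 1 ∣ B - b)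
    (h1 : y + 6 ≤ β * 2 ^ m) (h2 : x + 6 ≤ (α + 1) * 2 ^ m)
    (h3 : y + (α + 1) * 2 ^ m + 6 ≤ 3 / 2 * (x + y) + 100)
    (h4 : x + β * 2 ^ m + 6 ≤ 3 / 2 * (x + y) + 100) : False := by
  have hp2 : (2 : ℝ) ≤ p := by exact_mod_cast (Fact.out : p.Prime).two_le
  have hgcd : Int.gcd (thueMorseProd p m * A) B ≤ 10 ^ m := by
    have e : Int.gcd (thueMorseProd p m * A) B = Int.gcd (thueMorseProd p m) B := by
      rw [Int.gcd, Int.natAbs_mul]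
      exact Nat.Coprime.gcd_mul_right_cancel _ (Int.isCoprime_iff_gcd_eq_one.1 hcop)
    rw [e]
    exact (gcd_thueMorseProd_le hb (hq ▸ hBb)).trans (Nat.pow_le_pow_left hb10 m)
  have hg : (Int.gcd (thueMorseProd p m * A) B : ℝ) ≤ (p : ℝ) ^ (4 * m : ℝ) := by
    calc (Int.gcd (thueMorseProd p m * A) B : ℝ) ≤ 10 ^ m := by exact_mod_cast hgcd
      _ ≤ (2 ^ 4) ^ m := by gcongr; norm_num
      _ ≤ ((p : ℝ) ^ 4) ^ m := by gcongr
      _ = _ := by rw [← pow_mul]; exact_mod_cast (Real.rpow_natCast (p : ℝ) (4 * m)).symm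
  have hm12 : ∀ n : ℕ, 12 * n ≤ 2 ^ n + 32 := by
    intro n
    rcases lt_or_ge n 5 with hn | hn
    · interval_cases n <;> norm_num
    · induction n, hn using Nat.le_induction with
      | base => norm_num
      | succ n hn ih =>
        have : 2 ^ 5 ≤ 2 ^ n := Nat.pow_le_pow_right (by norm_num) hn
        rw [pow_succ]; omega
  have hmr : 12 * (m : ℝ) ≤ 2 ^ m + 32 := by exact_mod_cast hm12 m
  have hβr : (1 : ℝ) ≤ β := by exact_mod_cast hβ
  have hT : (0 : ℝ) < 2 ^ m := by positivity
  have hα0 : (0 : ℝ) ≤ α := by positivity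
  refine false_of_better_pade hΞ hr hs h hm hq hM hc hc4 hAB hA hA' hB hB' hg ?_ ?_ h3 h4 ?_
  · push_cast; linarith
  · push_cast; linarith
  · push_cast
    nlinarith [mul_le_mul_of_nonneg_right hβr hT.le, mul_nonneg hα0 hT.le]

/-- The approximant `(1 - 2 q ^ 2) / (1 + q)`, whose order exceeds the normal one, is far from
every better approximation. -/
lemma false_of_better_special_pade {p : ℕ} [Fact p.Prime] {Ξ : ℤ_[p]}
    (hΞ : ∀ m, ∃ e : ℤ_[p], Ξ = thueMorseProd p m + (p : ℤ_[p]) ^ 2 ^ m * e)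
    {r s : ℤ} {x y : ℝ} (hr : |(r : ℝ)| = (p : ℝ) ^ x) (hs : |(s : ℝ)| = (p : ℝ) ^ y)
    (h : ‖(s : ℤ_[p]) * Ξ - r‖ ≤ (p : ℝ) ^ (-(3 / 2 * (x + y) + 100)))
    {m : ℕ} (hm : 2 ≤ m) (h1 : y + 6 ≤ 3 * 2 ^ m) (h2 : x + 6 ≤ 5 * 2 ^ m)
    (h3 : y + 3 * 2 ^ m + 6 ≤ 3 / 2 * (x + y) + 100)
    (h4 : x + 2 ^ m + 6 ≤ 3 / 2 * (x + y) + 100) : False := by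
  have hp2 : (2 : ℝ) ≤ p := by exact_mod_cast (Fact.out : p.Prime).two_le
  obtain ⟨q, hq⟩ : ∃ q : ℤ, q = (p : ℤ) ^ 2 ^ m := ⟨_, rfl⟩
  have hq1 : 1 ≤ q := hq ▸ one_le_pow₀ (by exact_mod_cast (Fact.out : p.Prime).one_le)
  have hA : |1 - 2 * q ^ 2| = 2 * q ^ 2 - 1 := by
    rw [abs_sub_comm, abs_of_nonneg]; nlinarith
  have hB : |1 + q| = 1 + q := abs_of_nonneg (by omega)
  have hcop : IsCoprime (1 - 2 * q ^ 2) (1 + q) := ⟨-1, 2 - 2 * q, by ring⟩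
  have hgcd : Int.gcd (thueMorseProd p m * (1 - 2 * q ^ 2)) (1 + q) ≤ 2 := by
    have e : Int.gcd (thueMorseProd p m * (1 - 2 * q ^ 2)) (1 + q)
        = Int.gcd (thueMorseProd p m) (1 + q) := by
      rw [Int.gcd, Int.natAbs_mul]
      exact Nat.Coprime.gcd_mul_right_cancel _ (Int.isCoprime_iff_gcd_eq_one.1 hcop)
    rw [e, hq]
    exact gcd_thueMorseProd_succ_le_two (by omega)
  refine false_of_better_pade hΞ hr hs h (m := m) (M := 6) (α := 2) (β := 1) (c := 2) (d := -q)
    (A := 1 - 2 * q ^ 2) (B := 1 + q) (γ := 1) hm hq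
    (by norm_num) (by norm_num) (by norm_num) (by ring) ?_ ?_ ?_ ?_ ?_ ?_ ?_ ?_ ?_ ?_
  · rw [hA]; nlinarith
  · rw [hA]; nlinarith
  · rw [hB, pow_one]; omega
  · rw [hB, pow_one]; omega
  · rw [Real.rpow_one]
    exact le_trans (by exact_mod_cast hgcd) hp2
  all_goals push_cast; linarith

lemma false_of_better_approximation {p : ℕ} [Fact p.Prime] {Ξ : ℤ_[p]}
    (hΞ : ∀ m, ∃ e : ℤ_[p], Ξ = thueMorseProd p m + (p : ℤ_[p]) ^ 2 ^ m * e)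
    {r s : ℤ} {x y : ℝ} (hx : 0 ≤ x) (hy : 0 ≤ y)
    (hr : |(r : ℝ)| = (p : ℝ) ^ x) (hs : |(s : ℝ)| = (p : ℝ) ^ y)
    (h : ‖(s : ℤ_[p]) * Ξ - r‖ ≤ (p : ℝ) ^ (-(3 / 2 * (x + y) + 100))) : False := by
  have hex : ∃ m : ℕ, y + 6 ≤ 3 * 2 ^ (m + 4) ∧ x + 6 ≤ 5 * 2 ^ (m + 4) := by
    obtain ⟨n, hn⟩ := pow_unbounded_of_one_lt (x + y + 6) (by norm_num : (1 : ℝ) < 2)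
    refine ⟨n, ?_, ?_⟩ <;> rw [pow_add] <;> linarith
  classical
  obtain ⟨hm1, hm2⟩ := Nat.find_spec hex
  have hmin := fun n hn => Nat.find_min hex (m := n) hn
  generalize Nat.find hex = m at hm1 hm2 hmin
  rcases m with _ | m
  · norm_num at hm1 hm2
    exact false_of_better_special_pade hΞ hr hs h (m := 4) (by norm_num) (by linarith)
      (by linarith) (by linarith) (by linarith)
  have hprev : 3 * 2 ^ (m + 4) < y + 6 ∨ 5 * 2 ^ (m + 4) < x + 6 := by
    by_contra! hcon
    exact hmin m (by omega) hcon
  clear hmin hex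
  obtain ⟨T, hT⟩ : ∃ T : ℝ, T = 2 ^ (m + 4) := ⟨_, rfl⟩
  have hT16 : 16 ≤ T := by
    rw [hT, pow_add]
    have : (1 : ℝ) ≤ 2 ^ m := one_le_pow₀ (by norm_num)
    linarith
  have hT1 : (2 : ℝ) ^ (m + 1 + 4) = 2 * T := by rw [hT]; ring
  have hT2 : (2 : ℝ) ^ (m + 2 + 4) = 4 * T := by rw [hT]; ring
  rw [← hT] at hprev
  rw [hT1] at hm1 hm2
  have hq1 : ∀ n : ℕ, 1 ≤ (p : ℤ) ^ 2 ^ n := fun n =>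
    one_le_pow₀ (by exact_mod_cast (Fact.out : p.Prime).one_le)
  by_cases hE : y + 3 * (2 * T) + 6 ≤ 3 / 2 * (x + y) + 100
  · refine false_of_better_special_pade hΞ hr hs h (m := m + 1 + 4) (by omega) ?_ ?_ ?_ ?_ <;>
      rw [hT1] <;> rcases hprev with h' | h' <;> linarith
  have hy3 : 3 * T < y + 6 := by
    rcases hprev with h' | h'
    · exact h'
    · linarith
  have pow_mono : ∀ q : ℤ, 1 ≤ q → q ≤ q ^ 2 ∧ q ^ 2 ≤ q ^ 3 ∧ q ^ 3 ≤ q ^ 4 := fun q hq =>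
    ⟨by nlinarith, pow_le_pow_right₀ hq (by norm_num), pow_le_pow_right₀ hq (by norm_num)⟩
  by_cases hy4 : y + 6 ≤ 4 * T
  · by_cases hx1 : x + 6 ≤ T
    · obtain ⟨q, hq⟩ : ∃ q : ℤ, q = (p : ℤ) ^ 2 ^ (m + 4) := ⟨_, rfl⟩
      have hq' : 1 ≤ q := hq ▸ hq1 _
      obtain ⟨g1, g2, g3⟩ := pow_mono q hq'
      have hB : |1 + q + 2 * q ^ 2 + 2 * q ^ 3 + 4 * q ^ 4|
          = 1 + q + 2 * q ^ 2 + 2 * q ^ 3 + 4 * q ^ 4 := abs_of_nonneg (by positivity)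
      refine false_of_better_normal_pade hΞ hr hs h (m := m + 4) (α := 0) (β := 4)
        (A := 1) (B := 1 + q + 2 * q ^ 2 + 2 * q ^ 3 + 4 * q ^ 4) (b := 10) (c := -4)
        (d := -2 + 4 * q - q ^ 2 + 4 * q ^ 3 + 2 * q ^ 4 - 4 * q ^ 5)
        (by omega) hq (by norm_num) (by norm_num) (by norm_num) (by norm_num) (by ring)
        (by simp) (by simp) (by rw [hB]; linarith) (by rw [hB]; linarith) isCoprime_one_left
        (by norm_num) (by norm_num)
        ⟨4 * q ^ 3 + 6 * q ^ 2 + 8 * q + 9, by ring⟩ ?_ ?_ ?_ ?_ <;>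
      rw [← hT] <;> push_cast <;> linarith
    by_cases hx2 : x + 6 ≤ 2 * T
    · obtain ⟨q, hq⟩ : ∃ q : ℤ, q = (p : ℤ) ^ 2 ^ (m + 1 + 4) := ⟨_, rfl⟩
      have hq' : 1 ≤ q := hq ▸ hq1 _
      obtain ⟨g1, g2, g3⟩ := pow_mono q hq'
      have hB : |1 + q + 2 * q ^ 2| = 1 + q + 2 * q ^ 2 := abs_of_nonneg (by positivity)
      refine false_of_better_normal_pade hΞ hr hs h (m := m + 1 + 4) (α := 0) (β := 2)
        (A := 1) (B := 1 + q + 2 * q ^ 2) (b := 4) (c := -2)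
        (d := -2 + 2 * q + 2 * q ^ 3 + q ^ 4 - 2 * q ^ 5)
        (by omega) hq (by norm_num) (by norm_num) (by norm_num) (by norm_num) (by ring)
        (by simp) (by simp) (by rw [hB]; linarith) (by rw [hB]; linarith) isCoprime_one_left
        (by norm_num) (by norm_num) ⟨2 * q + 3, by ring⟩ ?_ ?_ ?_ ?_ <;>
      rw [hT1] <;> push_cast <;> linarith
    · obtain ⟨q, hq⟩ : ∃ q : ℤ, q = (p : ℤ) ^ 2 ^ (m + 2 + 4) := ⟨_, rfl⟩
      have hq' : 1 ≤ q := hq ▸ hq1 _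
      have hB : |1 + q| = 1 + q := abs_of_nonneg (by positivity)
      refine false_of_better_normal_pade hΞ hr hs h (m := m + 2 + 4) (α := 0) (β := 1)
        (A := 1) (B := 1 + q) (b := 2) (c := -2) (d := 2 * q ^ 3 - q ^ 5)
        (by omega) hq (by norm_num) (by norm_num) (by norm_num) (by norm_num) (by ring)
        (by simp) (by simp) (by rw [hB]; linarith) (by rw [hB]; linarith) isCoprime_one_left
        (by norm_num) (by norm_num) ⟨1, by ring⟩ ?_ ?_ ?_ ?_ <;>
      rw [hT2] <;> push_cast <;> linarith
  · obtain ⟨q, hq⟩ : ∃ q : ℤ, q = (p : ℤ) ^ 2 ^ (m + 1 + 4) := ⟨_, rfl⟩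
    have hq' : 1 ≤ q := hq ▸ hq1 _
    obtain ⟨g1, g2, g3⟩ := pow_mono q hq'
    by_cases hx2 : x + 6 ≤ 2 * T
    · have hB : |1 + q + 2 * q ^ 2 + 2 * q ^ 3| = 1 + q + 2 * q ^ 2 + 2 * q ^ 3 :=
        abs_of_nonneg (by positivity)
      refine false_of_better_normal_pade hΞ hr hs h (m := m + 1 + 4) (α := 0) (β := 3)
        (A := 1) (B := 1 + q + 2 * q ^ 2 + 2 * q ^ 3) (b := 6) (c := -4)
        (d := 2 * q + 3 * q ^ 3 - 2 * q ^ 5)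
        (by omega) hq (by norm_num) (by norm_num) (by norm_num) (by norm_num) (by ring)
        (by simp) (by simp) (by rw [hB]; linarith) (by rw [hB]; linarith) isCoprime_one_left
        (by norm_num) (by norm_num) ⟨2 * q ^ 2 + 4 * q + 5, by ring⟩ ?_ ?_ ?_ ?_ <;>
      rw [hT1] <;> push_cast <;> linarith
    · have hA : |1 - 2 * q| = 2 * q - 1 := by rw [abs_sub_comm, abs_of_nonneg]; linarith
      have hB : |1 - q - 2 * q ^ 3| = 2 * q ^ 3 + q - 1 := by
        rw [abs_of_nonpos] <;> linarith
      refine false_of_better_normal_pade hΞ hr hs h (m := m + 1 + 4) (α := 1) (β := 3)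
        (A := 1 - 2 * q) (B := 1 - q - 2 * q ^ 3) (b := -2) (c := 4)
        (d := -2 - q ^ 2 - 2 * q ^ 3 + 2 * q ^ 4)
        (by omega) hq (by norm_num) (by norm_num) (by norm_num) (by norm_num) (by ring)
        (by rw [hA]; linarith) (by rw [hA]; linarith) (by rw [hB]; linarith)
        (by rw [hB]; linarith)
        ⟨-(5 - 3 * (1 - 2 * q) + (1 - 2 * q) ^ 2), 4, by ring⟩
        (by norm_num) (by norm_num) ⟨-2 * q ^ 2 - 2 * q - 3, by ring⟩ ?_ ?_ ?_ ?_ <;>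
      rw [hT1] <;> push_cast <;> linarith

theorem tm_no_better_approximations (p : ℕ) [Fact p.Prime]
    (t : ℕ → ℤ) (ht0 : t 0 = 1)
    (hte : ∀ n, t (2 * n) = t n) (hto : ∀ n, t (2 * n + 1) = - t n)
    (ξ : ℚ_[p]) (hξ : ξ = ∑' n : ℕ, (t n : ℚ_[p]) * (p : ℚ_[p]) ^ n) :
    ∃ c₂ : ℝ, 0 < c₂ ∧ ∀ r s : ℤ, r ≠ 0 → s ≠ 0 →
      c₂ * ((|r * s| : ℤ) : ℝ) ^ (-(3 / 2) : ℝ) < ‖(s : ℚ_[p]) * ξ - (r : ℚ_[p])‖ := by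
  have hp1 : (1 : ℝ) < p := by exact_mod_cast (Fact.out : p.Prime).one_lt
  have hp0 : (0 : ℝ) < p := by linarith
  obtain ⟨Ξ, hΞξ, hΞ⟩ := exists_padicInt_thueMorse p t ht0 hte hto
  refine ⟨(p : ℝ) ^ (-100 : ℝ), by positivity, fun r s hr hs => ?_⟩
  by_contra! hle
  have key : ∀ z : ℤ, z ≠ 0 → ∃ u : ℝ, 0 ≤ u ∧ |(z : ℝ)| = (p : ℝ) ^ u := by
    intro z hz
    have hz1 : (1 : ℝ) ≤ |(z : ℝ)| := by exact_mod_cast Int.one_le_abs hz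
    exact ⟨_, Real.logb_nonneg hp1 hz1, (Real.rpow_logb hp0 hp1.ne' (by linarith)).symm⟩
  obtain ⟨x, hx, hrx⟩ := key r hr
  obtain ⟨y, hy, hsy⟩ := key s hs
  refine false_of_better_approximation hΞ hx hy hrx hsy ?_
  have hnorm : ‖(s : ℤ_[p]) * Ξ - r‖ = ‖(s : ℚ_[p]) * ξ - (r : ℚ_[p])‖ := by
    rw [hξ, ← hΞξ, PadicInt.norm_def]
    push_cast
    rfl
  rw [hnorm]
  refine hle.trans_eq ?_
  push_cast
  rw [abs_mul, hrx, hsy, ← Real.rpow_add hp0, ← Real.rpow_mul hp0.le, ← Real.rpow_add hp0]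
  congr 1
  ring
end

section
/- Let p be a prime number and c = (c_k)_{k≥0} a bounded sequence of integers such that the p-adic number ξ = Σ_{k≥0} c_k p^k is irrational. Then μ×(ξ) = 2/(1 − η(c)), with the convention that 2/0 = +∞. -/
open Filter

/-- The rational number `x_m = c₀/p^m + c₁/p^{m-1} + ⋯ + c_{m-1}/p`. -/
noncomputable def xm (p : ℕ) (c : ℕ → ℤ) (m : ℕ) : ℚ :=
  ∑ k ∈ Finset.range m, (c k : ℚ) / (p : ℚ) ^ (m - k)

/-- The largest partial quotient of the continued fraction expansion of `x`. -/
noncomputable def maxPartQuot (x : ℚ) : ℝ :=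
  sSup {r : ℝ | ∃ q ∈ (GenContFract.of x).partDens, r = (q : ℝ)}

/-- `η_m`, the real number such that the largest partial quotient of `x_m` is `p^{η_m m}`. -/
noncomputable def etaSeq (p : ℕ) (c : ℕ → ℤ) (m : ℕ) : ℝ :=
  Real.logb p (maxPartQuot (xm p c m)) / m

namespace GenContFract

open GenContFract (of)

variable {K : Type*} [Field K] [LinearOrder K] [FloorRing K]

/-- The continuants of a regular continued fraction are integers. -/
theorem exists_int_contsAux_of (x : K) (n : ℕ) :
    ∃ A B : ℤ, (of x).contsAux n = ⟨(A : K), (B : K)⟩ := by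
  induction n using Nat.twoStepInduction with
  | zero => exact ⟨1, 0, by simp⟩
  | one => exact ⟨⌊x⌋, 1, by simp⟩
  | more n ih ih' =>
    obtain ⟨A, B, h⟩ := ih
    obtain ⟨A', B', h'⟩ := ih'
    rcases hs : (of x).s.get? n with _ | gp
    · exact ⟨A', B', by rw [← h']; exact contsAux_stable_step_of_terminated hs⟩
    · obtain ⟨ha, z, hz⟩ := of_partNum_eq_one_and_exists_int_partDen_eq hs
      refine ⟨z * A' + A, z * B' + B, ?_⟩
      rw [contsAux_recurrence hs h h', ha, hz]
      simp

theorem exists_mem_partDens_of_fract_ne_zero {x : K} (h : Int.fract x ≠ 0) :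
    ∃ r, r ∈ (of x).partDens :=
  ⟨_, 0, (partDen_eq_s_b (of_s_head h)).symm⟩

variable [IsStrictOrderedRing K]

theorem one_le_dens_of (x : K) (n : ℕ) : 1 ≤ (of x).dens n := by
  induction n with
  | zero => simp
  | succ n ih => exact ih.trans of_den_mono

theorem exists_stream_of_s_get?_eq_some {x : K} {n : ℕ} {gp : Pair K}
    (h : (of x).s.get? n = some gp) :
    ∃ ifp : IntFractPair K, IntFractPair.stream x n = some ifp ∧ 0 < ifp.fr ∧
      gp.b = (⌊ifp.fr⁻¹⌋ : K) := by
  obtain ⟨ifp', h1, h2⟩ := IntFractPair.exists_succ_get?_stream_of_gcf_of_get?_eq_some h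
  obtain ⟨ifp, h3, h4, rfl⟩ := IntFractPair.succ_nth_stream_eq_some_iff.1 h1
  exact ⟨ifp, h3, lt_of_le_of_ne (IntFractPair.nth_stream_fr_nonneg h3) (Ne.symm h4), h2.symm⟩

theorem abs_sub_convs_eq {x : K} {n : ℕ} {ifp : IntFractPair K}
    (h : IntFractPair.stream x n = some ifp) (hfr : 0 < ifp.fr) :
    |x - (of x).convs n| =
      1 / ((of x).dens n * (ifp.fr⁻¹ * (of x).dens n + ((of x).contsAux n).b)) := by
  have h1 := sub_convs_eq h
  simp only [hfr.ne', if_false] at h1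
  have h2 : ((of x).contsAux (n + 1)).b = (of x).dens n := rfl
  have h3 := one_le_dens_of x n
  have h4 : 0 ≤ ((of x).contsAux n).b := zero_le_of_contsAux_b
  rw [h1, h2, abs_div, abs_pow, abs_neg, abs_one, one_pow, abs_of_pos]
  positivity

/-- Every partial quotient yields a good rational approximation. -/
theorem exists_approx_of_mem_partDens {x r : K} (hr : r ∈ (of x).partDens) :
    ∃ u v : ℤ, 0 < v ∧ v * x - u ≠ 0 ∧ |v * x - u| * v * r ≤ 1 := by
  obtain ⟨n, hn⟩ := hr
  replace hn : (of x).partDens.get? n = some r := hn.symm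
  obtain ⟨gp, hs, rfl⟩ := exists_s_b_of_partDen hn
  obtain ⟨ifp, h1, hfr, h2⟩ := exists_stream_of_s_get?_eq_some hs
  obtain ⟨u, v, huv⟩ := exists_int_contsAux_of x (n + 1)
  have hv : (of x).dens n = v := congrArg Pair.b huv
  have hu : (of x).nums n = u := congrArg Pair.a huv
  have h3 := one_le_dens_of x n
  have h4 : 0 ≤ ((of x).contsAux n).b := zero_le_of_contsAux_b
  have h5 : 0 < |x - (of x).convs n| := by
    rw [abs_sub_convs_eq h1 hfr]
    positivity
  have h6 := abs_sub_convergents_le' hn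
  have hb := of_one_le_get?_partDen hn
  have hc : (of x).convs n = u / v := by rw [conv_eq_num_div_den, hu, hv]
  rw [hv] at h3 h6
  rw [hc] at h5 h6
  have hv0 : (0 : K) < v := by linarith
  have h7 : (v : K) * x - u = v * (x - u / v) := by field_simp
  refine ⟨u, v, by exact_mod_cast hv0, ?_, ?_⟩
  · rw [h7]
    exact mul_ne_zero hv0.ne' (abs_pos.1 h5)
  · rw [h7, abs_mul, abs_of_pos hv0]
    rw [le_div_iff₀ (by positivity)] at h6
    linarith

theorem contsAux_b_le_dens_of (x : K) (n : ℕ) : ((of x).contsAux n).b ≤ (of x).dens n := by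
  cases n with
  | zero => simp
  | succ n => exact of_den_mono

theorem convs_of_rat_eq_convergent (x : ℚ) (n : ℕ) :
    (of x).convs n = (x : ℝ).convergent n := by
  induction n generalizing x with
  | zero => simp
  | succ n ih =>
    rw [convs_succ, Real.convergent_succ, ih]
    push_cast
    simp

/-- For a convergent of a rational number, the reduced denominator is the continuant. -/
theorem den_convs_of_rat {x : ℚ} {n : ℕ} (h : ¬ (of x).TerminatedAt n) :
    (((of x).convs n).den : ℚ) = (of x).dens n := by
  obtain ⟨u, v, huv⟩ := exists_int_contsAux_of x (n + 1)
  obtain ⟨u', v', huv'⟩ := exists_int_contsAux_of x (n + 2)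
  have hv : (of x).dens n = v := congrArg Pair.b huv
  have hu : (of x).nums n = u := congrArg Pair.a huv
  have hv' : (of x).dens (n + 1) = v' := congrArg Pair.b huv'
  have hu' : (of x).nums (n + 1) = u' := congrArg Pair.a huv'
  have hdet : (of x).nums n * (of x).dens (n + 1) - (of x).dens n * (of x).nums (n + 1)
      = (-1) ^ (n + 1) := SimpContFract.determinant (s := SimpContFract.of x) h
  rw [hv, hu, hv', hu'] at hdet
  have hdet' : u * v' - v * u' = (-1) ^ (n + 1) := by exact_mod_cast hdet
  have hcop : IsCoprime u v := by
    refine ⟨(-1) ^ (n + 1) * v', -(-1) ^ (n + 1) * u', ?_⟩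
    have : ((-1 : ℤ) ^ (n + 1)) * (-1) ^ (n + 1) = 1 := by
      rw [← mul_pow]; simp
    linear_combination (-1 : ℤ) ^ (n + 1) * hdet' + this
  have h3 := one_le_dens_of x n
  rw [hv] at h3
  have hv0 : 0 < v := by
    have : (0 : ℚ) < v := by linarith
    exact_mod_cast this
  rw [conv_eq_num_div_den, hu, hv]
  have := Rat.den_div_eq_of_coprime (a := u) (b := v) hv0 (Int.isCoprime_iff_gcd_eq_one.1 hcop)
  exact_mod_cast this

/-- A rational approximation good enough for Legendre's theorem forces a large partial quotient. -/
theorem exists_mem_partDens_of_approx {x : ℚ} {u v : ℤ} (hv : v ≠ 0) (hne : v * x - u ≠ 0)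
    (h : 2 * (|(v : ℚ)| * |v * x - u|) < 1) :
    ∃ r ∈ (of x).partDens, 1 ≤ 3 * r * (|(v : ℚ)| * |v * x - u|) := by
  set q : ℚ := u / v with hq
  have hvQ : (v : ℚ) ≠ 0 := by exact_mod_cast hv
  have hden : (q.den : ℚ) ≤ |(v : ℚ)| := by
    have h1 : (q.den : ℤ) ∣ v := by
      rw [hq, ← Rat.divInt_eq_div]
      exact Rat.den_dvd u v
    have h2 : (q.den : ℤ) ≤ |v| := Int.le_of_dvd (abs_pos.2 hv) ((dvd_abs _ _).2 h1)
    exact_mod_cast h2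
  have hqpos : (0 : ℚ) < q.den := by exact_mod_cast q.den_pos
  have hxq : (v : ℚ) * x - u = v * (x - q) := by rw [hq]; field_simp
  have hxq0 : 0 < |x - q| := by
    rw [hxq] at hne
    exact abs_pos.2 (right_ne_zero_of_mul hne)
  have habs : |(v : ℚ)| * |v * x - u| = |(v : ℚ)| ^ 2 * |x - q| := by
    rw [hxq, abs_mul]; ring
  have hsq : (q.den : ℚ) ^ 2 ≤ |(v : ℚ)| ^ 2 := by gcongr
  have hle : (q.den : ℚ) ^ 2 * |x - q| ≤ |(v : ℚ)| ^ 2 * |x - q| := by gcongr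
  have hleg : |x - q| < 1 / (2 * (q.den : ℚ) ^ 2) := by
    rw [lt_div_iff₀ (by positivity)]
    rw [habs] at h
    linarith
  obtain ⟨n, hn⟩ := Real.exists_rat_eq_convergent (ξ := (x : ℝ)) (q := q) (by
    have := (Rat.cast_lt (K := ℝ)).2 hleg
    push_cast at this
    exact this)
  rw [← convs_of_rat_eq_convergent] at hn
  have hnt : ¬ (of x).TerminatedAt n := by
    intro ht
    have := of_correctness_of_terminatedAt ht
    rw [← hn] at this
    exact hxq0.ne' (by rw [← this]; simp)
  obtain ⟨gp, hs⟩ : ∃ gp, (of x).s.get? n = some gp := Option.ne_none_iff_exists'.1 hnt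
  obtain ⟨ifp, h1, hfr, h2⟩ := exists_stream_of_s_get?_eq_some hs
  have hget := partDen_eq_s_b hs
  refine ⟨gp.b, ⟨n, hget.symm⟩, ?_⟩
  have hr1 := of_one_le_get?_partDen hget
  have hB := den_convs_of_rat hnt
  rw [← hn] at hB
  have heq := abs_sub_convs_eq h1 hfr
  rw [← hn, ← hB] at heq
  have hpB := contsAux_b_le_dens_of x n
  rw [← hB] at hpB
  have hpB0 : 0 ≤ ((of x).contsAux n).b := zero_le_of_contsAux_b
  have hfl : ifp.fr⁻¹ ≤ gp.b + 1 := by rw [h2]; exact (Int.lt_floor_add_one _).le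
  have hfr' : 0 < ifp.fr⁻¹ := inv_pos.2 hfr
  have hD : (q.den : ℚ) * (ifp.fr⁻¹ * q.den + ((of x).contsAux n).b) ≤ 3 * gp.b * q.den ^ 2 := by
    have : ifp.fr⁻¹ * q.den + ((of x).contsAux n).b ≤ (gp.b + 1) * q.den + q.den := by gcongr
    have h3 : (gp.b + 1) * q.den + q.den ≤ 3 * gp.b * (q.den : ℚ) := by nlinarith
    calc _ ≤ (q.den : ℚ) * (3 * gp.b * q.den) := by gcongr; linarith
      _ = _ := by ring
  have h4 : 1 ≤ 3 * gp.b * q.den ^ 2 * |x - q| := by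
    rw [heq, mul_one_div, le_div_iff₀ (by positivity)]
    linarith
  rw [habs]
  calc 1 ≤ _ := h4
    _ = 3 * gp.b * (q.den ^ 2 * |x - q|) := by ring
    _ ≤ _ := by gcongr

end GenContFract

section PartialSums

/-- The integer `c₀ + c₁ p + ⋯ + c_{m-1} p^{m-1}`. -/
def partialSum (p : ℕ) (c : ℕ → ℤ) (m : ℕ) : ℤ :=
  ∑ k ∈ Finset.range m, c k * (p : ℤ) ^ k

theorem xm_eq_partialSum_div {p : ℕ} (hp : p ≠ 0) (c : ℕ → ℤ) (m : ℕ) :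
    xm p c m = partialSum p c m / (p : ℚ) ^ m := by
  have hp' : (p : ℚ) ≠ 0 := by exact_mod_cast hp
  rw [xm, partialSum]
  push_cast
  rw [Finset.sum_div]
  refine Finset.sum_congr rfl fun k hk => ?_
  have hk' : k ≤ m := (Finset.mem_range.1 hk).le
  rw [div_eq_div_iff (by positivity) (by positivity), mul_assoc, ← pow_add,
    Nat.add_sub_cancel' hk']

theorem exists_dvd_of_mem_partDens {p : ℕ} (hp : p ≠ 0) {c : ℕ → ℤ} {m : ℕ} {r : ℚ}
    (hr : r ∈ (GenContFract.of (xm p c m)).partDens) :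
    ∃ a b : ℤ, a ≠ 0 ∧ b ≠ 0 ∧ (p : ℤ) ^ m ∣ b * partialSum p c m - a ∧
      ((|a * b| : ℤ) : ℚ) * r ≤ (p : ℚ) ^ m := by
  obtain ⟨u, v, hv, hne, hle⟩ := GenContFract.exists_approx_of_mem_partDens hr
  have hpm : (0 : ℚ) < (p : ℚ) ^ m := by positivity
  have hx : (v : ℚ) * xm p c m - u =
      ((v * partialSum p c m - u * (p : ℤ) ^ m : ℤ) : ℚ) / (p : ℚ) ^ m := by
    rw [xm_eq_partialSum_div hp]
    push_cast
    field_simp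
  refine ⟨v * partialSum p c m - u * (p : ℤ) ^ m, v, ?_, hv.ne', ⟨u, by ring⟩, ?_⟩
  · intro h
    rw [hx, h] at hne
    simp at hne
  · have hv' : (0 : ℚ) < v := by exact_mod_cast hv
    rw [hx, abs_div, abs_of_pos hpm, div_mul_eq_mul_div, div_mul_eq_mul_div,
      div_le_one hpm] at hle
    rw [Int.cast_abs, Int.cast_mul, abs_mul, abs_of_pos hv']
    exact hle

theorem exists_mem_partDens_of_dvd {p : ℕ} (hp : p ≠ 0) {c : ℕ → ℤ} {m : ℕ} {a b : ℤ}
    (ha : a ≠ 0) (hb : b ≠ 0) (hdvd : (p : ℤ) ^ m ∣ b * partialSum p c m - a)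
    (hlt : 2 * |a * b| < (p : ℤ) ^ m) :
    ∃ r ∈ (GenContFract.of (xm p c m)).partDens,
      (p : ℚ) ^ m ≤ 3 * r * ((|a * b| : ℤ) : ℚ) := by
  obtain ⟨u, hu⟩ := hdvd
  have hpm : (0 : ℚ) < (p : ℚ) ^ m := by positivity
  have hx : (b : ℚ) * xm p c m - u = (a : ℚ) / (p : ℚ) ^ m := by
    have hu' : (b : ℚ) * partialSum p c m - a = (p : ℚ) ^ m * u := by exact_mod_cast hu
    rw [xm_eq_partialSum_div hp]
    field_simp
    linarith
  have ha' : (a : ℚ) ≠ 0 := by exact_mod_cast ha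
  have habs : |(b : ℚ)| * |(b : ℚ) * xm p c m - u| = ((|a * b| : ℤ) : ℚ) / (p : ℚ) ^ m := by
    rw [hx, abs_div, abs_of_pos hpm, Int.cast_abs, Int.cast_mul, abs_mul]
    ring
  obtain ⟨r, hr, h⟩ := GenContFract.exists_mem_partDens_of_approx (x := xm p c m) (u := u) hb
    (by rw [hx]; positivity) (by
      rw [habs, mul_div_assoc', div_lt_one hpm]
      exact_mod_cast hlt)
  refine ⟨r, hr, ?_⟩
  rwa [habs, mul_div_assoc', le_div_iff₀ hpm, one_mul] at h

theorem one_le_of_mem_partDens {x r : ℚ} (hr : r ∈ (GenContFract.of x).partDens) : 1 ≤ r := by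
  obtain ⟨n, hn⟩ := hr
  exact GenContFract.of_one_le_get?_partDen hn.symm

theorem le_pow_of_mem_partDens {p : ℕ} (hp : p ≠ 0) {c : ℕ → ℤ} {m : ℕ} {r : ℚ}
    (hr : r ∈ (GenContFract.of (xm p c m)).partDens) : r ≤ (p : ℚ) ^ m := by
  obtain ⟨a, b, ha, hb, -, h⟩ := exists_dvd_of_mem_partDens hp hr
  have h1 : (1 : ℚ) ≤ ((|a * b| : ℤ) : ℚ) := by
    exact_mod_cast Int.one_le_abs (mul_ne_zero ha hb)
  have := one_le_of_mem_partDens hr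
  nlinarith

theorem le_maxPartQuot {p : ℕ} (hp : p ≠ 0) {c : ℕ → ℤ} {m : ℕ} {r : ℚ}
    (hr : r ∈ (GenContFract.of (xm p c m)).partDens) : (r : ℝ) ≤ maxPartQuot (xm p c m) := by
  refine le_csSup ⟨(p : ℝ) ^ m, ?_⟩ ⟨r, hr, rfl⟩
  rintro _ ⟨q, hq, rfl⟩
  exact_mod_cast le_pow_of_mem_partDens hp hq

theorem maxPartQuot_le_pow {p : ℕ} (hp : p ≠ 0) (c : ℕ → ℤ) (m : ℕ) :
    maxPartQuot (xm p c m) ≤ (p : ℝ) ^ m := by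
  refine Real.sSup_le ?_ (by positivity)
  rintro _ ⟨q, hq, rfl⟩
  exact_mod_cast le_pow_of_mem_partDens hp hq

theorem maxPartQuot_eq_zero_or_one_le {p : ℕ} (hp : p ≠ 0) (c : ℕ → ℤ) (m : ℕ) :
    maxPartQuot (xm p c m) = 0 ∨ 1 ≤ maxPartQuot (xm p c m) := by
  by_cases h : ∃ r, r ∈ (GenContFract.of (xm p c m)).partDens
  · obtain ⟨r, hr⟩ := h
    right
    have h1 : (1 : ℝ) ≤ r := by exact_mod_cast one_le_of_mem_partDens hr
    exact h1.trans (le_maxPartQuot hp hr)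
  · left
    have : {r : ℝ | ∃ q ∈ (GenContFract.of (xm p c m)).partDens, r = (q : ℝ)} = ∅ := by
      refine Set.eq_empty_iff_forall_notMem.2 ?_
      rintro _ ⟨q, hq, -⟩
      exact h ⟨q, hq⟩
    rw [maxPartQuot, this, Real.sSup_empty]

theorem etaSeq_nonneg {p : ℕ} (hp : 1 < p) (c : ℕ → ℤ) (m : ℕ) : 0 ≤ etaSeq p c m := by
  refine div_nonneg ?_ (Nat.cast_nonneg m)
  rcases maxPartQuot_eq_zero_or_one_le (by omega : p ≠ 0) c m with h | h
  · simp [h]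
  · exact Real.logb_nonneg (by exact_mod_cast hp) h

theorem etaSeq_le_one {p : ℕ} (hp : 1 < p) (c : ℕ → ℤ) (m : ℕ) : etaSeq p c m ≤ 1 := by
  have hp' : (1 : ℝ) < p := by exact_mod_cast hp
  refine div_le_one_of_le₀ ?_ (Nat.cast_nonneg m)
  rcases maxPartQuot_eq_zero_or_one_le (by omega : p ≠ 0) c m with h | h
  · simp [h]
  · rw [Real.logb_le_iff_le_rpow hp' (by linarith), Real.rpow_natCast]
    exact maxPartQuot_le_pow (by omega) c m

theorem limsup_etaSeq_mem_Icc {p : ℕ} (hp : 1 < p) (c : ℕ → ℤ) :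
    limsup (etaSeq p c) atTop ∈ Set.Icc 0 1 := by
  have hb : IsBoundedUnder (· ≤ ·) atTop (etaSeq p c) :=
    isBoundedUnder_of ⟨1, etaSeq_le_one hp c⟩
  have hcob : IsCoboundedUnder (· ≤ ·) atTop (etaSeq p c) :=
    IsCoboundedUnder.of_frequently_ge (a := 0)
      (Frequently.of_forall fun m => etaSeq_nonneg hp c m)
  exact ⟨le_limsup_of_frequently_le (Frequently.of_forall fun m => etaSeq_nonneg hp c m) hb,
    limsup_le_of_le hcob (Eventually.of_forall fun m => etaSeq_le_one hp c m)⟩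

end PartialSums

section Padic

variable {p : ℕ} [Fact p.Prime]

theorem summable_intCast_mul_pow (c : ℕ → ℤ) :
    Summable fun k : ℕ => (c k : ℚ_[p]) * (p : ℚ_[p]) ^ k := by
  have hp : (1 : ℝ) < p := by exact_mod_cast (Fact.out : p.Prime).one_lt
  refine Summable.of_norm_bounded (g := fun k : ℕ => ((p : ℝ)⁻¹) ^ k)
    (summable_geometric_of_lt_one (by positivity) (inv_lt_one_of_one_lt₀ hp)) fun k => ?_
  rw [norm_mul, norm_pow, Padic.norm_p]
  exact mul_le_of_le_one_left (by positivity) (Padic.norm_int_le_one _)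

theorem norm_tsum_sub_partialSum_le (c : ℕ → ℤ) (m : ℕ) :
    ‖(∑' k : ℕ, (c k : ℚ_[p]) * (p : ℚ_[p]) ^ k) - (partialSum p c m : ℚ_[p])‖
      ≤ (p : ℝ) ^ (-(m : ℤ)) := by
  have hs := summable_intCast_mul_pow (p := p) c
  have hN : (partialSum p c m : ℚ_[p]) =
      ∑ k ∈ Finset.range m, (c k : ℚ_[p]) * (p : ℚ_[p]) ^ k := by
    rw [partialSum]; push_cast; rfl
  rw [hN, ← hs.sum_add_tsum_nat_add m, add_sub_cancel_left]
  have hfac : (∑' k : ℕ, (c (k + m) : ℚ_[p]) * (p : ℚ_[p]) ^ (k + m)) =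
      (∑' k : ℕ, (c (k + m) : ℚ_[p]) * (p : ℚ_[p]) ^ k) * (p : ℚ_[p]) ^ m := by
    rw [← tsum_mul_right]
    exact tsum_congr fun k => by ring
  rw [hfac, norm_mul, norm_pow, Padic.norm_p, zpow_neg, zpow_natCast, inv_pow]
  refine mul_le_of_le_one_left (by positivity) ?_
  refine IsUltrametricDist.norm_tsum_le_of_forall_le_of_nonneg zero_le_one fun k => ?_
  rw [norm_mul, norm_pow]
  exact mul_le_one₀ (Padic.norm_int_le_one _) (by positivity)
    (pow_le_one₀ (norm_nonneg _) Padic.norm_p_lt_one.le)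

variable {c : ℕ → ℤ} {ξ : ℚ_[p]}

theorem norm_mul_sub_le_iff (hξ : ξ = ∑' k : ℕ, (c k : ℚ_[p]) * (p : ℚ_[p]) ^ k)
    (a b : ℤ) (m : ℕ) :
    ‖(b : ℚ_[p]) * ξ - (a : ℚ_[p])‖ ≤ (p : ℝ) ^ (-(m : ℤ)) ↔
      (p : ℤ) ^ m ∣ b * partialSum p c m - a := by
  have h1 : ‖(b : ℚ_[p]) * (ξ - partialSum p c m)‖ ≤ (p : ℝ) ^ (-(m : ℤ)) := by
    rw [norm_mul, hξ]
    exact (mul_le_of_le_one_left (norm_nonneg _) (Padic.norm_int_le_one _)).trans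
      (norm_tsum_sub_partialSum_le c m)
  have h2 := Padic.norm_int_le_pow_iff_dvd (p := p) (b * partialSum p c m - a) m
  push_cast at h2
  rw [← h2]
  constructor
  · intro h
    have : (b : ℚ_[p]) * partialSum p c m - a =
        (b * ξ - a) - b * (ξ - partialSum p c m) := by ring
    rw [this, sub_eq_add_neg]
    exact (IsUltrametricDist.norm_add_le_max _ _).trans (max_le h (by rwa [norm_neg]))
  · intro h
    have : (b : ℚ_[p]) * ξ - a =
        (b * partialSum p c m - a) + b * (ξ - partialSum p c m) := by ring
    rw [this]
    exact (IsUltrametricDist.norm_add_le_max _ _).trans (max_le h h1)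

/-- The solutions `(a, b)` of `0 < |bξ - a|_p ≤ |ab|^{-μ/2}`. -/
def goodApproximations (ξ : ℚ_[p]) (μ : ℝ) : Set (ℤ × ℤ) :=
  {ab : ℤ × ℤ | 0 < ‖(ab.2 : ℚ_[p]) * ξ - (ab.1 : ℚ_[p])‖ ∧
    ‖(ab.2 : ℚ_[p]) * ξ - (ab.1 : ℚ_[p])‖ ≤ ((|ab.1 * ab.2| : ℤ) : ℝ) ^ (-μ / 2)}

theorem mul_sub_ne_zero_of_irrational (hirr : ∀ q : ℚ, ξ ≠ (q : ℚ_[p])) {a b : ℤ}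
    (hb : b ≠ 0) : (b : ℚ_[p]) * ξ - a ≠ 0 := by
  intro h
  have hb' : (b : ℚ_[p]) ≠ 0 := by exact_mod_cast hb
  refine hirr (a / b) ?_
  push_cast
  rw [eq_div_iff hb']
  linear_combination h

theorem exists_zpow_neg_lt (p : ℕ) [Fact p.Prime] {ε : ℝ} (hε : 0 < ε) :
    ∃ M : ℕ, ∀ m ≥ M, (p : ℝ) ^ (-(m : ℤ)) < ε := by
  have hp : (1 : ℝ) < p := by exact_mod_cast (Fact.out : p.Prime).one_lt
  obtain ⟨M, hM⟩ := exists_pow_lt_of_lt_one hε (inv_lt_one_of_one_lt₀ hp)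
  refine ⟨M, fun m hm => lt_of_le_of_lt ?_ hM⟩
  rw [zpow_neg, zpow_natCast, ← inv_pow]
  exact pow_le_pow_of_le_one (by positivity) (inv_le_one_of_one_le₀ hp.le) hm

theorem eventually_exists_mem_partDens (hξ : ξ = ∑' k : ℕ, (c k : ℚ_[p]) * (p : ℚ_[p]) ^ k)
    (hξ0 : ξ ≠ 0) :
    ∀ᶠ m in atTop, ∃ r, r ∈ (GenContFract.of (xm p c m)).partDens := by
  have hp : p ≠ 0 := (Fact.out : p.Prime).ne_zero
  obtain ⟨M, hM⟩ := exists_zpow_neg_lt p (norm_pos_iff.2 hξ0)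
  filter_upwards [eventually_ge_atTop M] with m hm
  refine GenContFract.exists_mem_partDens_of_fract_ne_zero fun hfr => ?_
  refine (hM m hm).not_ge ?_
  have h := (norm_mul_sub_le_iff hξ 0 1 m).2 ?_
  · simpa using h
  · refine ⟨⌊xm p c m⌋, ?_⟩
    have h1 : xm p c m = ⌊xm p c m⌋ := by
      rw [← Int.self_sub_floor] at hfr
      linarith
    have h2 := xm_eq_partialSum_div hp c m
    rw [eq_div_iff (by positivity)] at h2
    rw [h1] at h2
    have h3 : ⌊xm p c m⌋ * (p : ℤ) ^ m = partialSum p c m := by exact_mod_cast h2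
    linarith

theorem infinite_goodApproximations (hξ : ξ = ∑' k : ℕ, (c k : ℚ_[p]) * (p : ℚ_[p]) ^ k)
    (hirr : ∀ q : ℚ, ξ ≠ (q : ℚ_[p])) {μ : ℝ} (hμ : 0 < μ)
    (hlt : μ * (1 - limsup (etaSeq p c) atTop) < 2) : (goodApproximations ξ μ).Infinite := by
  have hp1 := (Fact.out : p.Prime).one_lt
  have hp : (1 : ℝ) < p := by exact_mod_cast hp1
  have hp0 : p ≠ 0 := by omega
  have hθ : 1 - 2 / μ < limsup (etaSeq p c) atTop := by
    have : 1 - limsup (etaSeq p c) atTop < 2 / μ := by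
      rw [lt_div_iff₀ hμ]; linarith
    linarith
  have hcob : IsCoboundedUnder (· ≤ ·) atTop (etaSeq p c) :=
    IsCoboundedUnder.of_frequently_ge (a := 0)
      (Frequently.of_forall fun m => etaSeq_nonneg hp1 c m)
  have hfreq := (frequently_lt_of_lt_limsup hcob hθ).and_eventually
    (eventually_exists_mem_partDens hξ (by simpa using hirr 0))
  have hsmall : ∀ M : ℕ, ∃ ab ∈ goodApproximations ξ μ, ∃ m > M,
      ‖(ab.2 : ℚ_[p]) * ξ - (ab.1 : ℚ_[p])‖ ≤ (p : ℝ) ^ (-(m : ℤ)) := by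
    intro M
    obtain ⟨m, hm, hη, r₀, hr₀⟩ := frequently_atTop.1 hfreq (M + 1)
    have hm0 : (0 : ℝ) < m := by
      have : 0 < m := by omega
      exact_mod_cast this
    have hmax : (1 : ℝ) ≤ maxPartQuot (xm p c m) :=
      le_trans (by exact_mod_cast one_le_of_mem_partDens hr₀) (le_maxPartQuot hp0 hr₀)
    rw [etaSeq, lt_div_iff₀ hm0, Real.lt_logb_iff_rpow_lt hp (by linarith)] at hη
    obtain ⟨_, ⟨r, hr, rfl⟩, hlt⟩ := exists_lt_of_lt_csSup
      (s := {r : ℝ | ∃ q ∈ (GenContFract.of (xm p c m)).partDens, r = (q : ℝ)})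
      ⟨(r₀ : ℝ), r₀, hr₀, rfl⟩ hη
    obtain ⟨a, b, ha, hb, hdvd, hle⟩ := exists_dvd_of_mem_partDens hp0 hr
    have hnorm := (norm_mul_sub_le_iff hξ a b m).2 hdvd
    have hab1 : (1 : ℝ) ≤ ((|a * b| : ℤ) : ℝ) := by
      exact_mod_cast Int.one_le_abs (mul_ne_zero ha hb)
    have hle' : ((|a * b| : ℤ) : ℝ) * r ≤ (p : ℝ) ^ m := by exact_mod_cast hle
    have hab : ((|a * b| : ℤ) : ℝ) ≤ (p : ℝ) ^ (2 / μ * m) := by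
      have h1 : (p : ℝ) ^ m = (p : ℝ) ^ (2 / μ * m) * (p : ℝ) ^ ((1 - 2 / μ) * m) := by
        rw [← Real.rpow_add (by linarith), ← Real.rpow_natCast]
        congr 1; ring
      have h2 : 0 < (p : ℝ) ^ ((1 - 2 / μ) * m) := by positivity
      refine le_of_mul_le_mul_right ?_ h2
      rw [← h1]
      exact (mul_le_mul_of_nonneg_left hlt.le (by linarith)).trans hle'
    refine ⟨(a, b), ⟨norm_pos_iff.2 (mul_sub_ne_zero_of_irrational hirr hb), ?_⟩, m, hm, hnorm⟩
    refine hnorm.trans ?_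
    refine le_trans (le_of_eq ?_)
      (Real.rpow_le_rpow_of_nonpos (by linarith) hab (by linarith : -μ / 2 ≤ 0))
    rw [← Real.rpow_mul (by linarith), ← Real.rpow_intCast]
    congr 1
    push_cast
    field_simp
  intro hfin
  obtain ⟨ab₀, h₀, -⟩ := hsmall 0
  obtain ⟨ab, hab, hmin⟩ := Set.exists_min_image (goodApproximations ξ μ)
    (fun ab => ‖(ab.2 : ℚ_[p]) * ξ - (ab.1 : ℚ_[p])‖) hfin ⟨ab₀, h₀⟩
  obtain ⟨M, hM⟩ := exists_zpow_neg_lt p hab.1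
  obtain ⟨ab', hab', m, hm, hle⟩ := hsmall M
  exact ((hmin ab' hab').trans hle).not_gt (hM m hm.le)

theorem exists_norm_eq_zpow_neg (hξ : ξ = ∑' k : ℕ, (c k : ℚ_[p]) * (p : ℚ_[p]) ^ k)
    {a b : ℤ} (h : 0 < ‖(b : ℚ_[p]) * ξ - (a : ℚ_[p])‖) :
    ∃ m : ℕ, ‖(b : ℚ_[p]) * ξ - (a : ℚ_[p])‖ = (p : ℝ) ^ (-(m : ℤ)) := by
  have h1 : ‖(b : ℚ_[p]) * ξ - (a : ℚ_[p])‖ ≤ 1 := by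
    simpa using (norm_mul_sub_le_iff hξ a b 0).2 (by simp)
  have h0 := norm_pos_iff.1 h
  rw [Padic.norm_le_one_iff_val_nonneg] at h1
  refine ⟨((b : ℚ_[p]) * ξ - (a : ℚ_[p])).valuation.toNat, ?_⟩
  rw [Int.toNat_of_nonneg h1, Padic.norm_eq_zpow_neg_valuation h0]

theorem exists_large_of_infinite {μ : ℝ} (hμ : 0 < μ) (h : (goodApproximations ξ μ).Infinite)
    (K : ℕ) : ∃ a b : ℤ, (a, b) ∈ goodApproximations ξ μ ∧ a ≠ 0 ∧ b ≠ 0 ∧ (K : ℤ) < |a * b| := by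
  by_contra! hcon
  refine h (((Set.finite_Icc (-(K : ℤ)) K).prod (Set.finite_Icc (-(K : ℤ)) K)).subset ?_)
  rintro ⟨a, b⟩ hab
  have hne : a * b ≠ 0 := by
    intro h0
    have h1 := hab.1.trans_le hab.2
    simp only [h0, abs_zero, Int.cast_zero] at h1
    rw [Real.zero_rpow (by linarith)] at h1
    exact h1.false
  have ha : a ≠ 0 := left_ne_zero_of_mul hne
  have hb : b ≠ 0 := right_ne_zero_of_mul hne
  have hK := hcon a b hab ha hb
  rw [abs_mul] at hK
  have h1 := Int.one_le_abs ha
  have h2 := Int.one_le_abs hb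
  exact ⟨abs_le.1 (by nlinarith), abs_le.1 (by nlinarith)⟩

theorem mul_one_sub_limsup_le_two (hξ : ξ = ∑' k : ℕ, (c k : ℚ_[p]) * (p : ℚ_[p]) ^ k)
    {μ : ℝ} (h : (goodApproximations ξ μ).Infinite) :
    μ * (1 - limsup (etaSeq p c) atTop) ≤ 2 := by
  have hp1 := (Fact.out : p.Prime).one_lt
  have hp : (1 : ℝ) < p := by exact_mod_cast hp1
  have hp0 : p ≠ 0 := by omega
  obtain ⟨hη0, hη1⟩ := limsup_etaSeq_mem_Icc hp1 c
  rcases le_or_gt μ 2 with hμ | hμ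
  · nlinarith
  have hμ0 : 0 < μ := by linarith
  suffices hsuff : 1 - 2 / μ ≤ limsup (etaSeq p c) atTop by
    have : 1 - limsup (etaSeq p c) atTop ≤ 2 / μ := by linarith
    rw [le_div_iff₀ hμ0] at this
    linarith
  refine le_of_forall_pos_sub_le fun ε hε => ?_
  refine le_limsup_of_frequently_le ?_ (isBoundedUnder_of ⟨1, etaSeq_le_one hp1 c⟩)
  refine frequently_atTop.2 fun M₀ => ?_
  obtain ⟨M₁, hM₁⟩ := exists_nat_gt (Real.logb p 3 / ε)
  have htend : Tendsto (fun K : ℕ => (K : ℝ) ^ (μ / 2 - 1)) atTop atTop :=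
    (tendsto_rpow_atTop (by linarith)).comp tendsto_natCast_atTop_atTop
  obtain ⟨K, hK2, hK⟩ := ((htend.eventually_gt_atTop 2).and
    (eventually_ge_atTop (p ^ (M₀ + M₁ + 1)))).exists
  obtain ⟨a, b, ⟨hpos, hle⟩, ha, hb, hlarge⟩ := exists_large_of_infinite hμ0 h K
  dsimp only at hpos hle
  obtain ⟨m, hm⟩ := exists_norm_eq_zpow_neg hξ hpos
  have hdvd := (norm_mul_sub_le_iff hξ a b m).1 hm.le
  set t : ℝ := ((|a * b| : ℤ) : ℝ) with ht
  have ht1 : (1 : ℝ) ≤ t := by rw [ht]; exact_mod_cast Int.one_le_abs (mul_ne_zero ha hb)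
  have hKt : (K : ℝ) < t := by rw [ht]; exact_mod_cast hlarge
  have hpow : t ^ (μ / 2) ≤ (p : ℝ) ^ m := by
    rw [hm, neg_div, Real.rpow_neg (by linarith), zpow_neg, zpow_natCast] at hle
    exact (inv_le_inv₀ (by positivity) (by positivity)).1 hle
  have htm : 2 * t < (p : ℝ) ^ m := by
    refine lt_of_lt_of_le ?_ hpow
    have h1 : t ^ (μ / 2) = t ^ (μ / 2 - 1) * t := by
      rw [← Real.rpow_add_one (by linarith)]; congr 1; ring
    have h2 : (K : ℝ) ^ (μ / 2 - 1) ≤ t ^ (μ / 2 - 1) :=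
      Real.rpow_le_rpow (Nat.cast_nonneg K) hKt.le (by linarith)
    rw [h1]
    exact mul_lt_mul_of_pos_right (by linarith) (by linarith)
  have hMm : M₀ + M₁ + 1 ≤ m := by
    have h1 : (p : ℝ) ^ (M₀ + M₁ + 1) ≤ K := by exact_mod_cast hK
    exact (pow_le_pow_iff_right₀ hp).1 (by linarith)
  have hm0 : (0 : ℝ) < m := by
    have : 0 < m := by omega
    exact_mod_cast this
  obtain ⟨r, hr, hr3⟩ := exists_mem_partDens_of_dvd hp0 ha hb hdvd
    (by rw [ht] at htm; exact_mod_cast htm)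
  have hr3' : (p : ℝ) ^ m ≤ 3 * r * t := by rw [ht]; exact_mod_cast hr3
  have hr1 : (1 : ℝ) ≤ r := by exact_mod_cast one_le_of_mem_partDens hr
  have hrmax := le_maxPartQuot hp0 hr
  refine ⟨m, by omega, ?_⟩
  have hlog1 : μ / 2 * Real.logb p t ≤ m := by
    rw [← Real.logb_rpow_eq_mul_logb_of_pos (by linarith)]
    rw [Real.logb_le_iff_le_rpow hp (by positivity), Real.rpow_natCast]
    exact hpow
  have hlog2 : (m : ℝ) ≤ Real.logb p 3 + Real.logb p r + Real.logb p t := by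
    rw [← Real.logb_mul (by norm_num) (by linarith), ← Real.logb_mul (by positivity) (by linarith),
      Real.le_logb_iff_rpow_le hp (by positivity), Real.rpow_natCast]
    exact hr3'
  have hlog3 : Real.logb p r ≤ Real.logb p (maxPartQuot (xm p c m)) :=
    Real.logb_le_logb_of_le hp (by linarith) hrmax
  have hlog4 : Real.logb p t ≤ 2 / μ * m := by
    rw [div_mul_eq_mul_div, le_div_iff₀ hμ0]
    linarith
  have hlog5 : Real.logb p 3 ≤ ε * m := by
    rw [div_lt_iff₀ hε] at hM₁
    have : (M₁ : ℝ) ≤ m := by exact_mod_cast (by omega : M₁ ≤ m)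
    nlinarith
  rw [etaSeq, le_div_iff₀ hm0]
  linarith

end Padic

theorem multIrrExp_eq (p : ℕ) [Fact p.Prime] (c : ℕ → ℤ)
    (hc : ∃ B : ℝ, ∀ k, |(c k : ℝ)| ≤ B)
    (ξ : ℚ_[p]) (hξ : ξ = ∑' k : ℕ, (c k : ℚ_[p]) * (p : ℚ_[p]) ^ k)
    (hirr : ∀ q : ℚ, ξ ≠ (q : ℚ_[p])) :
    multIrrExp p ξ =
      if limsup (etaSeq p c) atTop = 1 then (⊤ : EReal)
      else ((2 / (1 - limsup (etaSeq p c) atTop) : ℝ) : EReal) := by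
  have hp1 := (Fact.out : p.Prime).one_lt
  obtain ⟨hη0, hη1⟩ := limsup_etaSeq_mem_Icc hp1 c
  set η := limsup (etaSeq p c) atTop with hη
  have hset : multIrrExp p ξ =
      sSup {e : EReal | ∃ μ : ℝ, e = (μ : EReal) ∧ (goodApproximations ξ μ).Infinite} := rfl
  rw [hset]
  split_ifs with h1
  · refine EReal.eq_top_iff_forall_lt _ |>.2 fun y => ?_
    refine lt_of_lt_of_le (b := ((max y 0 + 1 : ℝ) : EReal)) ?_ (le_sSup ⟨_, rfl, ?_⟩)
    · exact_mod_cast lt_of_le_of_lt (le_max_left y 0) (lt_add_one _)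
    · refine infinite_goodApproximations hξ hirr (by positivity) ?_
      rw [← hη, h1]
      norm_num
  · have hpos : 0 < 1 - η := by
      have := lt_of_le_of_ne hη1 h1
      linarith
    refine le_antisymm (sSup_le ?_) ?_
    · rintro _ ⟨μ, rfl, hμ⟩
      rw [EReal.coe_le_coe_iff, le_div_iff₀ hpos]
      exact mul_one_sub_limsup_le_two hξ hμ
    · refine le_of_forall_lt fun e he => ?_
      obtain ⟨y, hey, hy⟩ := EReal.lt_iff_exists_real_btwn.1 he
      rw [EReal.coe_lt_coe_iff] at hy
      have h0 : 0 < 2 / (1 - η) := by positivity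
      obtain ⟨μ, hμ1, hμ2⟩ := exists_between (max_lt hy h0)
      have hyμ : (y : EReal) ≤ (μ : EReal) :=
        EReal.coe_le_coe_iff.2 ((le_max_left y 0).trans hμ1.le)
      refine lt_of_lt_of_le hey (hyμ.trans (le_sSup ⟨μ, rfl, ?_⟩))
      refine infinite_goodApproximations hξ hirr ((le_max_right y 0).trans_lt hμ1) ?_
      rwa [lt_div_iff₀ hpos] at hμ2
end
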